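/- Let N ≥ 3, let p ≥ q > 1/3 with p > (q+1)/(3q−1), let a, b > −2, and assume the quadruple (p,q,a,b) is subcritical. Let (u,v) be a positive solution of the Hénon–Lane–Emden system (HLE) such that there exists C > 0 with |x|^a v(x)^{p+1} ≤ C |x|^b u(x)^{q+1} for all x ∈ ℝ^N ∖ {0}. Suppose there exist R₅ > R₀ > 0 and R* > 0 such that for every R ≥ R* and every twice continuously differentiable function φ with compact support contained in the open annulus B_{R R₅} ∖ cl(B_{R R₀}), one has √(pq) ∫ |x|^{(a+b)/2} u(x)^{(q−1)/2} v(x)^{(p−1)/2} φ(x)² dx ≤ ∫ |∇φ(x)|² dx. Then u ≡ 0 and v ≡ 0 on ℝ^N. -/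

import Mathlib

open MeasureTheory Metric Set

noncomputable section

/-- Euclidean space `ℝ^N`. -/
abbrev Euc (N : ℕ) := EuclideanSpace ℝ (Fin N)

/-- The Laplacian of a function `f : ℝ^N → ℝ`, as the sum of the pure second
partial derivatives. -/
def lap {N : ℕ} (f : Euc N → ℝ) (x : Euc N) : ℝ :=
  ∑ i : Fin N, iteratedFDeriv ℝ 2 f x ![EuclideanSpace.single i 1, EuclideanSpace.single i 1]

/-- `(u, v)` is a solution of the Hénon–Lane–Emden system
`-Δu = |x|^a |v|^{p-1} v`, `-Δv = |x|^b |u|^{q-1} u` on `ℝ^N \ {0}`: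
`u, v` are `C²` on `ℝ^N \ {0}`, continuous on `ℝ^N`, and satisfy the equations pointwise. -/
def IsHLESol {N : ℕ} (p q a b : ℝ) (u v : Euc N → ℝ) : Prop :=
  ContDiffOn ℝ 2 u {x : Euc N | x ≠ 0} ∧ ContDiffOn ℝ 2 v {x : Euc N | x ≠ 0} ∧
  Continuous u ∧ Continuous v ∧
  (∀ x : Euc N, x ≠ 0 → -lap u x = ‖x‖ ^ a * (|v x| ^ (p - 1) * v x)) ∧
  (∀ x : Euc N, x ≠ 0 → -lap v x = ‖x‖ ^ b * (|u x| ^ (q - 1) * u x))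

/-- Stability of a (positive) solution of the Hénon–Lane–Emden system on an open set `Ω`:
there exist positive `C²` functions `ξ, ζ` on `Ω` with
`-Δξ ≥ p |x|^a v^{p-1} ζ` and `-Δζ ≥ q |x|^b u^{q-1} ξ` on `Ω`. -/
def HLEStableOn {N : ℕ} (p q a b : ℝ) (u v : Euc N → ℝ) (Ω : Set (Euc N)) : Prop :=
  ∃ ξ ζ : Euc N → ℝ, ContDiffOn ℝ 2 ξ Ω ∧ ContDiffOn ℝ 2 ζ Ω ∧
    (∀ x ∈ Ω, 0 < ξ x) ∧ (∀ x ∈ Ω, 0 < ζ x) ∧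
    (∀ x ∈ Ω, p * ‖x‖ ^ a * v x ^ (p - 1) * ζ x ≤ -lap ξ x) ∧
    (∀ x ∈ Ω, q * ‖x‖ ^ b * u x ^ (q - 1) * ξ x ≤ -lap ζ x)

/-- Stability outside a compact set `K`: stability on every open set whose closure is
compact and contained in `ℝ^N \ K`. -/
def HLEStableOutside {N : ℕ} (p q a b : ℝ) (u v : Euc N → ℝ) (K : Set (Euc N)) : Prop :=
  IsCompact K ∧
    ∀ Ω : Set (Euc N), IsOpen Ω → IsCompact (closure Ω) → closure Ω ⊆ Kᶜ →
      HLEStableOn p q a b u v Ω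

/-- `(u, v)` solves the Lane–Emden system `-Δu = |v|^{p-1} v`, `-Δv = |u|^{q-1} u` on `ℝ^N`. -/
def IsLESol {N : ℕ} (p q : ℝ) (u v : Euc N → ℝ) : Prop :=
  (∀ x : Euc N, -lap u x = |v x| ^ (p - 1) * v x) ∧
  (∀ x : Euc N, -lap v x = |u x| ^ (q - 1) * u x)

/-- Stability of a (positive) solution of the Lane–Emden system on an open set `Ω`. -/
def LEStableOn {N : ℕ} (p q : ℝ) (u v : Euc N → ℝ) (Ω : Set (Euc N)) : Prop :=
  ∃ ξ ζ : Euc N → ℝ, ContDiffOn ℝ 2 ξ Ω ∧ ContDiffOn ℝ 2 ζ Ω ∧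
    (∀ x ∈ Ω, 0 < ξ x) ∧ (∀ x ∈ Ω, 0 < ζ x) ∧
    (∀ x ∈ Ω, p * v x ^ (p - 1) * ζ x ≤ -lap ξ x) ∧
    (∀ x ∈ Ω, q * u x ^ (q - 1) * ξ x ≤ -lap ζ x)

/-- A function on `ℝ^N` is polynomially bounded. -/
def PolyBounded {N : ℕ} (w : Euc N → ℝ) : Prop :=
  ∃ K L R : ℝ, 0 < K ∧ 0 < L ∧ ∀ x : Euc N, R ≤ ‖x‖ → |w x| ≤ K * ‖x‖ ^ L

/-- The polynomial `G` from Theorem 1.4 (iii). -/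
def Gpoly (p q x : ℝ) : ℝ :=
  x ^ 4 - (4 * p * q * (q + 1) / (p + 1)) * x ^ 2 +
    (2 * p * q * (q + 1) * (p + q + 2) / (p + 1) ^ 2) * x -
    p * q * (q + 1) ^ 2 / (p + 1) ^ 2

section Gradient

variable {N : ℕ}

lemma gradient_mul {f g : Euc N → ℝ} {x : Euc N} (hf : DifferentiableAt ℝ f x)
    (hg : DifferentiableAt ℝ g x) :
    gradient (fun y => f y * g y) x = f x • gradient g x + g x • gradient f x := by
  simp [gradient, fderiv_fun_mul hf hg]

lemma gradient_rpow_const {f : Euc N → ℝ} {x : Euc N} (hf : DifferentiableAt ℝ f x)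
    (h0 : 0 < f x) (r : ℝ) :
    gradient (fun y => f y ^ r) x = (r * f x ^ (r - 1)) • gradient f x := by
  have h := (hf.hasFDerivAt.rpow_const (p := r) (Or.inl h0.ne')).fderiv
  simp only [gradient, h]
  simp

lemma gradient_eq_zero_of_notMem_tsupport {f : Euc N → ℝ} {x : Euc N} (hx : x ∉ tsupport f) :
    gradient f x = 0 := by
  have : fderiv ℝ f x = 0 := by
    by_contra h
    exact hx (support_fderiv_subset ℝ h)
  simp [gradient, this]

lemma isOpen_ne_zero : IsOpen {x : Euc N | x ≠ 0} := isOpen_ne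

lemma ContDiffOn.contDiffAt_punctured {n : WithTop ℕ∞} {E : Type*} [NormedAddCommGroup E]
    [NormedSpace ℝ E] {f : Euc N → E}
    (hf : ContDiffOn ℝ n f {x : Euc N | x ≠ 0}) {x : Euc N} (hx : x ≠ 0) : ContDiffAt ℝ n f x :=
  hf.contDiffAt (isOpen_ne_zero.mem_nhds hx)

lemma ContDiffOn.differentiableAt_punctured {f : Euc N → ℝ}
    (hf : ContDiffOn ℝ 2 f {x : Euc N | x ≠ 0}) {x : Euc N} (hx : x ≠ 0) :
    DifferentiableAt ℝ f x :=
  (hf.contDiffAt_punctured hx).differentiableAt (by norm_num)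

lemma ContDiffOn.contDiffOn_fderiv_punctured {f : Euc N → ℝ}
    (hf : ContDiffOn ℝ 2 f {x : Euc N | x ≠ 0}) :
    ContDiffOn ℝ 1 (fderiv ℝ f) {x : Euc N | x ≠ 0} :=
  hf.fderiv_of_isOpen isOpen_ne_zero (by norm_num)

lemma ContDiffOn.contDiffOn_gradient_punctured {f : Euc N → ℝ}
    (hf : ContDiffOn ℝ 2 f {x : Euc N | x ≠ 0}) :
    ContDiffOn ℝ 1 (gradient f) {x : Euc N | x ≠ 0} :=
  ((InnerProductSpace.toDual ℝ (Euc N)).symm.toContinuousLinearEquiv.contDiff.comp_contDiffOn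
    hf.contDiffOn_fderiv_punctured :)

lemma ContDiffOn.continuousOn_gradient_punctured {f : Euc N → ℝ}
    (hf : ContDiffOn ℝ 2 f {x : Euc N | x ≠ 0}) :
    ContinuousOn (gradient f) {x : Euc N | x ≠ 0} :=
  hf.contDiffOn_gradient_punctured.continuousOn

lemma ContDiff.continuous_gradient {f : Euc N → ℝ} (hf : ContDiff ℝ 1 f) :
    Continuous (gradient f) :=
  (InnerProductSpace.toDual ℝ (Euc N)).symm.continuous.comp (hf.continuous_fderiv (by norm_num))

lemma contDiff_mul_of_tsupport_subset {n : WithTop ℕ∞} {φ g : Euc N → ℝ} (hφ : ContDiff ℝ n φ)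
    (hs : tsupport φ ⊆ {x : Euc N | x ≠ 0}) (hg : ContDiffOn ℝ n g {x : Euc N | x ≠ 0}) :
    ContDiff ℝ n (fun x => φ x * g x) := by
  rw [contDiff_iff_contDiffAt]
  intro x
  by_cases hx : x ∈ tsupport φ
  · exact hφ.contDiffAt.mul (hg.contDiffAt_punctured (hs hx))
  · have : (fun x => φ x * g x) =ᶠ[nhds x] fun _ => 0 := by
      filter_upwards [(isClosed_tsupport φ).isOpen_compl.mem_nhds hx] with y hy
      simp [image_eq_zero_of_notMem_tsupport hy]
    exact contDiffAt_const.congr_of_eventuallyEq this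

lemma integrable_of_continuousOn_punctured {F : Euc N → ℝ} {K : Set (Euc N)} (hK : IsCompact K)
    (hK0 : K ⊆ {x : Euc N | x ≠ 0}) (hF : ContinuousOn F {x : Euc N | x ≠ 0})
    (h0 : ∀ x, x ∉ K → F x = 0) : Integrable F := by
  have h := (hF.mono hK0).integrableOn_compact (μ := volume) hK
  refine (integrableOn_iff_integrable_of_support_subset ?_).1 h
  intro x hx
  by_contra h
  exact hx (h0 x h)

end Gradient

section Weak

variable {N : ℕ}

lemma integral_fderiv_apply_eq_zero {h : Euc N → ℝ} (hh : ContDiff ℝ 1 h)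
    (hc : HasCompactSupport h) (e : Euc N) : ∫ x, fderiv ℝ h x e = 0 := by
  have hd : Integrable (fun x => fderiv ℝ h x e) :=
    ((hh.continuous_fderiv (by norm_num)).clm_apply continuous_const).integrable_of_hasCompactSupport
      (hc.fderiv_apply ℝ e)
  have := integral_mul_fderiv_eq_neg_fderiv_mul_of_integrable (μ := (volume : Measure (Euc N)))
    (f := fun _ => (1 : ℝ)) (g := h) (v := e)
    (by simp) (by simpa using hd)
    (by simpa using hh.continuous.integrable_of_hasCompactSupport hc)
    (by intro x _; fun_prop) (by intro x _; exact hh.differentiable (by norm_num) x)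
  simpa using this

lemma clm_apply_eq_sum (L : Euc N →L[ℝ] ℝ) (x : Euc N) :
    L x = ∑ i, x i * L (EuclideanSpace.single i 1) := by
  have hx : x = ∑ i, x i • EuclideanSpace.single i (1 : ℝ) := by
    have := (EuclideanSpace.basisFun (Fin N) ℝ).sum_repr x
    simpa using this.symm
  conv_lhs => rw [hx]
  simp

lemma integral_fderiv_self_eq {ψ : Euc N → ℝ} (hψ : ContDiff ℝ 1 ψ)
    (hc : HasCompactSupport ψ) : ∫ x, fderiv ℝ ψ x x = -(N : ℝ) * ∫ x, ψ x := by
  have hcont : ∀ i : Fin N, Continuous fun x : Euc N => x i := fun i => by fun_prop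
  have hI : ∀ i : Fin N, Integrable
      (fun x : Euc N => x i * fderiv ℝ ψ x (EuclideanSpace.single i 1)) := fun i =>
    ((hcont i).mul ((hψ.continuous_fderiv (by norm_num)).clm_apply
      continuous_const)).integrable_of_hasCompactSupport
      ((hc.fderiv_apply ℝ _).mul_left)
  have hf : ∀ (i : Fin N) (x : Euc N),
      fderiv ℝ (fun x : Euc N => x i) x (EuclideanSpace.single i 1) = 1 := by
    intro i x
    have : HasFDerivAt (fun x : Euc N => x i) (EuclideanSpace.proj i : Euc N →L[ℝ] ℝ) x :=
      (EuclideanSpace.proj i : Euc N →L[ℝ] ℝ).hasFDerivAt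
    rw [this.fderiv]
    simp
  have key : ∀ i : Fin N,
      ∫ x : Euc N, x i * fderiv ℝ ψ x (EuclideanSpace.single i 1) = -∫ x, ψ x := by
    intro i
    have hψi := hψ.continuous.integrable_of_hasCompactSupport (μ := volume) hc
    rw [integral_mul_fderiv_eq_neg_fderiv_mul_of_integrable (μ := (volume : Measure (Euc N)))
      (f := fun x => x i) (g := ψ) (by simpa [hf] using hψi) (hI i)
      (((hcont i).mul hψ.continuous).integrable_of_hasCompactSupport hc.mul_left)
      (by intro x _; fun_prop) (by intro x _; exact hψ.differentiable (by norm_num) x)]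
    simp [hf]
  simp_rw [fun x => clm_apply_eq_sum (fderiv ℝ ψ x) x]
  rw [integral_finsetSum _ fun i _ => hI i]
  simp [key]

lemma lap_eq_sum (u : Euc N → ℝ) (x : Euc N) : lap u x = ∑ i : Fin N,
    fderiv ℝ (fderiv ℝ u) x (EuclideanSpace.single i 1) (EuclideanSpace.single i 1) := by
  simp [lap, iteratedFDeriv_two_apply]

lemma continuousOn_lap {u : Euc N → ℝ} (hu : ContDiffOn ℝ 2 u {x : Euc N | x ≠ 0}) :
    ContinuousOn (lap u) {x : Euc N | x ≠ 0} := by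
  have h : ContinuousOn (fderiv ℝ (fderiv ℝ u)) {x : Euc N | x ≠ 0} :=
    hu.contDiffOn_fderiv_punctured.continuousOn_fderiv_of_isOpen isOpen_ne_zero (by norm_num)
  simp_rw [funext (lap_eq_sum u)]
  refine continuousOn_finsetSum _ fun i _ => ?_
  exact (h.clm_apply continuousOn_const).clm_apply continuousOn_const

/-- Green's identity for functions that are `C²` away from the origin. -/
lemma integral_inner_gradient_eq {u φ : Euc N → ℝ} (hu : ContDiffOn ℝ 2 u {x : Euc N | x ≠ 0})
    (hφ : ContDiff ℝ 1 φ) (hc : HasCompactSupport φ) (hs : tsupport φ ⊆ {x : Euc N | x ≠ 0}) :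
    ∫ x, inner ℝ (gradient u x) (gradient φ x) = ∫ x, -lap u x * φ x := by
  set e : Fin N → Euc N := fun i => EuclideanSpace.single i 1 with he
  set ψ : Fin N → Euc N → ℝ := fun i x => φ x * fderiv ℝ u x (e i) with hψd
  have hd : ∀ i, ContDiffOn ℝ 1 (fun x => fderiv ℝ u x (e i)) {x : Euc N | x ≠ 0} := fun i =>
    hu.contDiffOn_fderiv_punctured.clm_apply contDiffOn_const
  have hψ : ∀ i, ContDiff ℝ 1 (ψ i) := fun i => contDiff_mul_of_tsupport_subset hφ hs (hd i)
  have hψc : ∀ i, HasCompactSupport (ψ i) := fun i => hc.mul_right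
  have hpt : ∀ x, ∑ i, fderiv ℝ (ψ i) x (e i) =
      inner ℝ (gradient u x) (gradient φ x) - -lap u x * φ x := by
    intro x
    by_cases hx : x ∈ tsupport φ
    · have hx0 : x ≠ 0 := hs hx
      have h1 : ∀ i, fderiv ℝ (ψ i) x (e i) =
          φ x * fderiv ℝ (fderiv ℝ u) x (e i) (e i) + fderiv ℝ u x (e i) * fderiv ℝ φ x (e i) := by
        intro i
        have hdi : DifferentiableAt ℝ (fun x => fderiv ℝ u x (e i)) x :=
          ((hd i).contDiffAt_punctured hx0).differentiableAt (by norm_num)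
        have hdu : DifferentiableAt ℝ (fderiv ℝ u) x :=
          (hu.contDiffOn_fderiv_punctured.contDiffAt_punctured hx0).differentiableAt (by norm_num)
        simp only [hψd]
        rw [fderiv_fun_mul (hφ.differentiable (by norm_num) x) hdi,
          fderiv_clm_apply hdu (differentiableAt_const _)]
        simp
      rw [Finset.sum_congr rfl fun i _ => h1 i, Finset.sum_add_distrib, ← Finset.mul_sum,
        ← lap_eq_sum, inner_gradient_right, clm_apply_eq_sum]
      have : ∀ i, (gradient u x) i = fderiv ℝ u x (e i) := by
        intro i
        have h := inner_gradient_left (f := u) (x := x) (y := e i)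
        rw [he, EuclideanSpace.inner_single_right] at h
        simpa using h
      simp [this]
      ring
    · have hz : ∀ i, ψ i =ᶠ[nhds x] fun _ => 0 := fun i => by
        filter_upwards [(isClosed_tsupport φ).isOpen_compl.mem_nhds hx] with y hy
        simp [hψd, image_eq_zero_of_notMem_tsupport hy]
      have hz' : ∀ i, fderiv ℝ (ψ i) x = 0 := fun i => by rw [(hz i).fderiv_eq]; simp
      simp [hz', gradient_eq_zero_of_notMem_tsupport hx,
        image_eq_zero_of_notMem_tsupport hx]
  have hI1 : Integrable fun x => inner ℝ (gradient u x) (gradient φ x) :=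
    integrable_of_continuousOn_punctured hc.isCompact hs
      (hu.continuousOn_gradient_punctured.inner hφ.continuous_gradient.continuousOn)
      (fun x hx => by simp [gradient_eq_zero_of_notMem_tsupport hx])
  have hI2 : Integrable fun x => -lap u x * φ x :=
    integrable_of_continuousOn_punctured hc.isCompact hs
      ((continuousOn_lap hu).neg.mul hφ.continuous.continuousOn)
      (fun x hx => by simp [image_eq_zero_of_notMem_tsupport hx])
  have h0 : ∫ x, ∑ i, fderiv ℝ (ψ i) x (e i) = 0 := by
    rw [integral_finsetSum _ fun i _ => ?_]
    · exact Finset.sum_eq_zero fun i _ => integral_fderiv_apply_eq_zero (hψ i) (hψc i) _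
    · exact (((hψ i).continuous_fderiv (by norm_num)).clm_apply
        continuous_const).integrable_of_hasCompactSupport ((hψc i).fderiv_apply ℝ _)
  rw [integral_congr_ae (Filter.Eventually.of_forall hpt), integral_sub hI1 hI2] at h0
  linarith

end Weak

section Local

variable {N : ℕ} {K : Set (Euc N)}

lemma ContinuousOn.integrableOn_punctured {F : Euc N → ℝ}
    (hF : ContinuousOn F {x : Euc N | x ≠ 0}) (hK : IsCompact K)
    (hK0 : K ⊆ {x : Euc N | x ≠ 0}) : IntegrableOn F K :=
  (hF.mono hK0).integrableOn_compact hK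

lemma ContinuousOn.rpow_of_pos {f : Euc N → ℝ} {s : Set (Euc N)} (hf : ContinuousOn f s)
    (h0 : ∀ x, 0 < f x) (r : ℝ) : ContinuousOn (fun x => f x ^ r) s :=
  hf.rpow_const fun x _ => Or.inl (h0 x).ne'

lemma ContDiffOn.rpow_of_pos {n : WithTop ℕ∞} {f : Euc N → ℝ} {s : Set (Euc N)}
    (hf : ContDiffOn ℝ n f s) (h0 : ∀ x, 0 < f x) (r : ℝ) :
    ContDiffOn ℝ n (fun x => f x ^ r) s :=
  hf.rpow_const_of_ne fun x _ => (h0 x).ne'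

lemma tsupport_mul_subset' {φ g : Euc N → ℝ} (h : tsupport φ ⊆ K) :
    tsupport (fun x => φ x * g x) ⊆ K :=
  (tsupport_mul_subset_left (f := φ) (g := g)).trans h

lemma setIntegral_inner_gradient_mul_sq (hK : IsCompact K) (hK0 : K ⊆ {x : Euc N | x ≠ 0})
    {u g ω : Euc N → ℝ} (hu : ContDiffOn ℝ 2 u {x : Euc N | x ≠ 0})
    (hg : ContDiffOn ℝ 1 g {x : Euc N | x ≠ 0}) (hω : ContDiff ℝ 1 ω) (hs : tsupport ω ⊆ K) :
    ∫ x in K, (ω x ^ 2 * inner ℝ (gradient u x) (gradient g x)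
        + 2 * (ω x * g x * inner ℝ (gradient u x) (gradient ω x)))
      = ∫ x in K, -lap u x * (g x * ω x ^ 2) := by
  have hω2 : ContDiffOn ℝ 1 (fun x => ω x * g x) {x : Euc N | x ≠ 0} := hω.contDiffOn.mul hg
  have hφ : ContDiff ℝ 1 (fun x => ω x * (ω x * g x)) :=
    contDiff_mul_of_tsupport_subset hω (hs.trans hK0) hω2
  have hφs : tsupport (fun x => ω x * (ω x * g x)) ⊆ K := tsupport_mul_subset' hs
  have hφc : HasCompactSupport (fun x => ω x * (ω x * g x)) :=
    hK.of_isClosed_subset (isClosed_tsupport _) hφs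
  have h := integral_inner_gradient_eq hu hφ hφc (hφs.trans hK0)
  have hl : ∫ x in K, inner ℝ (gradient u x) (gradient (fun x => ω x * (ω x * g x)) x) =
      ∫ x, inner ℝ (gradient u x) (gradient (fun x => ω x * (ω x * g x)) x) :=
    setIntegral_eq_integral_of_forall_compl_eq_zero fun x hx => by
      rw [gradient_eq_zero_of_notMem_tsupport fun h => hx (hφs h), inner_zero_right]
  have hr : ∫ x in K, -lap u x * (ω x * (ω x * g x)) = ∫ x, -lap u x * (ω x * (ω x * g x)) :=
    setIntegral_eq_integral_of_forall_compl_eq_zero fun x hx => by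
      rw [image_eq_zero_of_notMem_tsupport fun h => hx (hs h), zero_mul, mul_zero]
  rw [← hl, ← hr] at h
  refine Eq.trans (setIntegral_congr_fun hK.measurableSet fun x hx => ?_) (h.trans
    (setIntegral_congr_fun hK.measurableSet fun x _ => ?_))
  · have hx0 : x ≠ 0 := hK0 hx
    have hωd : DifferentiableAt ℝ ω x := hω.differentiable (by norm_num) x
    have hgd : DifferentiableAt ℝ g x :=
      (hg.contDiffAt_punctured hx0).differentiableAt (by norm_num)
    simp only [gradient_mul hωd (hωd.fun_mul hgd), gradient_mul hωd hgd, inner_add_right,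
      inner_smul_right, smul_add]
    ring
  · ring

lemma setIntegral_rpow_mul_sq (hK : IsCompact K) (hK0 : K ⊆ {x : Euc N | x ≠ 0})
    {u ω : Euc N → ℝ} (hu : ContDiffOn ℝ 2 u {x : Euc N | x ≠ 0}) (hu0 : ∀ x, 0 < u x)
    (hω : ContDiff ℝ 1 ω) (hs : tsupport ω ⊆ K) (r : ℝ) :
    ∫ x in K, (r * (u x ^ (r - 1) * ‖gradient u x‖ ^ 2 * ω x ^ 2)
        + 2 * (u x ^ r * ω x * inner ℝ (gradient u x) (gradient ω x)))
      = ∫ x in K, -lap u x * (u x ^ r * ω x ^ 2) := by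
  rw [← setIntegral_inner_gradient_mul_sq hK hK0 hu
    ((hu.of_le (by norm_num)).rpow_of_pos hu0 r) hω hs]
  refine setIntegral_congr_fun hK.measurableSet fun x hx => ?_
  simp only [gradient_rpow_const (hu.differentiableAt_punctured (hK0 hx)) (hu0 x),
    inner_smul_right, real_inner_self_eq_norm_sq]
  ring

/-- Positive supersolutions yield a Hardy type inequality. -/
lemma setIntegral_hardy (hK : IsCompact K) (hK0 : K ⊆ {x : Euc N | x ≠ 0})
    {u ω : Euc N → ℝ} (hu : ContDiffOn ℝ 2 u {x : Euc N | x ≠ 0}) (hu0 : ∀ x, 0 < u x)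
    (hω : ContDiff ℝ 1 ω) (hs : tsupport ω ⊆ K) :
    (∫ x in K, -lap u x * (u x ^ (-1 : ℝ) * ω x ^ 2))
        + 1 / 2 * ∫ x in K, u x ^ (-2 : ℝ) * ‖gradient u x‖ ^ 2 * ω x ^ 2
      ≤ 2 * ∫ x in K, ‖gradient ω x‖ ^ 2 := by
  have h := setIntegral_rpow_mul_sq hK hK0 hu hu0 hω hs (-1)
  have hcu := fun r => hu.continuousOn.rpow_of_pos hu0 r
  have hgu := hu.continuousOn_gradient_punctured
  have hcω : ContinuousOn ω {x : Euc N | x ≠ 0} := hω.continuous.continuousOn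
  have hgω : ContinuousOn (gradient ω) {x : Euc N | x ≠ 0} := hω.continuous_gradient.continuousOn
  have i1 : IntegrableOn (fun x => u x ^ (-2 : ℝ) * ‖gradient u x‖ ^ 2 * ω x ^ 2) K :=
    ContinuousOn.integrableOn_punctured (((hcu (-2)).mul (hgu.norm.pow 2)).mul (hcω.pow 2)) hK hK0
  have i2 : IntegrableOn (fun x => ‖gradient ω x‖ ^ 2) K :=
    ContinuousOn.integrableOn_punctured (hgω.norm.pow 2) hK hK0
  have i3 : IntegrableOn (fun x => (-1) * (u x ^ ((-1 : ℝ) - 1) * ‖gradient u x‖ ^ 2 * ω x ^ 2)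
        + 2 * (u x ^ (-1 : ℝ) * ω x * inner ℝ (gradient u x) (gradient ω x))) K :=
    ContinuousOn.integrableOn_punctured ((continuousOn_const.mul
      (((hcu _).mul (hgu.norm.pow 2)).mul (hcω.pow 2))).add
      (continuousOn_const.mul (((hcu _).mul hcω).mul (hgu.inner hgω)))) hK hK0
  rw [← h, ← integral_const_mul, ← integral_const_mul, ← integral_add i3 (i1.const_mul _)]
  refine setIntegral_mono_on (i3.add (i1.const_mul _)) (i2.const_mul _) hK.measurableSet
    fun x _ => ?_
  have e2 : u x ^ (-2 : ℝ) = u x ^ (-1 : ℝ) * u x ^ (-1 : ℝ) := by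
    rw [← Real.rpow_add (hu0 x)]; norm_num
  have e3 : ((-1 : ℝ) - 1) = -2 := by norm_num
  have hn := sq_nonneg ‖(u x ^ (-1 : ℝ) * ω x) • gradient u x - (2 : ℝ) • gradient ω x‖
  rw [norm_sub_sq_real, norm_smul, norm_smul, inner_smul_left, inner_smul_right, mul_pow, mul_pow,
    Real.norm_eq_abs, Real.norm_eq_abs, sq_abs, sq_abs] at hn
  simp only [conj_trivial] at hn
  rw [e3, e2]
  nlinarith

lemma norm_smul_add_sq_le {q δ : ℝ} (hq : 0 < q) (hδ : 0 < δ) : ∃ c : ℝ, 0 ≤ c ∧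
    ∀ A B : Euc N,
      ‖((q + 1) / 2) • A + B‖ ^ 2 ≤
        ((q + 1) ^ 2 / (4 * q)) * (1 + δ) * (q * ‖A‖ ^ 2 + 2 * inner ℝ A B) + c * ‖B‖ ^ 2 ∧
      ‖A‖ ^ 2 ≤ 2 / q * (q * ‖A‖ ^ 2 + 2 * inner ℝ A B) + c * ‖B‖ ^ 2 := by
  set t := (q + 1) / 2 with ht
  have ht0 : 0 < t := by positivity
  set κ := 2 * (t ^ 2 / q) * (1 + δ) - 2 * t with hκ
  have aux : ∀ (α κ : ℝ) (_ : 0 < α) (A B : Euc N),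
      0 ≤ α * ‖A‖ ^ 2 + κ * inner ℝ A B + κ ^ 2 / (4 * α) * ‖B‖ ^ 2 := by
    intro α κ hα A B
    have h := sq_nonneg ‖(2 * α) • A + κ • B‖
    rw [norm_add_sq_real, norm_smul, norm_smul, inner_smul_left, inner_smul_right, mul_pow,
      mul_pow, Real.norm_eq_abs, Real.norm_eq_abs, sq_abs, sq_abs] at h
    simp only [conj_trivial] at h
    have : α * ‖A‖ ^ 2 + κ * inner ℝ A B + κ ^ 2 / (4 * α) * ‖B‖ ^ 2 =
      ((2 * α) ^ 2 * ‖A‖ ^ 2 + 2 * (2 * α * (κ * inner ℝ A B)) + κ ^ 2 * ‖B‖ ^ 2) / (4 * α) := by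
      field_simp; ring
    rw [this]; positivity
  refine ⟨1 + κ ^ 2 / (4 * (t ^ 2 * δ)) + (4 / q) ^ 2 / (4 * 1), by positivity, fun A B => ?_⟩
  have h1 := aux (t ^ 2 * δ) κ (by positivity) A B
  have h2 := aux 1 (4 / q) (by positivity) A B
  have hn : ‖t • A + B‖ ^ 2 = t ^ 2 * ‖A‖ ^ 2 + 2 * (t * inner ℝ A B) + ‖B‖ ^ 2 := by
    rw [norm_add_sq_real, norm_smul, inner_smul_left, mul_pow, Real.norm_eq_abs, sq_abs]
    simp
  have hB := sq_nonneg ‖B‖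
  constructor
  · rw [hn]
    have e1 : (q + 1) ^ 2 / (4 * q) * (1 + δ) * (q * ‖A‖ ^ 2 + 2 * inner ℝ A B) =
        t ^ 2 * ‖A‖ ^ 2 + t ^ 2 * δ * ‖A‖ ^ 2 + (κ + 2 * t) * inner ℝ A B := by
      rw [hκ, ht]; field_simp; ring
    rw [e1]
    have : 0 ≤ (4 / q) ^ 2 / (4 * 1) * ‖B‖ ^ 2 := by positivity
    linarith
  · have e1 : 2 / q * (q * ‖A‖ ^ 2 + 2 * inner ℝ A B) =
        2 * ‖A‖ ^ 2 + 4 / q * inner ℝ A B := by field_simp; ring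
    rw [e1]
    have : 0 ≤ κ ^ 2 / (4 * (t ^ 2 * δ)) * ‖B‖ ^ 2 := by positivity
    linarith

lemma gradient_mul_rpow {u ω : Euc N → ℝ} {x : Euc N} (hu : DifferentiableAt ℝ u x)
    (hω : DifferentiableAt ℝ ω x) (h0 : 0 < u x) (t : ℝ) :
    gradient (fun y => ω y * u y ^ t) x =
      t • ((u x ^ (t - 1) * ω x) • gradient u x) + u x ^ t • gradient ω x := by
  rw [gradient_mul hω (hu.rpow_const (Or.inl h0.ne')), gradient_rpow_const hu h0, smul_smul,
    smul_smul]
  congr 2; ring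

set_option maxHeartbeats 400000 in
/-- Energy estimate for the power `u ^ ((q + 1) / 2)`. -/
lemma setIntegral_energy {q δ : ℝ} (hq : 0 < q) (hδ : 0 < δ) : ∃ c : ℝ, 0 ≤ c ∧
    ∀ (K : Set (Euc N)), IsCompact K → K ⊆ {x : Euc N | x ≠ 0} → ∀ u ω : Euc N → ℝ,
      ContDiffOn ℝ 2 u {x : Euc N | x ≠ 0} → (∀ x, 0 < u x) → ContDiff ℝ 1 ω → tsupport ω ⊆ K →
      (∫ x in K, ‖gradient (fun y => ω y * u y ^ ((q + 1) / 2)) x‖ ^ 2) ≤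
        ((q + 1) ^ 2 / (4 * q)) * (1 + δ) * (∫ x in K, -lap u x * (u x ^ q * ω x ^ 2))
          + c * ∫ x in K, u x ^ (q + 1) * ‖gradient ω x‖ ^ 2 ∧
      (∫ x in K, u x ^ (q - 1) * ‖gradient u x‖ ^ 2 * ω x ^ 2) ≤
        2 / q * (∫ x in K, -lap u x * (u x ^ q * ω x ^ 2))
          + c * ∫ x in K, u x ^ (q + 1) * ‖gradient ω x‖ ^ 2 := by
  obtain ⟨c, hc, hAB⟩ := norm_smul_add_sq_le (N := N) hq hδ
  refine ⟨c, hc, fun K hK hK0 u ω hu hu0 hω hs => ?_⟩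
  have h := setIntegral_rpow_mul_sq hK hK0 hu hu0 hω hs q
  have hcu := fun r => hu.continuousOn.rpow_of_pos hu0 r
  have hgu := hu.continuousOn_gradient_punctured
  have hcω : ContinuousOn ω {x : Euc N | x ≠ 0} := hω.continuous.continuousOn
  have hgω : ContinuousOn (gradient ω) {x : Euc N | x ≠ 0} := hω.continuous_gradient.continuousOn
  have i1 : IntegrableOn (fun x => u x ^ (q - 1) * ‖gradient u x‖ ^ 2 * ω x ^ 2) K :=
    ContinuousOn.integrableOn_punctured (((hcu _).mul (hgu.norm.pow 2)).mul (hcω.pow 2)) hK hK0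
  have i2 : IntegrableOn (fun x => u x ^ (q + 1) * ‖gradient ω x‖ ^ 2) K :=
    ContinuousOn.integrableOn_punctured ((hcu _).mul (hgω.norm.pow 2)) hK hK0
  have i3 : IntegrableOn (fun x => q * (u x ^ (q - 1) * ‖gradient u x‖ ^ 2 * ω x ^ 2)
        + 2 * (u x ^ q * ω x * inner ℝ (gradient u x) (gradient ω x))) K :=
    ContinuousOn.integrableOn_punctured ((continuousOn_const.mul
      (((hcu _).mul (hgu.norm.pow 2)).mul (hcω.pow 2))).add
      (continuousOn_const.mul (((hcu _).mul hcω).mul (hgu.inner hgω)))) hK hK0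
  have hgrad : ∀ x ∈ K, gradient (fun y => ω y * u y ^ ((q + 1) / 2)) x =
      ((q + 1) / 2) • ((u x ^ ((q - 1) / 2) * ω x) • gradient u x)
        + u x ^ ((q + 1) / 2) • gradient ω x := fun x hx => by
    rw [gradient_mul_rpow (hu.differentiableAt_punctured (hK0 hx))
      (hω.differentiable (by norm_num) x) (hu0 x), show (q + 1) / 2 - 1 = (q - 1) / 2 by ring]
  have i4 : IntegrableOn
      (fun x => ‖gradient (fun y => ω y * u y ^ ((q + 1) / 2)) x‖ ^ 2) K := by
    refine IntegrableOn.congr_fun (ContinuousOn.integrableOn_punctured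
      (F := fun x => ‖((q + 1) / 2) • ((u x ^ ((q - 1) / 2) * ω x) • gradient u x)
        + u x ^ ((q + 1) / 2) • gradient ω x‖ ^ 2) ?_ hK hK0) ?_ hK.measurableSet
    · have c1 : ContinuousOn (fun x => (u x ^ ((q - 1) / 2) * ω x) • gradient u x)
          {x : Euc N | x ≠ 0} := ((hcu ((q - 1) / 2)).mul hcω).smul hgu
      have c2 : ContinuousOn (fun x => u x ^ ((q + 1) / 2) • gradient ω x)
          {x : Euc N | x ≠ 0} := (hcu ((q + 1) / 2)).smul hgω
      exact ((c1.const_smul ((q + 1) / 2)).add c2).norm.pow 2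
    · intro x hx
      simp only [hgrad x hx]
  have hpt : ∀ x, ‖(u x ^ ((q - 1) / 2) * ω x) • gradient u x‖ ^ 2 =
        u x ^ (q - 1) * ‖gradient u x‖ ^ 2 * ω x ^ 2 ∧
      inner ℝ ((u x ^ ((q - 1) / 2) * ω x) • gradient u x) (u x ^ ((q + 1) / 2) • gradient ω x) =
        u x ^ q * ω x * inner ℝ (gradient u x) (gradient ω x) ∧
      ‖u x ^ ((q + 1) / 2) • gradient ω x‖ ^ 2 = u x ^ (q + 1) * ‖gradient ω x‖ ^ 2 := by
    intro x
    have e1 : u x ^ (q - 1) = u x ^ ((q - 1) / 2) * u x ^ ((q - 1) / 2) := by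
      rw [← Real.rpow_add (hu0 x)]; ring_nf
    have e2 : u x ^ q = u x ^ ((q - 1) / 2) * u x ^ ((q + 1) / 2) := by
      rw [← Real.rpow_add (hu0 x)]; ring_nf
    have e3 : u x ^ (q + 1) = u x ^ ((q + 1) / 2) * u x ^ ((q + 1) / 2) := by
      rw [← Real.rpow_add (hu0 x)]; ring_nf
    refine ⟨?_, ?_, ?_⟩
    · rw [norm_smul, mul_pow, Real.norm_eq_abs, sq_abs, e1]; ring
    · rw [real_inner_smul_left, real_inner_smul_right, e2]; ring
    · rw [norm_smul, mul_pow, Real.norm_eq_abs, sq_abs, e3]; ring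
  rw [← h]
  simp only [← integral_const_mul]
  rw [← integral_add (i3.const_mul _) (i2.const_mul _),
    ← integral_add (i3.const_mul _) (i2.const_mul _)]
  constructor
  · refine setIntegral_mono_on i4 ((i3.const_mul _).add (i2.const_mul _)) hK.measurableSet
      fun x hx => ?_
    obtain ⟨e1, e2, e3⟩ := hpt x
    have := (hAB ((u x ^ ((q - 1) / 2) * ω x) • gradient u x)
      (u x ^ ((q + 1) / 2) • gradient ω x)).1
    rwa [← hgrad x hx, e1, e2, e3] at this
  · refine setIntegral_mono_on i1 ((i3.const_mul _).add (i2.const_mul _)) hK.measurableSet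
      fun x hx => ?_
    obtain ⟨e1, e2, e3⟩ := hpt x
    have := (hAB ((u x ^ ((q - 1) / 2) * ω x) • gradient u x)
      (u x ^ ((q + 1) / 2) • gradient ω x)).2
    rwa [e1, e2, e3] at this

end Local

@[fun_prop]
lemma continuousOn_rpow_of_forall_ne_zero {X : Type*} [TopologicalSpace X] {f : X → ℝ}
    {s : Set X} {r : ℝ} (hf : ContinuousOn f s) (h : ∀ x ∈ s, f x ≠ 0) :
    ContinuousOn (fun x => f x ^ r) s :=
  hf.rpow_const fun x hx => Or.inl (h x hx)

@[fun_prop]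
lemma continuousOn_real_inner {X : Type*} [TopologicalSpace X] {N : ℕ} {f g : X → Euc N}
    {s : Set X} (hf : ContinuousOn f s) (hg : ContinuousOn g s) :
    ContinuousOn (fun x => inner ℝ (f x) (g x)) s :=
  hf.inner hg

/-- Positive solutions, away from the origin, subject to the comparison estimate. -/
structure IsPosSol {N : ℕ} (p q a b C : ℝ) (u v : Euc N → ℝ) : Prop where
  contDiffOn_fst : ContDiffOn ℝ 2 u {x : Euc N | x ≠ 0}
  contDiffOn_snd : ContDiffOn ℝ 2 v {x : Euc N | x ≠ 0}
  fst_pos : ∀ x, 0 < u x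
  snd_pos : ∀ x, 0 < v x
  lap_fst : ∀ x, x ≠ 0 → -lap u x = ‖x‖ ^ a * v x ^ p
  lap_snd : ∀ x, x ≠ 0 → -lap v x = ‖x‖ ^ b * u x ^ q
  comparison : ∀ x, x ≠ 0 → ‖x‖ ^ a * v x ^ (p + 1) ≤ C * (‖x‖ ^ b * u x ^ (q + 1))

/-- The integral stability inequality for test functions supported in `A`. -/
def StabilityOn {N : ℕ} (p q a b : ℝ) (u v : Euc N → ℝ) (A : Set (Euc N)) : Prop :=
  ∀ φ : Euc N → ℝ, ContDiff ℝ 2 φ → HasCompactSupport φ → tsupport φ ⊆ A →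
    Real.sqrt (p * q) *
        ∫ x : Euc N, ‖x‖ ^ ((a + b) / 2) * u x ^ ((q - 1) / 2) * v x ^ ((p - 1) / 2) * φ x ^ 2
      ≤ ∫ x : Euc N, ‖gradient φ x‖ ^ 2

section Estimates

variable {N : ℕ} {K : Set (Euc N)}

lemma contDiffOn_norm_rpow (r : ℝ) {n : WithTop ℕ∞} :
    ContDiffOn ℝ n (fun x : Euc N => ‖x‖ ^ r) {x : Euc N | x ≠ 0} :=
  (contDiffOn_id.norm ℝ fun _ hx => hx).rpow_const_of_ne fun _ hx => norm_ne_zero_iff.2 hx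

lemma exists_bound_on (hK : IsCompact K) (hK0 : K ⊆ {x : Euc N | x ≠ 0}) {h : Euc N → ℝ}
    (hh : ContinuousOn h {x : Euc N | x ≠ 0}) : ∃ M, 0 < M ∧ ∀ x ∈ K, h x ≤ M := by
  obtain ⟨M, hM⟩ := hK.exists_bound_of_continuousOn (hh.mono hK0)
  exact ⟨|M| + 1, by positivity, fun x hx =>
    (le_abs_self _).trans ((hM x hx).trans ((le_abs_self M).trans (by linarith)))⟩

lemma exists_norm_rpow_le (hK : IsCompact K) (hK0 : K ⊆ {x : Euc N | x ≠ 0}) (r : ℝ) :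
    ∃ M, 0 < M ∧ ∀ x ∈ K, ‖x‖ ^ r ≤ M :=
  exists_bound_on hK hK0 (contDiffOn_norm_rpow (n := 2) r).continuousOn

lemma setIntegral_mono_punctured (hK : IsCompact K) (hK0 : K ⊆ {x : Euc N | x ≠ 0})
    {F G : Euc N → ℝ} (hF : ContinuousOn F {x : Euc N | x ≠ 0})
    (hG : ContinuousOn G {x : Euc N | x ≠ 0}) (h : ∀ x ∈ K, F x ≤ G x) :
    ∫ x in K, F x ≤ ∫ x in K, G x :=
  setIntegral_mono_on (hF.integrableOn_punctured hK hK0) (hG.integrableOn_punctured hK hK0)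
    hK.measurableSet h

lemma contDiff_pow_mul {n : WithTop ℕ∞} {ζ w : Euc N → ℝ} (hζ : ContDiff ℝ n ζ)
    (hs : tsupport ζ ⊆ {x : Euc N | x ≠ 0}) (hw : ContDiffOn ℝ n w {x : Euc N | x ≠ 0}) (m : ℕ) :
    ContDiff ℝ n (fun x => ζ x ^ (m + 1) * w x) := by
  refine contDiff_mul_of_tsupport_subset (hζ.pow _) (subset_trans ?_ hs) hw
  refine closure_mono fun x hx h => hx ?_
  simp [h]

lemma tsupport_pow_mul_subset {ζ w : Euc N → ℝ} (hs : tsupport ζ ⊆ K) (m : ℕ) :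
    tsupport (fun x => ζ x ^ (m + 1) * w x) ⊆ K := by
  refine subset_trans ?_ hs
  refine closure_mono fun x hx h => hx ?_
  simp [h]

lemma exists_norm_gradient_pow_mul_le (hK : IsCompact K) (hK0 : K ⊆ {x : Euc N | x ≠ 0})
    {ζ w : Euc N → ℝ} (hζ : ContDiff ℝ 2 ζ) (hw : ContDiffOn ℝ 2 w {x : Euc N | x ≠ 0}) (m : ℕ) :
    ∃ c, 0 ≤ c ∧ ∀ x ∈ K, ‖gradient (fun y => ζ y ^ (m + 1) * w y) x‖ ^ 2 ≤ c * ζ x ^ (2 * m) := by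
  have hgζ : Continuous (gradient ζ) := (hζ.of_le (by norm_num)).continuous_gradient
  have hgw := hw.continuousOn_gradient_punctured
  have hcw := hw.continuousOn
  have hcζ := hζ.continuous
  obtain ⟨M, hM0, hM⟩ := exists_bound_on hK hK0
    (h := fun x => ‖((m + 1 : ℝ) * w x) • gradient ζ x + ζ x • gradient w x‖ ^ 2) (by fun_prop)
  refine ⟨M, hM0.le, fun x hx => ?_⟩
  have hζd : DifferentiableAt ℝ ζ x := hζ.differentiable (by norm_num) x
  have e1 : gradient (fun y => ζ y ^ (m + 1)) x = ((m + 1 : ℝ) * ζ x ^ m) • gradient ζ x := by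
    have := (hζd.hasFDerivAt.pow (m + 1)).fderiv
    simp only [gradient, this]
    simp
  have e2 : gradient (fun y => ζ y ^ (m + 1) * w y) x =
      ζ x ^ m • (((m + 1 : ℝ) * w x) • gradient ζ x + ζ x • gradient w x) := by
    rw [gradient_mul (f := fun y => ζ y ^ (m + 1)) (hζd.fun_pow _)
      (hw.differentiableAt_punctured (hK0 hx)), e1]
    simp only [smul_add, smul_smul]
    rw [add_comm, pow_succ]
    congr 2; ring
  rw [e2, norm_smul, mul_pow, Real.norm_eq_abs, sq_abs, ← pow_mul, mul_comm m 2, mul_comm]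
  exact mul_le_mul_of_nonneg_right (hM x hx) ((even_two_mul m).pow_nonneg _)

namespace IsPosSol

variable {p q a b C : ℝ}

lemma exists_snd_rpow_le (hK : IsCompact K) (hK0 : K ⊆ {x : Euc N | x ≠ 0}) (hC : 0 < C) :
    ∃ D, 0 < D ∧ ∀ u v, IsPosSol p q a b C u v → ∀ x ∈ K, v x ^ (p + 1) ≤ D * u x ^ (q + 1) := by
  obtain ⟨M, hM0, hM⟩ := exists_norm_rpow_le hK hK0 (b - a)
  refine ⟨C * M, by positivity, fun u v h x hx => ?_⟩
  have hx0 : 0 < ‖x‖ := norm_pos_iff.2 (hK0 hx)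
  have hxa : 0 < ‖x‖ ^ a := Real.rpow_pos_of_pos hx0 a
  have hu := Real.rpow_pos_of_pos (h.fst_pos x) (q + 1)
  have h1 := h.comparison x (hK0 hx)
  have e : ‖x‖ ^ b = ‖x‖ ^ a * ‖x‖ ^ (b - a) := by rw [← Real.rpow_add hx0]; ring_nf
  rw [e] at h1
  have h2 : v x ^ (p + 1) ≤ C * (‖x‖ ^ (b - a) * u x ^ (q + 1)) := by
    refine le_of_mul_le_mul_left (h1.trans (le_of_eq ?_)) hxa
    ring
  refine h2.trans ?_
  rw [mul_assoc]
  exact mul_le_mul_of_nonneg_left (mul_le_mul_of_nonneg_right (hM x hx) hu.le) hC.le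

lemma exists_snd_le (hK : IsCompact K) (hK0 : K ⊆ {x : Euc N | x ≠ 0}) (hC : 0 < C)
    (hp : 0 < p) : ∃ D, 0 < D ∧ ∀ u v, IsPosSol p q a b C u v → ∀ x ∈ K,
      v x ≤ D * u x ^ ((q + 1) / (p + 1)) := by
  obtain ⟨D, hD, h⟩ := exists_snd_rpow_le (p := p) (q := q) (a := a) (b := b) hK hK0 hC
  refine ⟨D ^ (1 / (p + 1)), by positivity, fun u v hs x hx => ?_⟩
  have hp1 : 0 < p + 1 := by linarith
  have hv := hs.snd_pos x
  have hu := hs.fst_pos x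
  have := Real.rpow_le_rpow (by positivity) (h u v hs x hx) (z := 1 / (p + 1)) (by positivity)
  rwa [← Real.rpow_mul hv.le, mul_one_div_cancel hp1.ne', Real.rpow_one,
    Real.mul_rpow hD.le (by positivity), ← Real.rpow_mul hu.le, mul_one_div] at this

end IsPosSol

end Estimates

section LocalEnergy

variable {N : ℕ} {K : Set (Euc N)} {p q a b C : ℝ}

lemma two_mul_le_weighted {l A B D P Q U W u v : ℝ} (hl : 0 < l) (hA : 0 ≤ A) (hB : 0 ≤ B)
    (hP : 0 ≤ P) (hQ : 0 ≤ Q) (huq : A * U = u)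
    (hvp : B * W = v) :
    2 * (P ^ 2 * v * (u * (D * Q) ^ 2)) ≤
      l * (P * Q * A * B * (D * Q * U) ^ 2) + l⁻¹ * (P * Q * A * B * (D * P * W) ^ 2) := by
  subst huq hvp
  have h : 0 ≤ l * (P * Q * A * B) * (D * Q * U - l⁻¹ * (D * P * W)) ^ 2 := by positivity
  have e : l * (P * Q * A * B) * (D * Q * U - l⁻¹ * (D * P * W)) ^ 2 =
      l * (P * Q * A * B * (D * Q * U) ^ 2) + l⁻¹ * (P * Q * A * B * (D * P * W) ^ 2)
        - 2 * (P ^ 2 * (B * W) * (A * U * (D * Q) ^ 2)) := by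
    field_simp
    ring
  linarith

namespace IsPosSol

lemma contDiff_test {u ζ w : Euc N → ℝ} (hu : ContDiffOn ℝ 2 u {x : Euc N | x ≠ 0})
    (hu0 : ∀ x, 0 < u x) (hζ : ContDiff ℝ 2 ζ) (hs : tsupport ζ ⊆ {x : Euc N | x ≠ 0})
    (hw : ContDiffOn ℝ 2 w {x : Euc N | x ≠ 0}) (m : ℕ) (r : ℝ) :
    ContDiff ℝ 2 (fun x => ζ x ^ (m + 1) * w x * u x ^ r) :=
  contDiff_mul_of_tsupport_subset (contDiff_pow_mul hζ hs hw m)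
    ((tsupport_pow_mul_subset subset_rfl m).trans hs) (hu.rpow_of_pos hu0 r)

/-- Stability combined with the energy identities. -/
lemma weighted_stability {A : Set (Euc N)} (hK : IsCompact K)
    (hK0 : K ⊆ {x : Euc N | x ≠ 0}) (hKA : K ⊆ A) {ζ : Euc N → ℝ} (hζ : ContDiff ℝ 2 ζ)
    (hζ0 : ∀ x, 0 ≤ ζ x) (hs : tsupport ζ ⊆ K) (m : ℕ) {u v : Euc N → ℝ}
    (h : IsPosSol p q a b C u v) (hst : StabilityOn p q a b u v A) {l : ℝ} (hl : 0 < l) :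
    2 * Real.sqrt (p * q) *
        (∫ x in K, -lap u x * (u x ^ q * (ζ x ^ (m + 1) * ‖x‖ ^ (b / 2)) ^ 2)) ≤
      l * (∫ x in K,
        ‖gradient (fun y => ζ y ^ (m + 1) * ‖y‖ ^ (b / 2) * u y ^ ((q + 1) / 2)) x‖ ^ 2) +
      l⁻¹ * ∫ x in K,
        ‖gradient (fun y => ζ y ^ (m + 1) * ‖y‖ ^ (a / 2) * v y ^ ((p + 1) / 2)) x‖ ^ 2 := by
  set φ : Euc N → ℝ := fun y => ζ y ^ (m + 1) * ‖y‖ ^ (b / 2) * u y ^ ((q + 1) / 2) with hφ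
  set ψ : Euc N → ℝ := fun y => ζ y ^ (m + 1) * ‖y‖ ^ (a / 2) * v y ^ ((p + 1) / 2) with hψ
  set V : Euc N → ℝ := fun x => ‖x‖ ^ ((a + b) / 2) * u x ^ ((q - 1) / 2) * v x ^ ((p - 1) / 2)
  have hu' : ∀ x ∈ {x : Euc N | x ≠ 0}, u x ≠ 0 := fun x _ => (h.fst_pos x).ne'
  have hv' : ∀ x ∈ {x : Euc N | x ≠ 0}, v x ≠ 0 := fun x _ => (h.snd_pos x).ne'
  have hn' : ∀ x ∈ {x : Euc N | x ≠ 0}, ‖x‖ ≠ 0 := fun x hx => norm_ne_zero_iff.2 hx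
  have hcu := h.contDiffOn_fst.continuousOn
  have hcv := h.contDiffOn_snd.continuousOn
  have key : ∀ w : Euc N → ℝ, ContDiff ℝ 2 w → tsupport w ⊆ K →
      Real.sqrt (p * q) * (∫ x in K, V x * w x ^ 2) ≤ ∫ x in K, ‖gradient w x‖ ^ 2 := by
    intro w hw hws
    have := hst w hw (hK.of_isClosed_subset (isClosed_tsupport _) hws) (hws.trans hKA)
    rwa [← setIntegral_eq_integral_of_forall_compl_eq_zero (s := K) (μ := volume)
        (f := fun x => ‖x‖ ^ ((a + b) / 2) * u x ^ ((q - 1) / 2) * v x ^ ((p - 1) / 2) * w x ^ 2)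
        fun x hx => by simp [image_eq_zero_of_notMem_tsupport fun h => hx (hws h)],
      ← setIntegral_eq_integral_of_forall_compl_eq_zero (s := K) (μ := volume)
        (f := fun x => ‖gradient w x‖ ^ 2)
        fun x hx => by rw [gradient_eq_zero_of_notMem_tsupport fun h => hx (hws h)]; simp] at this
  have hφ2 : ContDiff ℝ 2 φ := contDiff_test h.contDiffOn_fst h.fst_pos hζ (hs.trans hK0)
    (contDiffOn_norm_rpow _) m _
  have hψ2 : ContDiff ℝ 2 ψ := contDiff_test h.contDiffOn_snd h.snd_pos hζ (hs.trans hK0)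
    (contDiffOn_norm_rpow _) m _
  have h1 := key φ hφ2 (tsupport_mul_subset' (tsupport_pow_mul_subset hs m))
  have h2 := key ψ hψ2 (tsupport_mul_subset' (tsupport_pow_mul_subset hs m))
  have hcζ := hζ.continuous
  have hcφ := hφ2.continuous
  have hcψ := hψ2.continuous
  have hcV : ContinuousOn V {x : Euc N | x ≠ 0} := by fun_prop (disch := assumption)
  have h3 : 2 * (∫ x in K, -lap u x * (u x ^ q * (ζ x ^ (m + 1) * ‖x‖ ^ (b / 2)) ^ 2)) ≤
      l * (∫ x in K, V x * φ x ^ 2) + l⁻¹ * ∫ x in K, V x * ψ x ^ 2 := by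
    have i1 : IntegrableOn (fun x => l * (V x * φ x ^ 2)) K :=
      ContinuousOn.integrableOn_punctured (by fun_prop) hK hK0
    have i2 : IntegrableOn (fun x => l⁻¹ * (V x * ψ x ^ 2)) K :=
      ContinuousOn.integrableOn_punctured (by fun_prop) hK hK0
    rw [← integral_const_mul, ← integral_const_mul, ← integral_const_mul, ← integral_add i1 i2]
    have hcl := continuousOn_lap h.contDiffOn_fst
    refine setIntegral_mono_punctured hK hK0 (by fun_prop (disch := assumption)) (by fun_prop)
      fun x hx => ?_
    have hx0 : 0 < ‖x‖ := norm_pos_iff.2 (hK0 hx)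
    have hu := h.fst_pos x
    have hv := h.snd_pos x
    rw [h.lap_fst x (hK0 hx)]
    have ea : ‖x‖ ^ a = (‖x‖ ^ (a / 2)) ^ 2 := by
      rw [pow_two, ← Real.rpow_add hx0]; ring_nf
    have eab : ‖x‖ ^ ((a + b) / 2) = ‖x‖ ^ (a / 2) * ‖x‖ ^ (b / 2) := by
      rw [← Real.rpow_add hx0]; ring_nf
    simp only [V, φ, ψ]
    rw [ea, eab]
    have hζx := hζ0 x
    refine two_mul_le_weighted hl ?_ ?_ ?_ ?_ ?_ ?_ <;> try positivity
    · rw [← Real.rpow_add hu]; ring_nf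
    · rw [← Real.rpow_add hv]; ring_nf
  have hsq := Real.sqrt_nonneg (p * q)
  calc _ = Real.sqrt (p * q) *
        (2 * (∫ x in K, -lap u x * (u x ^ q * (ζ x ^ (m + 1) * ‖x‖ ^ (b / 2)) ^ 2))) := by ring
    _ ≤ Real.sqrt (p * q) * (l * (∫ x in K, V x * φ x ^ 2) + l⁻¹ * ∫ x in K, V x * ψ x ^ 2) :=
      mul_le_mul_of_nonneg_left h3 hsq
    _ = l * (Real.sqrt (p * q) * (∫ x in K, V x * φ x ^ 2)) +
        l⁻¹ * (Real.sqrt (p * q) * ∫ x in K, V x * ψ x ^ 2) := by ring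
    _ ≤ _ := add_le_add (mul_le_mul_of_nonneg_left h1 hl.le)
      (mul_le_mul_of_nonneg_left h2 (inv_pos.2 hl).le)

lemma energy_absorb {κ δ s l F Ea Eb c Y Iu Iv : ℝ} (hp : 0 < p) (hq : 0 < q) (hs : 0 < s)
    (hs2 : s ^ 2 = p * q)
    (hκ : κ = (p + 1) * (q + 1) / (4 * (p * q))) (hδ : κ * (1 + δ) = (1 + κ) / 2)
    (hl : l = s * (p + 1) / (p * (q + 1)))
    (h : 2 * s * F ≤ l * Iu + l⁻¹ * Iv)
    (hu : Iu ≤ (q + 1) ^ 2 / (4 * q) * (1 + δ) * F + Ea)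
    (hv : Iv ≤ (p + 1) ^ 2 / (4 * p) * (1 + δ) * F + Eb)
    (ha : Ea ≤ c * Y) (hb : Eb ≤ c * Y) :
    s * (1 - κ) * F ≤ (l + l⁻¹) * c * Y := by
  have hl0 : 0 < l := by rw [hl]; positivity
  have e1 : l * ((q + 1) ^ 2 / (4 * q) * (1 + δ)) = s * ((1 + κ) / 2) := by
    rw [← hδ, hκ, hl]; field_simp
  have e2 : l⁻¹ * ((p + 1) ^ 2 / (4 * p) * (1 + δ)) = s * ((1 + κ) / 2) := by
    rw [← hδ, hκ, hl]; field_simp; rw [hs2]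
  have h1 := mul_le_mul_of_nonneg_left (hu.trans (add_le_add_right ha _)) hl0.le
  have h2 := mul_le_mul_of_nonneg_left (hv.trans (add_le_add_right hb _)) (inv_pos.2 hl0).le
  have h3 : l * ((q + 1) ^ 2 / (4 * q) * (1 + δ) * F + c * Y) =
    s * ((1 + κ) / 2) * F + l * (c * Y) := by rw [← e1]; ring
  have h4 : l⁻¹ * ((p + 1) ^ 2 / (4 * p) * (1 + δ) * F + c * Y) =
    s * ((1 + κ) / 2) * F + l⁻¹ * (c * Y) := by rw [← e2]; ring
  rw [h3] at h1
  rw [h4] at h2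
  nlinarith

set_option maxHeartbeats 1000000 in
/-- Reverse Poincaré inequality for powers of stable solutions. -/
lemma exists_energy_le (hp : 0 < p) (hq : 0 < q) (hpq : (p + 1) * (q + 1) < 4 * (p * q))
    (hC : 0 < C) {A : Set (Euc N)} (hK : IsCompact K)
    (hK0 : K ⊆ {x : Euc N | x ≠ 0}) (hKA : K ⊆ A) {ζ : Euc N → ℝ} (hζ : ContDiff ℝ 2 ζ)
    (hζ0 : ∀ x, 0 ≤ ζ x) (hs : tsupport ζ ⊆ K) (m : ℕ) : ∃ c, 0 ≤ c ∧ ∀ u v,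
      IsPosSol p q a b C u v → StabilityOn p q a b u v A →
      (∫ x in K, ‖gradient (fun y => ζ y ^ (m + 1) * ‖y‖ ^ (b / 2) * u y ^ ((q + 1) / 2)) x‖ ^ 2)
        ≤ c * (∫ x in K, u x ^ (q + 1) * ζ x ^ (2 * m)) ∧
      (∫ x in K, u x ^ (q - 1) * ‖gradient u x‖ ^ 2 * (ζ x ^ (m + 1) * ‖x‖ ^ (b / 2)) ^ 2)
        ≤ c * ∫ x in K, u x ^ (q + 1) * ζ x ^ (2 * m) := by
  set κ := (p + 1) * (q + 1) / (4 * (p * q)) with hκ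
  have hκ0 : 0 < κ := by positivity
  have hκ1 : κ < 1 := by rw [hκ, div_lt_one (by positivity)]; exact hpq
  set δ := (1 - κ) / (2 * κ) with hδ
  have hδ0 : 0 < δ := div_pos (by linarith) (by positivity)
  have hδκ : κ * (1 + δ) = (1 + κ) / 2 := by rw [hδ]; field_simp; ring
  set s := Real.sqrt (p * q) with hsq
  have hs0 : 0 < s := Real.sqrt_pos.2 (by positivity)
  have hs2 : s ^ 2 = p * q := Real.sq_sqrt (by positivity)
  set l := s * (p + 1) / (p * (q + 1)) with hl
  have hl0 : 0 < l := by positivity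
  obtain ⟨c₁, hc₁, H₁⟩ := setIntegral_energy (N := N) hq hδ0
  obtain ⟨c₂, hc₂, H₂⟩ := setIntegral_energy (N := N) hp hδ0
  obtain ⟨c₃, hc₃, H₃⟩ := exists_norm_gradient_pow_mul_le hK hK0 hζ
    (contDiffOn_norm_rpow (b / 2)) m
  obtain ⟨c₄, hc₄, H₄⟩ := exists_norm_gradient_pow_mul_le hK hK0 hζ
    (contDiffOn_norm_rpow (a / 2)) m
  obtain ⟨D, hD, HD⟩ := exists_snd_rpow_le (p := p) (q := q) (a := a) (b := b) hK hK0 hC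
  set c := c₁ * c₃ + c₂ * (D * c₄) with hc
  have hcnn : 0 ≤ c := by positivity
  set B := (l + l⁻¹) * c / (s * (1 - κ)) with hB
  have hBnn : 0 ≤ B := div_nonneg (by positivity) (mul_nonneg hs0.le (by linarith))
  refine ⟨(q + 1) ^ 2 / (4 * q) * (1 + δ) * B + 2 / q * B + c, by positivity,
    fun u v h hst => ?_⟩
  have hu' : ∀ x ∈ {x : Euc N | x ≠ 0}, u x ≠ 0 := fun x _ => (h.fst_pos x).ne'
  have hv' : ∀ x ∈ {x : Euc N | x ≠ 0}, v x ≠ 0 := fun x _ => (h.snd_pos x).ne'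
  have hn' : ∀ x ∈ {x : Euc N | x ≠ 0}, ‖x‖ ≠ 0 := fun x hx => norm_ne_zero_iff.2 hx
  have hcu := h.contDiffOn_fst.continuousOn
  have hcv := h.contDiffOn_snd.continuousOn
  have hcζ := hζ.continuous
  set Y := ∫ x in K, u x ^ (q + 1) * ζ x ^ (2 * m) with hY
  have hYnn : 0 ≤ Y := setIntegral_nonneg hK.measurableSet fun x _ => by
    have := h.fst_pos x
    have := hζ0 x
    positivity
  have hωb : ContDiff ℝ 1 (fun x => ζ x ^ (m + 1) * ‖x‖ ^ (b / 2)) :=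
    contDiff_pow_mul (hζ.of_le (by norm_num)) (hs.trans hK0) (contDiffOn_norm_rpow _) m
  have hωa : ContDiff ℝ 1 (fun x => ζ x ^ (m + 1) * ‖x‖ ^ (a / 2)) :=
    contDiff_pow_mul (hζ.of_le (by norm_num)) (hs.trans hK0) (contDiffOn_norm_rpow _) m
  obtain ⟨h1, h1'⟩ := H₁ K hK hK0 u _ h.contDiffOn_fst h.fst_pos hωb (tsupport_pow_mul_subset hs m)
  obtain ⟨h2, -⟩ := H₂ K hK hK0 v _ h.contDiffOn_snd h.snd_pos hωa (tsupport_pow_mul_subset hs m)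
  have hF : (∫ x in K, -lap v x * (v x ^ p * (ζ x ^ (m + 1) * ‖x‖ ^ (a / 2)) ^ 2)) =
      ∫ x in K, -lap u x * (u x ^ q * (ζ x ^ (m + 1) * ‖x‖ ^ (b / 2)) ^ 2) := by
    refine setIntegral_congr_fun hK.measurableSet fun x hx => ?_
    have hx0 : 0 < ‖x‖ := norm_pos_iff.2 (hK0 hx)
    have ea : ‖x‖ ^ a = (‖x‖ ^ (a / 2)) ^ 2 := by
      rw [pow_two, ← Real.rpow_add hx0]; ring_nf
    have eb : ‖x‖ ^ b = (‖x‖ ^ (b / 2)) ^ 2 := by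
      rw [pow_two, ← Real.rpow_add hx0]; ring_nf
    simp only [h.lap_fst x (hK0 hx), h.lap_snd x (hK0 hx), ea, eb]
    ring
  have hga := hωa.continuous_gradient
  have hgb := hωb.continuous_gradient
  have hE1 : (∫ x in K, u x ^ (q + 1) *
      ‖gradient (fun x => ζ x ^ (m + 1) * ‖x‖ ^ (b / 2)) x‖ ^ 2) ≤ c₃ * Y := by
    rw [hY, ← integral_const_mul]
    refine setIntegral_mono_punctured hK hK0 (by fun_prop (disch := assumption))
      (by fun_prop (disch := assumption)) fun x hx => ?_
    have := h.fst_pos x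
    calc _ ≤ u x ^ (q + 1) * (c₃ * ζ x ^ (2 * m)) :=
          mul_le_mul_of_nonneg_left (H₃ x hx) (by positivity)
      _ = _ := by ring
  have hE2 : (∫ x in K, v x ^ (p + 1) *
      ‖gradient (fun x => ζ x ^ (m + 1) * ‖x‖ ^ (a / 2)) x‖ ^ 2) ≤ D * c₄ * Y := by
    rw [hY, ← integral_const_mul]
    refine setIntegral_mono_punctured hK hK0 (by fun_prop (disch := assumption))
      (by fun_prop (disch := assumption)) fun x hx => ?_
    have := h.fst_pos x
    calc _ ≤ (D * u x ^ (q + 1)) * (c₄ * ζ x ^ (2 * m)) :=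
          mul_le_mul (HD u v h x hx) (H₄ x hx) (by positivity) (by positivity)
      _ = _ := by ring
  have hEa : c₁ * (∫ x in K, u x ^ (q + 1) *
      ‖gradient (fun x => ζ x ^ (m + 1) * ‖x‖ ^ (b / 2)) x‖ ^ 2) ≤ c * Y := by
    refine (mul_le_mul_of_nonneg_left hE1 hc₁).trans ?_
    rw [← mul_assoc]
    exact mul_le_mul_of_nonneg_right (by rw [hc]; linarith [show 0 ≤ c₂ * (D * c₄) by positivity])
      hYnn
  have hEb : c₂ * (∫ x in K, v x ^ (p + 1) *
      ‖gradient (fun x => ζ x ^ (m + 1) * ‖x‖ ^ (a / 2)) x‖ ^ 2) ≤ c * Y := by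
    refine (mul_le_mul_of_nonneg_left hE2 hc₂).trans ?_
    rw [← mul_assoc]
    exact mul_le_mul_of_nonneg_right (by rw [hc]; linarith [show 0 ≤ c₁ * c₃ by positivity])
      hYnn
  rw [hF] at h2
  have hst' := weighted_stability hK hK0 hKA hζ hζ0 hs m h hst hl0
  set F := ∫ x in K, -lap u x * (u x ^ q * (ζ x ^ (m + 1) * ‖x‖ ^ (b / 2)) ^ 2) with hFd
  have hFle : F ≤ B * Y := by
    have := energy_absorb hp hq hs0 hs2 hκ hδκ hl hst' h1 h2 hEa hEb
    rw [hB, div_mul_eq_mul_div, le_div_iff₀ (mul_pos hs0 (by linarith))]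
    linarith
  have hq2 : 0 ≤ (q + 1) ^ 2 / (4 * q) * (1 + δ) := by positivity
  have hq3 : 0 ≤ 2 / q := by positivity
  have hBY : 0 ≤ B * Y := by positivity
  constructor
  · refine h1.trans ?_
    have := mul_le_mul_of_nonneg_left hFle hq2
    nlinarith [mul_nonneg hq3 hBY]
  · refine h1'.trans ?_
    have := mul_le_mul_of_nonneg_left hFle hq3
    nlinarith [mul_nonneg hq2 hBY]

end IsPosSol

end LocalEnergy

section LocalPower

variable {N : ℕ} {K : Set (Euc N)} {p q a b C : ℝ}

lemma mul_pow_le_young {X z σ ε : ℝ} {m : ℕ} (hX : 0 < X) (hz0 : 0 ≤ z) (hz1 : z ≤ 1)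
    (hσ : 0 < σ) (hm : 1 ≤ m * σ) (hε : 0 < ε) :
    X * z ^ (2 * m) ≤ ε * (X ^ (1 + σ) * z ^ (2 * (m + 1))) + (1 / ε) ^ (1 / σ) := by
  have hm0 : m ≠ 0 := by rintro rfl; norm_num at hm
  have hR : 0 ≤ (1 / ε) ^ (1 / σ) := by positivity
  rcases hz0.eq_or_lt with rfl | hz
  · simpa [hm0] using hR
  by_cases hc : 1 / ε ≤ X ^ σ * z ^ 2
  · have : X * z ^ (2 * m) ≤ ε * (X ^ (1 + σ) * z ^ (2 * (m + 1))) := by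
      rw [Real.rpow_add hX, Real.rpow_one, mul_add, pow_add]
      have h1 : 1 ≤ ε * (X ^ σ * z ^ 2) := by
        rw [div_le_iff₀ hε] at hc; linarith
      calc X * z ^ (2 * m) = X * z ^ (2 * m) * 1 := (mul_one _).symm
        _ ≤ X * z ^ (2 * m) * (ε * (X ^ σ * z ^ 2)) :=
          mul_le_mul_of_nonneg_left h1 (by positivity)
        _ = _ := by ring
    linarith
  · push Not at hc
    have h1 : (X * z ^ (2 * m)) ^ σ ≤ 1 / ε := by
      refine le_trans ?_ hc.le
      rw [Real.mul_rpow hX.le (by positivity)]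
      refine mul_le_mul_of_nonneg_left ?_ (by positivity)
      rw [← Real.rpow_natCast, ← Real.rpow_natCast, ← Real.rpow_mul hz.le]
      refine Real.rpow_le_rpow_of_exponent_ge hz hz1 ?_
      push_cast
      linarith
    have h2 : X * z ^ (2 * m) ≤ (1 / ε) ^ (1 / σ) := by
      have := Real.rpow_le_rpow (by positivity) h1 (z := 1 / σ) (by positivity)
      rwa [← Real.rpow_mul (by positivity), mul_one_div_cancel hσ.ne', Real.rpow_one] at this
    have : 0 ≤ ε * (X ^ (1 + σ) * z ^ (2 * (m + 1))) := by positivity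
    linarith

namespace IsPosSol

/-- Local bound on a superquadratic power of `u`. -/
lemma exists_setIntegral_rpow_le (hp : 0 < p) (hq : 0 < q)
    (hpq : (p + 1) * (q + 1) < 4 * (p * q)) (hC : 0 < C) {A : Set (Euc N)} (hK : IsCompact K)
    (hK0 : K ⊆ {x : Euc N | x ≠ 0}) (hKA : K ⊆ A) {ζ : Euc N → ℝ} (hζ : ContDiff ℝ 2 ζ)
    (hζ0 : ∀ x, 0 ≤ ζ x) (hs : tsupport ζ ⊆ K) (m : ℕ) : ∃ c, 0 ≤ c ∧ ∀ u v,
      IsPosSol p q a b C u v → StabilityOn p q a b u v A →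
      (∫ x in K, u x ^ (2 * q + 1 - (q + 1) / (p + 1)) * ζ x ^ (2 * (m + 1)))
        ≤ c * ∫ x in K, u x ^ (q + 1) * ζ x ^ (2 * m) := by
  obtain ⟨c, hc, H⟩ := exists_energy_le (a := a) (b := b) hp hq hpq hC hK hK0 hKA hζ hζ0 hs m
  obtain ⟨D, hD, HD⟩ := exists_snd_le (p := p) (q := q) (a := a) (b := b) hK hK0 hC hp
  obtain ⟨M, hM, HM⟩ := exists_norm_rpow_le hK hK0 (-(2 * b))
  refine ⟨M * D * (2 * c), by positivity, fun u v h hst => ?_⟩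
  obtain ⟨h1, -⟩ := H u v h hst
  set φ : Euc N → ℝ := fun y => ζ y ^ (m + 1) * ‖y‖ ^ (b / 2) * u y ^ ((q + 1) / 2) with hφ
  have hu' : ∀ x ∈ {x : Euc N | x ≠ 0}, u x ≠ 0 := fun x _ => (h.fst_pos x).ne'
  have hv' : ∀ x ∈ {x : Euc N | x ≠ 0}, v x ≠ 0 := fun x _ => (h.snd_pos x).ne'
  have hcu := h.contDiffOn_fst.continuousOn
  have hcv := h.contDiffOn_snd.continuousOn
  have hcζ := hζ.continuous
  have hφ2 : ContDiff ℝ 2 φ := contDiff_test h.contDiffOn_fst h.fst_pos hζ (hs.trans hK0)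
    (contDiffOn_norm_rpow _) m _
  have hcφ := hφ2.continuous
  have hardy := setIntegral_hardy hK hK0 h.contDiffOn_snd h.snd_pos (hφ2.of_le (by norm_num))
    (tsupport_mul_subset' (tsupport_pow_mul_subset hs m))
  have hnn : 0 ≤ ∫ x in K, v x ^ (-2 : ℝ) * ‖gradient v x‖ ^ 2 * φ x ^ 2 :=
    setIntegral_nonneg hK.measurableSet fun x _ => by
      have := h.snd_pos x
      positivity
  have h2 : (∫ x in K, u x ^ (2 * q + 1 - (q + 1) / (p + 1)) * ζ x ^ (2 * (m + 1))) ≤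
      M * D * ∫ x in K, -lap v x * (v x ^ (-1 : ℝ) * φ x ^ 2) := by
    rw [← integral_const_mul]
    have hcl := continuousOn_lap h.contDiffOn_snd
    refine setIntegral_mono_punctured hK hK0 (by fun_prop (disch := assumption))
      (by fun_prop (disch := assumption)) fun x hx => ?_
    have hx0 : 0 < ‖x‖ := norm_pos_iff.2 (hK0 hx)
    have hu := h.fst_pos x
    have hv := h.snd_pos x
    rw [h.lap_snd x (hK0 hx)]
    have e1 : u x ^ (2 * q + 1 - (q + 1) / (p + 1)) =
        u x ^ q * u x ^ (q + 1) * (u x ^ ((q + 1) / (p + 1)))⁻¹ := by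
      rw [← Real.rpow_neg hu.le, ← Real.rpow_add hu, ← Real.rpow_add hu]; ring_nf
    have e2 : φ x ^ 2 = ζ x ^ (2 * (m + 1)) * ‖x‖ ^ b * u x ^ (q + 1) := by
      have eb : ‖x‖ ^ b = (‖x‖ ^ (b / 2)) ^ 2 := by
        rw [pow_two, ← Real.rpow_add hx0]; ring_nf
      have eu : u x ^ (q + 1) = (u x ^ ((q + 1) / 2)) ^ 2 := by
        rw [pow_two, ← Real.rpow_add hu]; ring_nf
      rw [eb, eu]; simp only [φ]; ring
    have e3 : 1 ≤ M * (‖x‖ ^ b * ‖x‖ ^ b) := by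
      have := mul_le_mul_of_nonneg_right (HM x hx) (Real.rpow_nonneg hx0.le (2 * b))
      rw [← Real.rpow_add hx0] at this
      rw [← Real.rpow_add hx0, ← two_mul]
      simpa using this
    have e4 : (u x ^ ((q + 1) / (p + 1)))⁻¹ ≤ D * v x ^ (-1 : ℝ) := by
      rw [Real.rpow_neg_one, inv_le_iff_one_le_mul₀ (by positivity)]
      have := HD u v h x hx
      have h5 : v x * (v x)⁻¹ = 1 := mul_inv_cancel₀ hv.ne'
      calc 1 = v x * (v x)⁻¹ := h5.symm
        _ ≤ (D * u x ^ ((q + 1) / (p + 1))) * (v x)⁻¹ :=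
          mul_le_mul_of_nonneg_right this (by positivity)
        _ = _ := by ring
    rw [e1, e2]
    have hz : 0 ≤ ζ x ^ (2 * (m + 1)) := by have := hζ0 x; positivity
    calc u x ^ q * u x ^ (q + 1) * (u x ^ ((q + 1) / (p + 1)))⁻¹ * ζ x ^ (2 * (m + 1))
        ≤ u x ^ q * u x ^ (q + 1) * (D * v x ^ (-1 : ℝ)) * ζ x ^ (2 * (m + 1)) := by gcongr
      _ = 1 * (u x ^ q * u x ^ (q + 1) * (D * v x ^ (-1 : ℝ)) * ζ x ^ (2 * (m + 1))) := by ring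
      _ ≤ M * (‖x‖ ^ b * ‖x‖ ^ b) *
          (u x ^ q * u x ^ (q + 1) * (D * v x ^ (-1 : ℝ)) * ζ x ^ (2 * (m + 1))) := by gcongr
      _ = _ := by ring
  refine h2.trans ?_
  rw [mul_assoc]
  rw [mul_assoc (M * D)]
  refine (mul_assoc M D _).symm.le.trans ?_
  refine mul_le_mul_of_nonneg_left ?_ (by positivity)
  linarith

/-- Local bounds for `u` in the energy space. -/
lemma exists_local_bound (hp : 0 < p) (hq : 0 < q) (h1pq : 1 < p * q)
    (hpq : (p + 1) * (q + 1) < 4 * (p * q)) (hC : 0 < C) {A : Set (Euc N)} (hK : IsCompact K)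
    (hK0 : K ⊆ {x : Euc N | x ≠ 0}) (hKA : K ⊆ A) {ζ : Euc N → ℝ} (hζ : ContDiff ℝ 2 ζ)
    (hζ0 : ∀ x, 0 ≤ ζ x) (hζ1 : ∀ x, ζ x ≤ 1) (hs : tsupport ζ ⊆ K) :
    ∃ (m : ℕ) (B : ℝ), 0 ≤ B ∧ ∀ u v, IsPosSol p q a b C u v → StabilityOn p q a b u v A →
      (∫ x in K, u x ^ (q + 1) * ζ x ^ (2 * m)) ≤ B ∧
      (∫ x in K, u x ^ (q - 1) * ‖gradient u x‖ ^ 2 * ζ x ^ (2 * (m + 1))) ≤ B := by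
  set σ := (q - (q + 1) / (p + 1)) / (q + 1) with hσd
  have hσ : 0 < σ := by
    refine div_pos ?_ (by linarith)
    rw [sub_pos, div_lt_iff₀ (by linarith)]
    linarith
  obtain ⟨m, hm⟩ := exists_nat_ge (1 / σ)
  have hm1 : 1 ≤ m * σ := by rwa [div_le_iff₀ hσ] at hm
  obtain ⟨c, hc, H⟩ := exists_setIntegral_rpow_le (a := a) (b := b) hp hq hpq hC hK hK0 hKA hζ
    hζ0 hs m
  obtain ⟨c', hc', H'⟩ := exists_energy_le (a := a) (b := b) hp hq hpq hC hK hK0 hKA hζ hζ0 hs m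
  obtain ⟨M, hM, HM⟩ := exists_norm_rpow_le hK hK0 (-b)
  set ε := 1 / (2 * (c + 1)) with hε
  have hε0 : 0 < ε := by positivity
  set L := (1 / ε) ^ (1 / σ) * volume.real K with hL
  have hL0 : 0 ≤ L := by positivity
  refine ⟨m, 2 * L + M * (c' * (2 * L)), by positivity, fun u v h hst => ?_⟩
  have hu' : ∀ x ∈ {x : Euc N | x ≠ 0}, u x ≠ 0 := fun x _ => (h.fst_pos x).ne'
  have hn' : ∀ x ∈ {x : Euc N | x ≠ 0}, ‖x‖ ≠ 0 := fun x hx => norm_ne_zero_iff.2 hx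
  have hcu := h.contDiffOn_fst.continuousOn
  have hcg := h.contDiffOn_fst.continuousOn_gradient_punctured
  have hcζ := hζ.continuous
  set Y := ∫ x in K, u x ^ (q + 1) * ζ x ^ (2 * m) with hY
  have h1 : Y ≤ ε * (∫ x in K, u x ^ (2 * q + 1 - (q + 1) / (p + 1)) * ζ x ^ (2 * (m + 1)))
      + L := by
    have i1 : IntegrableOn (fun x => ε * (u x ^ (2 * q + 1 - (q + 1) / (p + 1)) *
        ζ x ^ (2 * (m + 1)))) K :=
      ContinuousOn.integrableOn_punctured (by fun_prop (disch := assumption)) hK hK0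
    have i2 : IntegrableOn (fun _ : Euc N => (1 / ε) ^ (1 / σ)) K :=
      ContinuousOn.integrableOn_punctured continuousOn_const hK hK0
    have e : L = ∫ x in K, (1 / ε) ^ (1 / σ) := by
      rw [setIntegral_const, smul_eq_mul, mul_comm]
    rw [e, hY, ← integral_const_mul, ← integral_add i1 i2]
    refine setIntegral_mono_punctured hK hK0 (by fun_prop (disch := assumption))
      (by fun_prop (disch := assumption)) fun x hx => ?_
    have hu := h.fst_pos x
    have := mul_pow_le_young (X := u x ^ (q + 1)) (by positivity) (hζ0 x) (hζ1 x) hσ hm1 hε0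
    rwa [← Real.rpow_mul hu.le, show (q + 1) * (1 + σ) = 2 * q + 1 - (q + 1) / (p + 1) by
      rw [hσd]; field_simp; ring] at this
  have hYnn : 0 ≤ Y := setIntegral_nonneg hK.measurableSet fun x _ => by
    have := h.fst_pos x
    have := hζ0 x
    positivity
  have hYL : Y ≤ 2 * L := by
    have h2 := mul_le_mul_of_nonneg_left (H u v h hst) hε0.le
    have h3 : ε * (c * Y) ≤ 1 / 2 * Y := by
      rw [← mul_assoc]
      refine mul_le_mul_of_nonneg_right ?_ hYnn
      rw [hε, div_mul_eq_mul_div, div_le_div_iff₀ (by positivity) (by norm_num)]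
      linarith
    linarith
  refine ⟨hYL.trans (le_add_of_nonneg_right (by positivity)), ?_⟩
  have h4 : (∫ x in K, u x ^ (q - 1) * ‖gradient u x‖ ^ 2 * ζ x ^ (2 * (m + 1))) ≤
      M * ∫ x in K, u x ^ (q - 1) * ‖gradient u x‖ ^ 2 * (ζ x ^ (m + 1) * ‖x‖ ^ (b / 2)) ^ 2 := by
    rw [← integral_const_mul]
    refine setIntegral_mono_punctured hK hK0 (by fun_prop (disch := assumption))
      (by fun_prop (disch := assumption)) fun x hx => ?_
    have hx0 : 0 < ‖x‖ := norm_pos_iff.2 (hK0 hx)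
    have hu := h.fst_pos x
    have hz : 0 ≤ ζ x := hζ0 x
    have e3 : 1 ≤ M * ‖x‖ ^ b := by
      have := mul_le_mul_of_nonneg_right (HM x hx) (Real.rpow_nonneg hx0.le b)
      rw [← Real.rpow_add hx0] at this
      simpa using this
    have eb : ‖x‖ ^ b = (‖x‖ ^ (b / 2)) ^ 2 := by
      rw [pow_two, ← Real.rpow_add hx0]; ring_nf
    calc u x ^ (q - 1) * ‖gradient u x‖ ^ 2 * ζ x ^ (2 * (m + 1))
        = 1 * (u x ^ (q - 1) * ‖gradient u x‖ ^ 2 * ζ x ^ (2 * (m + 1))) := by ring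
      _ ≤ M * ‖x‖ ^ b * (u x ^ (q - 1) * ‖gradient u x‖ ^ 2 * ζ x ^ (2 * (m + 1))) := by gcongr
      _ = _ := by rw [eb]; ring
  have h5 := (H' u v h hst).2.trans (mul_le_mul_of_nonneg_left hYL hc')
  exact (h4.trans (mul_le_mul_of_nonneg_left h5 hM.le)).trans
    (le_add_of_nonneg_left (by positivity))

end IsPosSol

end LocalPower

/-- The density whose integral over annuli controls the boundary terms of the Pohozaev identity. -/
def pohozaevDensity {N : ℕ} (p q a b : ℝ) (u v : Euc N → ℝ) (x : Euc N) : ℝ :=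
  ‖x‖ ^ a * v x ^ (p + 1) + ‖x‖ ^ b * u x ^ (q + 1) + ‖gradient u x‖ * ‖gradient v x‖ +
    ‖x‖⁻¹ * (u x * ‖gradient v x‖ + v x * ‖gradient u x‖)

lemma rpow_le_add_rpow {x lo j hi : ℝ} (hx : 0 < x) (h1 : lo ≤ j) (h2 : j ≤ hi) :
    x ^ j ≤ x ^ lo + x ^ hi := by
  have := Real.rpow_pos_of_pos hx lo
  have := Real.rpow_pos_of_pos hx hi
  rcases le_total x 1 with h | h
  · have := Real.rpow_le_rpow_of_exponent_ge hx h h1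
    linarith
  · have := Real.rpow_le_rpow_of_exponent_le h h2
    linarith

lemma rpow_le_one_add_rpow {x j hi : ℝ} (hx : 0 < x) (h1 : 0 ≤ j) (h2 : j ≤ hi) :
    x ^ j ≤ 1 + x ^ hi := by
  simpa using rpow_le_add_rpow hx h1 h2

lemma exists_exponent {p q : ℝ} (hq : 0 < q) (hqp : q ≤ p) (hpq : 1 ≤ p * q) :
    ∃ k : ℝ, -2 ≤ k ∧ k ≤ q - 1 ∧ 0 ≤ q - k + (q + 1) / (p + 1) ∧
      q - k + (q + 1) / (p + 1) ≤ q + 1 ∧ -2 ≤ 2 * ((q + 1) / (p + 1)) - k - 2 ∧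
      2 * ((q + 1) / (p + 1)) - k - 2 ≤ q - 1 := by
  have h0 : 0 < (q + 1) / (p + 1) := div_pos (by linarith) (by linarith)
  have h1 : (q + 1) / (p + 1) ≤ 1 := (div_le_one (by linarith)).2 (by linarith)
  have h2 : (q + 1) / (p + 1) ≤ q := by rw [div_le_iff₀ (by linarith)]; linarith
  have h3 : (q + 1) / (p + 1) * 2 ≤ q + 1 := by
    rw [div_mul_eq_mul_div, div_le_iff₀ (by linarith)]; nlinarith
  rcases le_total q 1 with h | h
  · exact ⟨q - 1, by linarith, by linarith, by linarith, by linarith, by linarith, by linarith⟩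
  · exact ⟨0, by linarith, by linarith, by linarith, by linarith, by linarith, by linarith⟩

section LocalDensity

variable {N : ℕ} {K : Set (Euc N)} {p q a b C : ℝ}

lemma setIntegral_le_add_add (hK : IsCompact K) (hK0 : K ⊆ {x : Euc N | x ≠ 0})
    {F G₁ G₂ G₃ : Euc N → ℝ} {c₁ c₂ c₃ : ℝ} (hF : ContinuousOn F {x : Euc N | x ≠ 0})
    (h₁ : ContinuousOn G₁ {x : Euc N | x ≠ 0}) (h₂ : ContinuousOn G₂ {x : Euc N | x ≠ 0})
    (h₃ : ContinuousOn G₃ {x : Euc N | x ≠ 0})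
    (h : ∀ x ∈ K, F x ≤ c₁ * G₁ x + (c₂ * G₂ x + c₃ * G₃ x)) :
    ∫ x in K, F x ≤ c₁ * (∫ x in K, G₁ x) + (c₂ * (∫ x in K, G₂ x) + c₃ * ∫ x in K, G₃ x) := by
  have i₁ := (h₁.integrableOn_punctured hK hK0).const_mul c₁
  have i₂ := (h₂.integrableOn_punctured hK hK0).const_mul c₂
  have i₃ := (h₃.integrableOn_punctured hK hK0).const_mul c₃
  have i₄ : Integrable (fun x => c₂ * G₂ x + c₃ * G₃ x) (volume.restrict K) := i₂.add i₃
  rw [← integral_const_mul, ← integral_const_mul, ← integral_const_mul,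
    ← integral_add i₂ i₃, ← integral_add i₁ i₄]
  exact setIntegral_mono_punctured hK hK0 hF (by fun_prop) h

lemma weighted_gradient_le {A B E : Euc N} {w k g u v U : ℝ} (hU : 0 < U)
    (hg : g = v * U) :
    U * ‖B‖ ^ 2 * w ^ 2 ≤
      2 * (w ^ 2 * inner ℝ B (U • B - (k * (v * (U * u⁻¹))) • A) + 2 * (w * g * inner ℝ B E)) +
      (2 * k ^ 2 * (v ^ 2 * (U * (u⁻¹) ^ 2) * ‖A‖ ^ 2 * w ^ 2) + 8 * (v ^ 2 * U * ‖E‖ ^ 2)) := by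
  subst hg
  have h1 := sq_nonneg ‖w • B - (2 * k * v * u⁻¹ * w) • A‖
  have h2 := sq_nonneg ‖w • B + (4 * v) • E‖
  rw [norm_sub_sq_real, norm_smul, norm_smul, real_inner_smul_left, real_inner_smul_right,
    mul_pow, mul_pow, Real.norm_eq_abs, Real.norm_eq_abs, sq_abs, sq_abs] at h1
  rw [norm_add_sq_real, norm_smul, norm_smul, real_inner_smul_left, real_inner_smul_right,
    mul_pow, mul_pow, Real.norm_eq_abs, Real.norm_eq_abs, sq_abs, sq_abs] at h2
  rw [inner_sub_right, real_inner_smul_right, real_inner_smul_right, real_inner_self_eq_norm_sq]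
  have h3 := mul_nonneg hU.le h1
  have h4 := mul_nonneg hU.le h2
  nlinarith

namespace IsPosSol

/-- Bounds for the weighted Dirichlet integrals of `u`. -/
lemma exists_gradient_fst_le (hK : IsCompact K)
    (hK0 : K ⊆ {x : Euc N | x ≠ 0}) {ζ : Euc N → ℝ} (hζ : ContDiff ℝ 2 ζ)
    (hs : tsupport ζ ⊆ K) (m : ℕ) : ∃ c, 0 ≤ c ∧ ∀ u v, IsPosSol p q a b C u v →
      (∫ x in K, (u x ^ (-2 : ℝ) + u x ^ (q - 1)) * ‖gradient u x‖ ^ 2 * ζ x ^ (2 * (m + 1))) ≤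
        c + ∫ x in K, u x ^ (q - 1) * ‖gradient u x‖ ^ 2 * ζ x ^ (2 * (m + 1)) := by
  set ω : Euc N → ℝ := fun x => ζ x ^ (m + 1) * 1 with hω
  have hω2 : ContDiff ℝ 1 ω := contDiff_pow_mul (hζ.of_le (by norm_num)) (hs.trans hK0)
    contDiffOn_const m
  refine ⟨4 * ∫ x in K, ‖gradient ω x‖ ^ 2,
    mul_nonneg (by norm_num) (integral_nonneg fun x => by positivity), fun u v h => ?_⟩
  have hu' : ∀ x ∈ {x : Euc N | x ≠ 0}, u x ≠ 0 := fun x _ => (h.fst_pos x).ne'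
  have hcu := h.contDiffOn_fst.continuousOn
  have hcg := h.contDiffOn_fst.continuousOn_gradient_punctured
  have hcζ := hζ.continuous
  have hardy := setIntegral_hardy hK hK0 h.contDiffOn_fst h.fst_pos hω2
    (tsupport_pow_mul_subset hs m)
  have hnn : 0 ≤ ∫ x in K, -lap u x * (u x ^ (-1 : ℝ) * ω x ^ 2) :=
    setIntegral_nonneg hK.measurableSet fun x hx => by
      rw [h.lap_fst x (hK0 hx)]
      have := h.fst_pos x
      have := h.snd_pos x
      positivity
  have i1 : IntegrableOn (fun x => u x ^ (-2 : ℝ) * ‖gradient u x‖ ^ 2 * ω x ^ 2) K :=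
    ContinuousOn.integrableOn_punctured (by fun_prop (disch := assumption)) hK hK0
  have i2 : IntegrableOn (fun x => u x ^ (q - 1) * ‖gradient u x‖ ^ 2 * ζ x ^ (2 * (m + 1))) K :=
    ContinuousOn.integrableOn_punctured (by fun_prop (disch := assumption)) hK hK0
  have e : (∫ x in K, (u x ^ (-2 : ℝ) + u x ^ (q - 1)) * ‖gradient u x‖ ^ 2 *
        ζ x ^ (2 * (m + 1))) =
      (∫ x in K, u x ^ (-2 : ℝ) * ‖gradient u x‖ ^ 2 * ω x ^ 2) +
        ∫ x in K, u x ^ (q - 1) * ‖gradient u x‖ ^ 2 * ζ x ^ (2 * (m + 1)) := by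
    rw [← integral_add i1 i2]
    refine setIntegral_congr_fun hK.measurableSet fun x _ => ?_
    simp only [ω]; ring
  rw [e]
  linarith

set_option maxHeartbeats 1000000 in
/-- Bounds for the weighted Dirichlet integrals of `v`. -/
lemma exists_gradient_snd_le (hp : 0 < p) (hC : 0 < C) (hK : IsCompact K)
    (hK0 : K ⊆ {x : Euc N | x ≠ 0}) {ζ : Euc N → ℝ} (hζ : ContDiff ℝ 2 ζ)
    (hζ0 : ∀ x, 0 ≤ ζ x) (hζ1 : ∀ x, ζ x ≤ 1) (hs : tsupport ζ ⊆ K) (m : ℕ) {k : ℝ}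
    (hk1 : 0 ≤ q - k + (q + 1) / (p + 1)) (hk2 : q - k + (q + 1) / (p + 1) ≤ q + 1)
    (hk3 : -2 ≤ 2 * ((q + 1) / (p + 1)) - k - 2) (hk4 : 2 * ((q + 1) / (p + 1)) - k - 2 ≤ q - 1) :
    ∃ c, 0 ≤ c ∧ ∀ u v, IsPosSol p q a b C u v →
      (∫ x in K, u x ^ (-k) * ‖gradient v x‖ ^ 2 * ζ x ^ (2 * (m + 1))) ≤
        c * ((∫ x in K, (1 + u x ^ (q + 1)) * ζ x ^ (2 * m)) + ∫ x in K,
          (u x ^ (-2 : ℝ) + u x ^ (q - 1)) * ‖gradient u x‖ ^ 2 * ζ x ^ (2 * (m + 1))) := by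
  obtain ⟨D, hD, HD⟩ := exists_snd_le (p := p) (q := q) (a := a) (b := b) hK hK0 hC hp
  obtain ⟨M, hM, HM⟩ := exists_norm_rpow_le hK hK0 b
  obtain ⟨cg, hcg, Hg⟩ := exists_norm_gradient_pow_mul_le hK hK0 hζ
    (contDiffOn_const (c := (1 : ℝ))) m
  set ω : Euc N → ℝ := fun x => ζ x ^ (m + 1) * 1 with hω
  have hω2 : ContDiff ℝ 1 ω := contDiff_pow_mul (hζ.of_le (by norm_num)) (hs.trans hK0)
    contDiffOn_const m
  have hcω := hω2.continuous
  have hgω := hω2.continuous_gradient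
  refine ⟨2 * (M * D) + 2 * k ^ 2 * D ^ 2 + 8 * D ^ 2 * cg, by positivity, fun u v h => ?_⟩
  have hu' : ∀ x ∈ {x : Euc N | x ≠ 0}, u x ≠ 0 := fun x _ => (h.fst_pos x).ne'
  have hcu := h.contDiffOn_fst.continuousOn
  have hcgu := h.contDiffOn_fst.continuousOn_gradient_punctured
  have hcv := h.contDiffOn_snd.continuousOn
  have hcgv := h.contDiffOn_snd.continuousOn_gradient_punctured
  have hcζ := hζ.continuous
  set Y := ∫ x in K, (1 + u x ^ (q + 1)) * ζ x ^ (2 * m) with hY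
  set G := ∫ x in K, (u x ^ (-2 : ℝ) + u x ^ (q - 1)) * ‖gradient u x‖ ^ 2 *
    ζ x ^ (2 * (m + 1)) with hG
  have hY0 : 0 ≤ Y := setIntegral_nonneg hK.measurableSet fun x _ => by
    have := h.fst_pos x
    have := hζ0 x
    positivity
  have hG0 : 0 ≤ G := setIntegral_nonneg hK.measurableSet fun x _ => by
    have := h.fst_pos x
    have := hζ0 x
    positivity
  have hd : ContDiffOn ℝ 1 (fun x => v x * u x ^ (-k)) {x : Euc N | x ≠ 0} :=
    (h.contDiffOn_snd.mul (h.contDiffOn_fst.rpow_of_pos h.fst_pos _)).of_le (by norm_num)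
  have hgd := (h.contDiffOn_snd.mul
    (h.contDiffOn_fst.rpow_of_pos h.fst_pos (-k))).continuousOn_gradient_punctured
  have hI := setIntegral_inner_gradient_mul_sq hK hK0 h.contDiffOn_snd hd hω2
    (tsupport_pow_mul_subset hs m)
  have hlap := continuousOn_lap h.contDiffOn_snd
  have h1 : (∫ x in K, -lap v x * (v x * u x ^ (-k) * ω x ^ 2)) ≤ M * D * Y := by
    rw [hY, ← integral_const_mul]
    refine setIntegral_mono_punctured hK hK0 (by fun_prop (disch := assumption))
      (by fun_prop (disch := assumption)) fun x hx => ?_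
    have hu := h.fst_pos x
    have hz : 0 ≤ ζ x := hζ0 x
    rw [h.lap_snd x (hK0 hx)]
    have e1 : u x ^ q * u x ^ ((q + 1) / (p + 1)) * u x ^ (-k) ≤ 1 + u x ^ (q + 1) := by
      rw [← Real.rpow_add hu, ← Real.rpow_add hu]
      exact rpow_le_one_add_rpow hu (by linarith) (by linarith)
    have e2 : ω x ^ 2 ≤ ζ x ^ (2 * m) := by
      have : ω x ^ 2 = ζ x ^ (2 * m + 2) := by simp only [ω]; ring
      rw [this]
      exact pow_le_pow_of_le_one hz (hζ1 x) (by omega)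
    calc ‖x‖ ^ b * u x ^ q * (v x * u x ^ (-k) * ω x ^ 2)
        ≤ M * u x ^ q * ((D * u x ^ ((q + 1) / (p + 1))) * u x ^ (-k) * ζ x ^ (2 * m)) := by
          have := HM x hx
          have := HD u v h x hx
          have := h.snd_pos x
          gcongr
      _ = M * D * (u x ^ q * u x ^ ((q + 1) / (p + 1)) * u x ^ (-k) * ζ x ^ (2 * m)) := by ring
      _ ≤ _ := by gcongr
  have h2 : (∫ x in K, v x ^ 2 * u x ^ (-k - 2) * ‖gradient u x‖ ^ 2 * ω x ^ 2) ≤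
      D ^ 2 * G := by
    rw [hG, ← integral_const_mul]
    refine setIntegral_mono_punctured hK hK0 (by fun_prop (disch := assumption))
      (by fun_prop (disch := assumption)) fun x hx => ?_
    have hu := h.fst_pos x
    have hv := h.snd_pos x
    have hz : 0 ≤ ζ x := hζ0 x
    have e1 : (u x ^ ((q + 1) / (p + 1))) ^ 2 * u x ^ (-k - 2) ≤
        u x ^ (-2 : ℝ) + u x ^ (q - 1) := by
      rw [pow_two, ← Real.rpow_add hu, ← Real.rpow_add hu]
      exact rpow_le_add_rpow hu (by linarith) (by linarith)
    calc v x ^ 2 * u x ^ (-k - 2) * ‖gradient u x‖ ^ 2 * ω x ^ 2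
        ≤ (D * u x ^ ((q + 1) / (p + 1))) ^ 2 * u x ^ (-k - 2) * ‖gradient u x‖ ^ 2 * ω x ^ 2 := by
          have := HD u v h x hx
          gcongr
      _ = D ^ 2 * ((u x ^ ((q + 1) / (p + 1))) ^ 2 * u x ^ (-k - 2) * ‖gradient u x‖ ^ 2 *
          ζ x ^ (2 * (m + 1))) := by simp only [ω]; ring
      _ ≤ _ := by gcongr
  have h3 : (∫ x in K, v x ^ 2 * u x ^ (-k) * ‖gradient ω x‖ ^ 2) ≤ D ^ 2 * cg * Y := by
    rw [hY, ← integral_const_mul]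
    refine setIntegral_mono_punctured hK hK0 (by fun_prop (disch := assumption))
      (by fun_prop (disch := assumption)) fun x hx => ?_
    have hu := h.fst_pos x
    have hv := h.snd_pos x
    have hz : 0 ≤ ζ x := hζ0 x
    have e1 : (u x ^ ((q + 1) / (p + 1))) ^ 2 * u x ^ (-k) ≤ 1 + u x ^ (q + 1) := by
      rw [pow_two, ← Real.rpow_add hu, ← Real.rpow_add hu]
      exact rpow_le_one_add_rpow hu (by linarith) (by linarith)
    calc v x ^ 2 * u x ^ (-k) * ‖gradient ω x‖ ^ 2
        ≤ (D * u x ^ ((q + 1) / (p + 1))) ^ 2 * u x ^ (-k) * (cg * ζ x ^ (2 * m)) := by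
          have := HD u v h x hx
          have := Hg x hx
          gcongr
      _ = D ^ 2 * cg * ((u x ^ ((q + 1) / (p + 1))) ^ 2 * u x ^ (-k) * ζ x ^ (2 * m)) := by ring
      _ ≤ _ := by gcongr
  have h4 : (∫ x in K, u x ^ (-k) * ‖gradient v x‖ ^ 2 * ζ x ^ (2 * (m + 1))) ≤
      2 * (∫ x in K, -lap v x * (v x * u x ^ (-k) * ω x ^ 2)) +
        (2 * k ^ 2 * (∫ x in K, v x ^ 2 * u x ^ (-k - 2) * ‖gradient u x‖ ^ 2 * ω x ^ 2) +
        8 * ∫ x in K, v x ^ 2 * u x ^ (-k) * ‖gradient ω x‖ ^ 2) := by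
    rw [← hI]
    refine setIntegral_le_add_add hK hK0 (by fun_prop (disch := assumption))
      (by fun_prop (disch := assumption)) (by fun_prop (disch := assumption))
      (by fun_prop (disch := assumption)) fun x hx => ?_
    have hu := h.fst_pos x
    have hvd := h.contDiffOn_snd.differentiableAt_punctured (hK0 hx)
    have hud := h.contDiffOn_fst.differentiableAt_punctured (hK0 hx)
    have hUd := (h.contDiffOn_fst.rpow_of_pos h.fst_pos (-k)).differentiableAt_punctured (hK0 hx)
    have e1 : gradient (fun x => v x * u x ^ (-k)) x = u x ^ (-k) • gradient v x -
        (k * (v x * (u x ^ (-k) * (u x)⁻¹))) • gradient u x := by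
      rw [gradient_mul hvd hUd, gradient_rpow_const hud hu, Real.rpow_sub hu, Real.rpow_one,
        smul_smul, add_comm, sub_eq_add_neg, ← neg_smul]
      congr 2
      ring
    have e2 : u x ^ (-k - 2) = u x ^ (-k) * ((u x)⁻¹) ^ 2 := by
      rw [Real.rpow_sub hu, inv_pow, div_eq_mul_inv]
      norm_num
    have := weighted_gradient_le (A := gradient u x) (B := gradient v x) (E := gradient ω x)
      (w := ω x) (k := k) (g := v x * u x ^ (-k)) (v := v x) (U := u x ^ (-k)) (u := u x)
      (by positivity) rfl
    rw [e1, e2]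
    have e3 : ζ x ^ (2 * (m + 1)) = ω x ^ 2 := by simp only [ω]; ring
    rw [e3]
    exact this
  have h5 := mul_le_mul_of_nonneg_left h2 (show 0 ≤ 2 * k ^ 2 by positivity)
  have e1 : 0 ≤ (2 * (M * D) + 8 * D ^ 2 * cg) * G := by positivity
  have e2 : 0 ≤ 2 * k ^ 2 * D ^ 2 * Y := by positivity
  linarith

end IsPosSol

end LocalDensity

section LocalDensityBound

variable {N : ℕ} {K : Set (Euc N)} {p q a b C : ℝ}

lemma density_le {C M D L y A B u v P Q V k₁ k₂ G T z w : ℝ} (hA : 0 ≤ A) (hB : 0 ≤ B)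
    (hu : 0 ≤ u) (hv : 0 ≤ v)
    (hC : 0 ≤ C) (hM : 0 ≤ M) (hL : 0 ≤ L) (hz : 0 ≤ z) (hzw : z ≤ w)
    (hP : P ≤ C * Q) (hQ : Q ≤ M * V) (hVw : 0 ≤ V) (hyL : y ≤ L)
    (hk : k₁ * k₂ = 1) (hk1 : 0 < k₁) (hk2 : 0 < k₂) (hG : k₁ * A ^ 2 ≤ G) (hT : k₂ * B ^ 2 = T)
    (hu2 : k₁ * u ^ 2 ≤ 1 + V) (hv2 : k₂ * v ^ 2 ≤ D * (1 + V)) (hD : 0 ≤ D) :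
    (P + Q + A * B + y * (u * B + v * A)) * z ≤
      ((C + 1) * M + L * (1 + D)) * ((1 + V) * w) + ((1 + L) * (G * z) + (1 + L) * (T * z)) := by
  subst hT
  have am : ∀ s t : ℝ, s * t ≤ (k₁ * s ^ 2 + k₂ * t ^ 2) := fun s t => by
    have h := mul_nonneg hk1.le (sq_nonneg (s - k₂ * t))
    have h' := mul_nonneg hk1.le (sq_nonneg s)
    have hnn := mul_nonneg hk2.le (sq_nonneg t)
    have e : k₁ * (s - k₂ * t) ^ 2 = k₁ * s ^ 2 - 2 * (k₁ * k₂) * (s * t) +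
      (k₁ * k₂) * (k₂ * t ^ 2) := by ring
    rw [hk] at e
    linarith
  have h1 := am A B
  have h2 := am u B
  have h3 := am A v
  have h4 : 0 ≤ k₁ * A ^ 2 := by positivity
  have h5 : 0 ≤ k₂ * B ^ 2 := by positivity
  have h6 : P + Q ≤ (C + 1) * M * (1 + V) := by
    have : (C + 1) * Q ≤ (C + 1) * (M * V) := by gcongr
    have : 0 ≤ (C + 1) * M := by positivity
    linarith
  have h7 : y * (u * B + v * A) ≤ L * ((1 + D) * (1 + V) + (G + k₂ * B ^ 2)) := by
    refine mul_le_mul hyL ?_ (by positivity) hL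
    linarith
  have h8 : P + Q + A * B + y * (u * B + v * A) ≤
      ((C + 1) * M + L * (1 + D)) * (1 + V) + ((1 + L) * G + (1 + L) * (k₂ * B ^ 2)) := by
    linarith
  have h9 := mul_le_mul_of_nonneg_right h8 hz
  have h10 : ((C + 1) * M + L * (1 + D)) * (1 + V) * z ≤
    ((C + 1) * M + L * (1 + D)) * (1 + V) * w := by gcongr
  linarith

namespace IsPosSol

set_option maxHeartbeats 1000000 in
/-- Uniform local bound for the boundary density of stable positive solutions. -/
theorem exists_density_le (hq : 0 < q) (hqp : q ≤ p) (h1pq : 1 < p * q)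
    (hpq : (p + 1) * (q + 1) < 4 * (p * q)) (hC : 0 < C) {A : Set (Euc N)} (hK : IsCompact K)
    (hK0 : K ⊆ {x : Euc N | x ≠ 0}) (hKA : K ⊆ A) {ζ : Euc N → ℝ} (hζ : ContDiff ℝ 2 ζ)
    (hζ0 : ∀ x, 0 ≤ ζ x) (hζ1 : ∀ x, ζ x ≤ 1) (hs : tsupport ζ ⊆ K) :
    ∃ (m : ℕ) (B : ℝ), ∀ u v, IsPosSol p q a b C u v → StabilityOn p q a b u v A →
      ∫ x in K, pohozaevDensity p q a b u v x * ζ x ^ (2 * (m + 1)) ≤ B := by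
  have hp : 0 < p := hq.trans_le hqp
  obtain ⟨m, B, hB, H⟩ := exists_local_bound (a := a) (b := b) hp hq h1pq hpq hC hK hK0 hKA hζ
    hζ0 hζ1 hs
  obtain ⟨k, hk2, hkq, hk3, hk4, hk5, hk6⟩ := exists_exponent hq hqp h1pq.le
  obtain ⟨c₁, hc₁, H₁⟩ := exists_gradient_fst_le (p := p) (q := q) (a := a) (b := b) (C := C)
    hK hK0 hζ hs m
  obtain ⟨c₂, hc₂, H₂⟩ := exists_gradient_snd_le (p := p) (q := q) (a := a) (b := b) hp hC
    hK hK0 hζ hζ0 hζ1 hs m hk3 hk4 hk5 hk6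
  obtain ⟨D, hD, HD⟩ := exists_snd_le (p := p) (q := q) (a := a) (b := b) hK hK0 hC hp
  obtain ⟨M, hM, HM⟩ := exists_norm_rpow_le hK hK0 b
  obtain ⟨L, hL, HL⟩ := exists_norm_rpow_le hK hK0 (-1)
  set y := volume.real K + B with hy
  have hy0 : 0 ≤ y := by positivity
  refine ⟨m, ((C + 1) * M + L * (1 + D ^ 2)) * y + ((1 + L) * (c₁ + B) +
    (1 + L) * (c₂ * (y + (c₁ + B)))), fun u v h hst => ?_⟩
  obtain ⟨h1, h2⟩ := H u v h hst
  have hu' : ∀ x ∈ {x : Euc N | x ≠ 0}, u x ≠ 0 := fun x _ => (h.fst_pos x).ne'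
  have hv' : ∀ x ∈ {x : Euc N | x ≠ 0}, v x ≠ 0 := fun x _ => (h.snd_pos x).ne'
  have hn' : ∀ x ∈ {x : Euc N | x ≠ 0}, ‖x‖ ≠ 0 := fun x hx => norm_ne_zero_iff.2 hx
  have hcu := h.contDiffOn_fst.continuousOn
  have hcgu := h.contDiffOn_fst.continuousOn_gradient_punctured
  have hcv := h.contDiffOn_snd.continuousOn
  have hcgv := h.contDiffOn_snd.continuousOn_gradient_punctured
  have hcζ := hζ.continuous
  have hY : (∫ x in K, (1 + u x ^ (q + 1)) * ζ x ^ (2 * m)) ≤ y := by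
    have i1 : IntegrableOn (fun x => u x ^ (q + 1) * ζ x ^ (2 * m)) K :=
      ContinuousOn.integrableOn_punctured (by fun_prop (disch := assumption)) hK hK0
    have i2 : IntegrableOn (fun _ : Euc N => (1 : ℝ)) K :=
      ContinuousOn.integrableOn_punctured continuousOn_const hK hK0
    calc _ ≤ ∫ x in K, (1 + u x ^ (q + 1) * ζ x ^ (2 * m)) :=
          setIntegral_mono_punctured hK hK0 (by fun_prop (disch := assumption))
            (by fun_prop (disch := assumption)) fun x _ => by
              have := pow_le_one₀ (hζ0 x) (hζ1 x) (n := 2 * m)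
              linarith
      _ = volume.real K + ∫ x in K, u x ^ (q + 1) * ζ x ^ (2 * m) := by
          rw [integral_add i2 i1]; simp
      _ ≤ _ := by linarith
  have hG := (H₁ u v h).trans (add_le_add_right h2 c₁)
  have hT := (H₂ u v h).trans (mul_le_mul_of_nonneg_left (add_le_add hY hG) hc₂)
  refine le_trans (setIntegral_le_add_add hK hK0 (F := fun x =>
      pohozaevDensity p q a b u v x * ζ x ^ (2 * (m + 1)))
    (G₁ := fun x => (1 + u x ^ (q + 1)) * ζ x ^ (2 * m))
    (G₂ := fun x => (u x ^ (-2 : ℝ) + u x ^ (q - 1)) * ‖gradient u x‖ ^ 2 * ζ x ^ (2 * (m + 1)))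
    (G₃ := fun x => u x ^ (-k) * ‖gradient v x‖ ^ 2 * ζ x ^ (2 * (m + 1)))
    (c₁ := (C + 1) * M + L * (1 + D ^ 2)) (c₂ := 1 + L) (c₃ := 1 + L)
    ?_ (by fun_prop (disch := assumption)) (by fun_prop (disch := assumption))
      (by fun_prop (disch := assumption)) fun x hx => ?_) ?_
  · unfold pohozaevDensity
    fun_prop (disch := assumption)
  · have hu := h.fst_pos x
    have hv := h.snd_pos x
    have hx0 := hK0 hx
    have hz := hζ0 x
    unfold pohozaevDensity
    refine density_le (k₁ := u x ^ k) (k₂ := u x ^ (-k)) (norm_nonneg _) (norm_nonneg _)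
      hu.le hv.le hC.le hM.le hL.le (by positivity)
      (pow_le_pow_of_le_one hz (hζ1 x) (by omega)) (h.comparison x hx0)
      (mul_le_mul_of_nonneg_right (HM x hx) (by positivity)) (by positivity) ?_ ?_
      (by positivity) (by positivity) ?_ rfl ?_ ?_ (by positivity)
    · rw [← Real.rpow_neg_one]
      exact HL x hx
    · rw [← Real.rpow_add hu]; simp
    · exact mul_le_mul_of_nonneg_right (rpow_le_add_rpow hu hk2 hkq) (by positivity)
    · rw [← Real.rpow_natCast, ← Real.rpow_add hu]
      exact rpow_le_one_add_rpow hu (by push_cast; linarith) (by push_cast; linarith)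
    · calc u x ^ (-k) * v x ^ 2 ≤ u x ^ (-k) * (D * u x ^ ((q + 1) / (p + 1))) ^ 2 := by
            have := HD u v h x hx
            gcongr
        _ = D ^ 2 * (u x ^ (-k) * (u x ^ ((q + 1) / (p + 1))) ^ 2) := by ring
        _ ≤ _ := by
            refine mul_le_mul_of_nonneg_left ?_ (by positivity)
            rw [pow_two, ← Real.rpow_add hu, ← Real.rpow_add hu]
            exact rpow_le_one_add_rpow hu (by linarith) (by linarith)
  · have hL1 : 0 ≤ 1 + L := by linarith
    have hc : 0 ≤ (C + 1) * M + L * (1 + D ^ 2) := by positivity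
    exact add_le_add (mul_le_mul_of_nonneg_left hY hc)
      (add_le_add (mul_le_mul_of_nonneg_left hG hL1) (mul_le_mul_of_nonneg_left hT hL1))

end IsPosSol

end LocalDensityBound

section Scaling

variable {N : ℕ} {p q a b C α β : ℝ} {u v : Euc N → ℝ}

/-- The dilation `x ↦ R ^ α * u (R x)`. -/
def dilate (α R : ℝ) (u : Euc N → ℝ) (x : Euc N) : ℝ := R ^ α * u (R • x)

lemma fderiv_dilate (α R : ℝ) (u : Euc N → ℝ) :
    fderiv ℝ (dilate α R u) = fun x => (R ^ α * R) • fderiv ℝ u (R • x) := by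
  funext x
  have h : dilate α R u = R ^ α • fun x => u (R • x) := rfl
  rw [h, fderiv_const_smul_field, Pi.smul_apply, fderiv_comp_smul, smul_smul]

lemma gradient_dilate (α R : ℝ) (u : Euc N → ℝ) (x : Euc N) :
    gradient (dilate α R u) x = (R ^ α * R) • gradient u (R • x) := by
  simp [gradient, fderiv_dilate]

lemma lap_dilate (α R : ℝ) (u : Euc N → ℝ) (x : Euc N) :
    lap (dilate α R u) x = R ^ α * R ^ 2 * lap u (R • x) := by
  have h : (fun x => (R ^ α * R) • fderiv ℝ u (R • x)) =
    (R ^ α * R) • fun x => fderiv ℝ u (R • x) := rfl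
  have h' : fderiv ℝ (fderiv ℝ (dilate α R u)) x =
      (R ^ α * R * R) • fderiv ℝ (fderiv ℝ u) (R • x) := by
    rw [fderiv_dilate, h, fderiv_const_smul_field (R ^ α * R) (f := fun x => fderiv ℝ u (R • x)),
      Pi.smul_apply, fderiv_comp_smul (f := fderiv ℝ u), smul_smul]
  rw [lap_eq_sum, lap_eq_sum, h', Finset.mul_sum]
  refine Finset.sum_congr rfl fun i _ => ?_
  simp only [smul_apply, smul_eq_mul]
  ring

lemma contDiffOn_dilate {n : WithTop ℕ∞} (hu : ContDiffOn ℝ n u {x : Euc N | x ≠ 0}) {R : ℝ}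
    (hR : 0 < R) (α : ℝ) : ContDiffOn ℝ n (dilate α R u) {x : Euc N | x ≠ 0} :=
  contDiffOn_const.mul (hu.comp (contDiffOn_id.const_smul R) fun _ hx => smul_ne_zero hR.ne' hx)

lemma integral_dilate_eq {F : Euc N → ℝ} {R : ℝ} (hR : 0 < R) :
    ∫ x, F x = R ^ N * ∫ x, F (R • x) := by
  rw [Measure.integral_comp_smul]
  simp [abs_of_pos hR, hR.ne']

lemma IsPosSol.dilate (h : IsPosSol p q a b C u v) (hα : α + 2 = p * β - a)
    (hβ : β + 2 = q * α - b) {R : ℝ} (hR : 0 < R) :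
    IsPosSol p q a b C (dilate α R u) (dilate β R v) where
  contDiffOn_fst := contDiffOn_dilate h.contDiffOn_fst hR α
  contDiffOn_snd := contDiffOn_dilate h.contDiffOn_snd hR β
  fst_pos x := mul_pos (Real.rpow_pos_of_pos hR _) (h.fst_pos _)
  snd_pos x := mul_pos (Real.rpow_pos_of_pos hR _) (h.snd_pos _)
  lap_fst x hx := by
    have h1 := h.lap_fst (R • x) (smul_ne_zero hR.ne' hx)
    have h2 : R ^ α * R ^ 2 * R ^ a = (R ^ β) ^ p := by
      rw [← Real.rpow_mul hR.le, ← Real.rpow_natCast, ← Real.rpow_add hR, ← Real.rpow_add hR]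
      congr 1; push_cast; linarith
    rw [norm_smul, Real.norm_of_nonneg hR.le, Real.mul_rpow hR.le (norm_nonneg _)] at h1
    rw [lap_dilate, ← mul_neg, h1, _root_.dilate,
      Real.mul_rpow (Real.rpow_nonneg hR.le _) (h.snd_pos _).le, ← h2]
    ring
  lap_snd x hx := by
    have h1 := h.lap_snd (R • x) (smul_ne_zero hR.ne' hx)
    have h2 : R ^ β * R ^ 2 * R ^ b = (R ^ α) ^ q := by
      rw [← Real.rpow_mul hR.le, ← Real.rpow_natCast, ← Real.rpow_add hR, ← Real.rpow_add hR]
      congr 1; push_cast; linarith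
    rw [norm_smul, Real.norm_of_nonneg hR.le, Real.mul_rpow hR.le (norm_nonneg _)] at h1
    rw [lap_dilate, ← mul_neg, h1, _root_.dilate,
      Real.mul_rpow (Real.rpow_nonneg hR.le _) (h.fst_pos _).le, ← h2]
    ring
  comparison x hx := by
    have h1 := h.comparison (R • x) (smul_ne_zero hR.ne' hx)
    have h2 : (R ^ β) ^ (p + 1) = R ^ (α + β + 2) * R ^ a := by
      rw [← Real.rpow_mul hR.le, ← Real.rpow_add hR]
      congr 1; linarith
    have h3 : (R ^ α) ^ (q + 1) = R ^ (α + β + 2) * R ^ b := by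
      rw [← Real.rpow_mul hR.le, ← Real.rpow_add hR]
      congr 1; linarith
    rw [norm_smul, Real.norm_of_nonneg hR.le, Real.mul_rpow hR.le (norm_nonneg _),
      Real.mul_rpow hR.le (norm_nonneg _)] at h1
    rw [_root_.dilate, _root_.dilate, Real.mul_rpow (Real.rpow_nonneg hR.le _) (h.fst_pos _).le,
      Real.mul_rpow (Real.rpow_nonneg hR.le _) (h.snd_pos _).le, h2, h3]
    have := mul_le_mul_of_nonneg_left h1 (Real.rpow_nonneg hR.le (α + β + 2))
    refine le_of_eq_of_le ?_ (this.trans_eq ?_) <;> ring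

lemma pohozaevDensity_dilate (hu : ∀ x, 0 < u x) (hv : ∀ x, 0 < v x) (hα : α + 2 = p * β - a)
    (hβ : β + 2 = q * α - b) {R : ℝ} (hR : 0 < R) (x : Euc N) :
    pohozaevDensity p q a b (dilate α R u) (dilate β R v) x =
      R ^ (α + β + 2) * pohozaevDensity p q a b u v (R • x) := by
  have h2 : (R ^ β) ^ (p + 1) = R ^ (α + β + 2) * R ^ a := by
    rw [← Real.rpow_mul hR.le, ← Real.rpow_add hR]
    congr 1; linarith
  have h3 : (R ^ α) ^ (q + 1) = R ^ (α + β + 2) * R ^ b := by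
    rw [← Real.rpow_mul hR.le, ← Real.rpow_add hR]
    congr 1; linarith
  have h4 : R ^ (α + β + 2) = R ^ α * R ^ β * R ^ 2 := by
    rw [Real.rpow_add hR, Real.rpow_add hR]; norm_num
  have hRα := Real.rpow_pos_of_pos hR α
  have hRβ := Real.rpow_pos_of_pos hR β
  simp only [pohozaevDensity, gradient_dilate, norm_smul, Real.norm_of_nonneg hR.le, dilate]
  rw [Real.mul_rpow hRα.le (hu _).le, Real.mul_rpow hRβ.le (hv _).le,
    Real.mul_rpow hR.le (norm_nonneg _), Real.mul_rpow hR.le (norm_nonneg _), h2, h3,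
    Real.norm_of_nonneg (by positivity), Real.norm_of_nonneg (by positivity), mul_inv]
  simp only [h4]
  field_simp

lemma StabilityOn.dilate {R₀ R₅ : ℝ} (hR₀ : 0 < R₀) (hu : ∀ x, 0 < u x) (hv : ∀ x, 0 < v x)
    (hα : α + 2 = p * β - a) (hβ : β + 2 = q * α - b) {R : ℝ} (hR : 0 < R)
    (h : StabilityOn p q a b u v
      (ball (0 : Euc N) (R * R₅) \ closure (ball (0 : Euc N) (R * R₀)))) :
    StabilityOn p q a b (dilate α R u) (dilate β R v)
      (ball (0 : Euc N) R₅ \ closure (ball (0 : Euc N) R₀)) := by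
  intro φ hφ hc hs
  have hRi : R⁻¹ ≠ 0 := inv_ne_zero hR.ne'
  have key := h (fun x => φ (R⁻¹ • x)) (by fun_prop) (hc.comp_smul hRi) ?_
  · rw [integral_dilate_eq hR, integral_dilate_eq hR (F := fun x => _ ^ 2)] at key
    have hg : ∀ x, gradient (fun x => φ (R⁻¹ • x)) (R • x) = R⁻¹ • gradient φ x := by
      intro x
      have := gradient_dilate 0 R⁻¹ φ (R • x)
      simp only [inv_smul_smul₀ hR.ne', Real.rpow_zero, one_mul] at this
      rw [← this]
      congr 1
      funext y
      simp [_root_.dilate]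
    have hRα := Real.rpow_pos_of_pos hR α
    have hRβ := Real.rpow_pos_of_pos hR β
    have h1 : (R ^ α) ^ ((q - 1) / 2) * (R ^ β) ^ ((p - 1) / 2) = R ^ ((a + b) / 2) * R ^ 2 := by
      rw [← Real.rpow_mul hR.le, ← Real.rpow_mul hR.le, ← Real.rpow_natCast, ← Real.rpow_add hR,
        ← Real.rpow_add hR]
      congr 1; push_cast; linarith
    simp only [hg, inv_smul_smul₀ hR.ne', norm_smul, norm_inv, Real.norm_of_nonneg hR.le,
      Real.mul_rpow hR.le (norm_nonneg _), mul_pow, integral_const_mul] at key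
    have h2 : ∀ x, ‖x‖ ^ ((a + b) / 2) * _root_.dilate α R u x ^ ((q - 1) / 2) *
        _root_.dilate β R v x ^ ((p - 1) / 2) * φ x ^ 2 =
        R ^ 2 * (R ^ ((a + b) / 2) * ‖x‖ ^ ((a + b) / 2) * u (R • x) ^ ((q - 1) / 2) *
          v (R • x) ^ ((p - 1) / 2) * φ x ^ 2) := by
      intro x
      rw [_root_.dilate, _root_.dilate, Real.mul_rpow hRα.le (hu _).le,
        Real.mul_rpow hRβ.le (hv _).le]
      linear_combination (‖x‖ ^ ((a + b) / 2) * u (R • x) ^ ((q - 1) / 2) *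
          v (R • x) ^ ((p - 1) / 2) * φ x ^ 2) * h1
    simp only [h2, integral_const_mul]
    have h3 := mul_le_mul_of_nonneg_left key (by positivity : 0 ≤ (R ^ N)⁻¹ * R ^ 2)
    refine le_of_eq_of_le ?_ (h3.trans_eq ?_) <;> field_simp
  · have h1 : tsupport (fun x => φ (R⁻¹ • x)) ⊆ (fun x : Euc N => R⁻¹ • x) ⁻¹' tsupport φ :=
      tsupport_comp_subset_preimage φ (continuous_const_smul R⁻¹)
    intro x hx
    obtain ⟨h2, h3⟩ := hs (h1 hx)
    refine ⟨?_, ?_⟩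
    · rw [mem_ball_zero_iff, norm_smul, norm_inv, Real.norm_of_nonneg hR.le,
        inv_mul_lt_iff₀ hR] at h2
      simpa using h2
    · rw [closure_ball _ (by positivity), mem_closedBall_zero_iff, not_le] at h3 ⊢
      rwa [norm_smul, norm_inv, Real.norm_of_nonneg hR.le, lt_inv_mul_iff₀ hR] at h3

end Scaling

section BlowUp

variable {N : ℕ} {p q a b C : ℝ} {K : Set (Euc N)} {ζ : Euc N → ℝ}

lemma integral_mul_comp_inv_smul {F : Euc N → ℝ} {R : ℝ} (hR : 0 < R) (hs : tsupport ζ ⊆ K)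
    {k : ℕ} (hk : k ≠ 0) :
    ∫ x, F x * ζ (R⁻¹ • x) ^ k = R ^ N * ∫ x in K, F (R • x) * ζ x ^ k := by
  rw [integral_dilate_eq hR, setIntegral_eq_integral_of_forall_compl_eq_zero]
  · simp only [inv_smul_smul₀ hR.ne']
  · intro x hx
    rw [image_eq_zero_of_notMem_tsupport fun h => hx (hs h), zero_pow hk, mul_zero]

/-- Decay of the integral of the Pohozaev density over large annuli. -/
lemma exists_integral_density_le_of_stable {α β R₀ R₅ Rstar : ℝ} (hq : 0 < q) (hqp : q ≤ p)
    (h1pq : 1 < p * q) (hpq : (p + 1) * (q + 1) < 4 * (p * q)) (hC : 0 < C)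
    (hα : α + 2 = p * β - a) (hβ : β + 2 = q * α - b) (hR₀ : 0 < R₀) (hRs : 0 < Rstar)
    (hK : IsCompact K) (hKA : K ⊆ ball (0 : Euc N) R₅ \ closure (ball (0 : Euc N) R₀))
    (hζ : ContDiff ℝ 2 ζ) (hζ0 : ∀ x, 0 ≤ ζ x) (hζ1 : ∀ x, ζ x ≤ 1) (hs : tsupport ζ ⊆ K)
    {u v : Euc N → ℝ} (h : IsPosSol p q a b C u v)
    (hst : ∀ R, Rstar ≤ R → StabilityOn p q a b u v
      (ball (0 : Euc N) (R * R₅) \ closure (ball (0 : Euc N) (R * R₀)))) :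
    ∃ (m : ℕ) (B : ℝ), ∀ R, Rstar ≤ R →
      ∫ x, pohozaevDensity p q a b u v x * ζ (R⁻¹ • x) ^ (2 * (m + 1)) ≤
        B * R ^ ((N : ℝ) - (α + β + 2)) := by
  have hK0 : K ⊆ {x : Euc N | x ≠ 0} := by
    rintro x hx rfl
    exact (hKA hx).2 (subset_closure (mem_ball_self hR₀))
  obtain ⟨m, B, hB⟩ := IsPosSol.exists_density_le (a := a) (b := b) hq hqp h1pq hpq hC hK hK0 hKA
    hζ hζ0 hζ1 hs
  refine ⟨m, B, fun R hR => ?_⟩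
  have hRp := hRs.trans_le hR
  rw [integral_mul_comp_inv_smul hRp hs (by omega)]
  have h1 := hB _ _ (h.dilate hα hβ hRp)
    ((hst R hR).dilate hR₀ h.fst_pos h.snd_pos hα hβ hRp)
  simp only [pohozaevDensity_dilate h.fst_pos h.snd_pos hα hβ hRp, mul_assoc,
    integral_const_mul] at h1
  have hS := Real.rpow_pos_of_pos hRp (α + β + 2)
  rw [Real.rpow_sub hRp, Real.rpow_natCast, ← mul_div_assoc, le_div_iff₀ hS]
  have := mul_le_mul_of_nonneg_left h1 (by positivity : 0 ≤ R ^ N)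
  linarith

/-- Caccioppoli estimate for bounded functions with Laplacian bounded from below. -/
lemma exists_caccioppoli (hK : IsCompact K) (hK0 : K ⊆ {x : Euc N | x ≠ 0})
    (hζ : ContDiff ℝ 2 ζ) (hζ0 : ∀ x, 0 ≤ ζ x) (hζ1 : ∀ x, ζ x ≤ 1) (hs : tsupport ζ ⊆ K)
    (m : ℕ) (M L : ℝ) (hL : 0 ≤ L) :
    ∃ B, ∀ w : Euc N → ℝ, ContDiffOn ℝ 2 w {x : Euc N | x ≠ 0} → (∀ x, 0 < w x) →
      (∀ x ∈ K, w x ≤ M) → (∀ x ∈ K, -lap w x ≤ L) →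
      ∫ x in K, ‖gradient w x‖ ^ 2 * ζ x ^ (2 * (m + 1)) ≤ B := by
  obtain ⟨c, hc0, hc⟩ := exists_norm_gradient_pow_mul_le hK hK0 hζ
    (contDiffOn_const (c := (1 : ℝ))) m
  refine ⟨∫ x in K, (2 * (L * M) + 4 * (M ^ 2 * c)), fun w hw hw0 hwM hwL => ?_⟩
  set ω : Euc N → ℝ := fun y => ζ y ^ (m + 1) * 1 with hωd
  have hs0 := hs.trans hK0
  have hω : ContDiff ℝ 2 ω := contDiff_pow_mul hζ hs0 contDiffOn_const m
  have hωs : tsupport ω ⊆ K := tsupport_pow_mul_subset hs m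
  have hid := setIntegral_rpow_mul_sq hK hK0 hw hw0 (hω.of_le (by norm_num)) hωs 1
  have hcw := hw.continuousOn
  have hcg := hw.continuousOn_gradient_punctured
  have hcl := continuousOn_lap hw
  have hcω := hω.continuous
  have hcgω := (hω.of_le (by norm_num) : ContDiff ℝ 1 ω).continuous_gradient
  have hcζ := hζ.continuous
  simp only [sub_self, Real.rpow_zero, Real.rpow_one, one_mul] at hid
  have h1 : ∫ x in K, ‖gradient w x‖ ^ 2 * ζ x ^ (2 * (m + 1)) ≤
      ∫ x in K, (2 * (‖gradient w x‖ ^ 2 * ω x ^ 2 +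
        2 * (w x * ω x * inner ℝ (gradient w x) (gradient ω x))) + 4 * (M ^ 2 * c)) := by
    refine setIntegral_mono_punctured hK hK0 (by fun_prop) (by fun_prop) fun x hx => ?_
    have e1 : ζ x ^ (2 * (m + 1)) = ω x ^ 2 := by simp only [hωd]; ring
    have e2 := (abs_le.1 (abs_real_inner_le_norm (gradient w x) (gradient ω x))).1
    have e3 : ‖gradient ω x‖ ^ 2 ≤ c :=
      (hc x hx).trans (mul_le_of_le_one_right hc0 (pow_le_one₀ (hζ0 x) (hζ1 x)))
    have e4 : w x ^ 2 * ‖gradient ω x‖ ^ 2 ≤ M ^ 2 * c :=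
      mul_le_mul (pow_le_pow_left₀ (hw0 x).le (hwM x hx) 2) e3 (by positivity) (by positivity)
    have e5 : 0 ≤ w x * ω x := mul_nonneg (hw0 x).le (mul_nonneg (pow_nonneg (hζ0 x) _) zero_le_one)
    have e6 := mul_le_mul_of_nonneg_left e2 e5
    rw [e1]
    nlinarith [sq_nonneg (‖gradient w x‖ * ω x - 2 * (w x * ‖gradient ω x‖))]
  have hint : IntegrableOn (fun x => ‖gradient w x‖ ^ 2 * ω x ^ 2 +
        2 * (w x * ω x * inner ℝ (gradient w x) (gradient ω x))) K :=
    ContinuousOn.integrableOn_punctured (by fun_prop) hK hK0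
  have hconst : ∀ r : ℝ, IntegrableOn (fun _ : Euc N => r) K := fun r =>
    continuousOn_const.integrableOn_compact hK
  rw [integral_add (hint.const_mul 2) (hconst _), integral_const_mul, hid, ← integral_const_mul,
    ← integral_add (ContinuousOn.integrableOn_punctured (by fun_prop) hK hK0) (hconst _)] at h1
  refine h1.trans (setIntegral_mono_punctured hK hK0 (by fun_prop) (by fun_prop) fun x hx => ?_)
  have e7 : -lap w x * (w x * ω x ^ 2) ≤ L * M := by
    have : ω x ^ 2 ≤ 1 := by
      simp only [hωd, mul_one]
      exact pow_le_one₀ (pow_nonneg (hζ0 x) _) (pow_le_one₀ (hζ0 x) (hζ1 x))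
    have h2 : 0 ≤ w x * ω x ^ 2 := mul_nonneg (hw0 x).le (sq_nonneg _)
    refine (mul_le_mul_of_nonneg_right (hwL x hx) h2).trans (mul_le_mul_of_nonneg_left ?_ hL)
    exact (mul_le_of_le_one_right (hw0 x).le this).trans (hwM x hx)
  linarith

/-- Decay of the integral of the Pohozaev density over small annuli. -/
lemma exists_integral_density_le_of_continuous (hN : 3 ≤ N) (hp : 0 < p) (hq : 0 < q)
    (ha : -2 < a) (hb : -2 < b)
    (hK : IsCompact K) (hK0 : K ⊆ {x : Euc N | x ≠ 0})
    (hζ : ContDiff ℝ 2 ζ) (hζ0 : ∀ x, 0 ≤ ζ x) (hζ1 : ∀ x, ζ x ≤ 1) (hs : tsupport ζ ⊆ K)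
    {u v : Euc N → ℝ} (h : IsPosSol p q a b C u v) (hu : Continuous u) (hv : Continuous v)
    (m : ℕ) :
    ∃ B : ℝ, ∀ ε, 0 < ε → ε ≤ 1 →
      ∫ x, pohozaevDensity p q a b u v x * ζ (ε⁻¹ • x) ^ (2 * (m + 1)) ≤ B * ε := by
  obtain ⟨ρ, hρ⟩ := hK.isBounded.subset_closedBall 0
  obtain ⟨M₁, hM₁⟩ := (isCompact_closedBall (0 : Euc N) ρ).exists_bound_of_continuousOn
    (hu.add hv).continuousOn
  obtain ⟨Ma, hMa0, hMa⟩ := exists_norm_rpow_le hK hK0 a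
  obtain ⟨Mb, hMb0, hMb⟩ := exists_norm_rpow_le hK hK0 b
  obtain ⟨Mi, hMi0, hMi⟩ := exists_norm_rpow_le hK hK0 (-1)
  obtain ⟨M, hM0, hM₁M⟩ : ∃ M, 0 ≤ M ∧ M₁ ≤ M := ⟨|M₁|, abs_nonneg _, le_abs_self _⟩
  have hM : ∀ ε : ℝ, 0 < ε → ε ≤ 1 → ∀ x ∈ K, u (ε • x) ≤ M ∧ v (ε • x) ≤ M := by
    intro ε h0 h1 x hx
    have hx' := mem_closedBall_zero_iff.1 (hρ hx)
    have hb : ε • x ∈ closedBall (0 : Euc N) ρ := by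
      rw [mem_closedBall_zero_iff, norm_smul, Real.norm_of_nonneg h0.le]
      exact (mul_le_of_le_one_left (norm_nonneg _) h1).trans hx'
    have h2 := (le_abs_self _).trans (hM₁ _ hb)
    simp only [Pi.add_apply] at h2
    have := h.fst_pos (ε • x)
    have := h.snd_pos (ε • x)
    exact ⟨by linarith, by linarith⟩
  obtain ⟨Bu, hBu⟩ := exists_caccioppoli hK hK0 hζ hζ0 hζ1 hs m M (Ma * M ^ p) (by positivity)
  obtain ⟨Bv, hBv⟩ := exists_caccioppoli hK hK0 hζ hζ0 hζ1 hs m M (Mb * M ^ q) (by positivity)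
  set D := Ma * M ^ (p + 1) + Mb * M ^ (q + 1) + Mi ^ 2 * M ^ 2 with hD
  have hD0 : 0 ≤ D := by positivity
  refine ⟨D * (∫ x in K, (1 : ℝ)) + (1 * Bu + 1 * Bv), fun ε h0 h1 => ?_⟩
  have hw : ∀ r : ℝ, -2 < r → ∀ x ∈ K, ∀ (M' : ℝ), ‖x‖ ^ r ≤ M' →
      ε ^ 2 * ‖ε • x‖ ^ r ≤ M' := by
    intro r hr x hx M' hM'
    have : ε ^ 2 * ε ^ r ≤ 1 := by
      rw [← Real.rpow_natCast, ← Real.rpow_add h0]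
      exact Real.rpow_le_one h0.le h1 (by push_cast; linarith)
    rw [norm_smul, Real.norm_of_nonneg h0.le, Real.mul_rpow h0.le (norm_nonneg _), ← mul_assoc]
    exact (mul_le_of_le_one_left (by positivity) this).trans hM'
  set U := dilate 0 ε u with hU
  set V := dilate 0 ε v with hV
  have hUx : ∀ x, U x = u (ε • x) := fun x => by simp [hU, dilate]
  have hVx : ∀ x, V x = v (ε • x) := fun x => by simp [hV, dilate]
  have hUg : ∀ x, gradient U x = ε • gradient u (ε • x) := fun x => by simp [hU, gradient_dilate]
  have hVg : ∀ x, gradient V x = ε • gradient v (ε • x) := fun x => by simp [hV, gradient_dilate]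
  have hUc := contDiffOn_dilate h.contDiffOn_fst h0 0
  have hVc := contDiffOn_dilate h.contDiffOn_snd h0 0
  have iU := hBu U hUc (fun x => hUx x ▸ h.fst_pos _) (fun x hx => hUx x ▸ (hM ε h0 h1 x hx).1)
    fun x hx => by
      have hv0 := h.snd_pos (ε • x)
      rw [hU, lap_dilate, Real.rpow_zero, one_mul, ← mul_neg,
        h.lap_fst _ (smul_ne_zero h0.ne' (hK0 hx)), ← mul_assoc]
      exact mul_le_mul (hw a ha x hx Ma (hMa x hx))
        (Real.rpow_le_rpow hv0.le (hM ε h0 h1 x hx).2 hp.le) (by positivity) hMa0.le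
  have iV := hBv V hVc (fun x => hVx x ▸ h.snd_pos _) (fun x hx => hVx x ▸ (hM ε h0 h1 x hx).2)
    fun x hx => by
      have hu0 := h.fst_pos (ε • x)
      rw [hV, lap_dilate, Real.rpow_zero, one_mul, ← mul_neg,
        h.lap_snd _ (smul_ne_zero h0.ne' (hK0 hx)), ← mul_assoc]
      exact mul_le_mul (hw b hb x hx Mb (hMb x hx))
        (Real.rpow_le_rpow hu0.le (hM ε h0 h1 x hx).1 hq.le) (by positivity) hMb0.le
  have hcζ := hζ.continuous
  have hcgU := hUc.continuousOn_gradient_punctured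
  have hcgV := hVc.continuousOn_gradient_punctured
  have hu' : ∀ x ∈ {x : Euc N | x ≠ 0}, u (ε • x) ≠ 0 := fun x _ => (h.fst_pos _).ne'
  have hv' : ∀ x ∈ {x : Euc N | x ≠ 0}, v (ε • x) ≠ 0 := fun x _ => (h.snd_pos _).ne'
  have hn' : ∀ x ∈ {x : Euc N | x ≠ 0}, ‖ε • x‖ ≠ 0 := fun x hx =>
    norm_ne_zero_iff.2 (smul_ne_zero h0.ne' hx)
  have hcgu : ContinuousOn (fun x => gradient u (ε • x)) {x : Euc N | x ≠ 0} :=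
    h.contDiffOn_fst.continuousOn_gradient_punctured.comp (by fun_prop)
      fun x hx => smul_ne_zero h0.ne' hx
  have hcgv : ContinuousOn (fun x => gradient v (ε • x)) {x : Euc N | x ≠ 0} :=
    h.contDiffOn_snd.continuousOn_gradient_punctured.comp (by fun_prop)
      fun x hx => smul_ne_zero h0.ne' hx
  have key : ε ^ 2 * ∫ x in K, pohozaevDensity p q a b u v (ε • x) * ζ x ^ (2 * (m + 1)) ≤
      D * (∫ x in K, (1 : ℝ)) + (1 * Bu + 1 * Bv) := by
    rw [← integral_const_mul]
    refine (setIntegral_le_add_add hK hK0 (G₁ := fun _ => 1)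
      (G₂ := fun x => ‖gradient U x‖ ^ 2 * ζ x ^ (2 * (m + 1)))
      (G₃ := fun x => ‖gradient V x‖ ^ 2 * ζ x ^ (2 * (m + 1)))
      (c₁ := D) (c₂ := 1) (c₃ := 1) ?_ (by fun_prop) (by fun_prop) (by fun_prop)
      fun x hx => ?_).trans (by linarith)
    · unfold pohozaevDensity
      fun_prop (disch := assumption)
    · have hz0 := pow_nonneg (hζ0 x) (2 * (m + 1))
      have hz1 : ζ x ^ (2 * (m + 1)) ≤ 1 := pow_le_one₀ (hζ0 x) (hζ1 x)
      have hu0 := h.fst_pos (ε • x)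
      have hv0 := h.snd_pos (ε • x)
      obtain ⟨huM, hvM⟩ := hM ε h0 h1 x hx
      have e1 : ε ^ 2 * ‖ε • x‖ ^ a * v (ε • x) ^ (p + 1) ≤ Ma * M ^ (p + 1) :=
        mul_le_mul (hw a ha x hx Ma (hMa x hx)) (Real.rpow_le_rpow hv0.le hvM (by linarith))
          (by positivity) hMa0.le
      have e2 : ε ^ 2 * ‖ε • x‖ ^ b * u (ε • x) ^ (q + 1) ≤ Mb * M ^ (q + 1) :=
        mul_le_mul (hw b hb x hx Mb (hMb x hx)) (Real.rpow_le_rpow hu0.le huM (by linarith))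
          (by positivity) hMb0.le
      have e3 : ‖gradient U x‖ = ε * ‖gradient u (ε • x)‖ := by
        rw [hUg, norm_smul, Real.norm_of_nonneg h0.le]
      have e4 : ‖gradient V x‖ = ε * ‖gradient v (ε • x)‖ := by
        rw [hVg, norm_smul, Real.norm_of_nonneg h0.le]
      have hMi' := hMi x hx
      rw [Real.rpow_neg_one] at hMi'
      have hi0 : 0 ≤ ‖x‖⁻¹ := by positivity
      have e5 : ε ^ 2 * (‖ε • x‖⁻¹ * (u (ε • x) * ‖gradient v (ε • x)‖ +
          v (ε • x) * ‖gradient u (ε • x)‖)) ≤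
          Mi * M * ‖gradient V x‖ + Mi * M * ‖gradient U x‖ := by
        have h2 : ε ^ 2 * (‖ε • x‖⁻¹ * (u (ε • x) * ‖gradient v (ε • x)‖ +
          v (ε • x) * ‖gradient u (ε • x)‖)) = ‖x‖⁻¹ * u (ε • x) * ‖gradient V x‖ +
            ‖x‖⁻¹ * v (ε • x) * ‖gradient U x‖ := by
          rw [e3, e4, norm_smul, Real.norm_of_nonneg h0.le, mul_inv]
          field_simp
        rw [h2]
        gcongr
      have e6 : ε ^ 2 * pohozaevDensity p q a b u v (ε • x) ≤
          D + ‖gradient U x‖ ^ 2 + ‖gradient V x‖ ^ 2 := by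
        have e7 : ε ^ 2 * (‖gradient u (ε • x)‖ * ‖gradient v (ε • x)‖) =
          ‖gradient U x‖ * ‖gradient V x‖ := by rw [e3, e4]; ring
        unfold pohozaevDensity
        nlinarith [sq_nonneg (‖gradient U x‖ - Mi * M), sq_nonneg (‖gradient V x‖ - Mi * M),
          sq_nonneg (‖gradient U x‖ - ‖gradient V x‖)]
      have e8 := mul_le_mul_of_nonneg_right e6 hz0
      have e9 := mul_le_of_le_one_right hD0 hz1
      linarith
  rw [integral_mul_comp_inv_smul h0 hs (by omega)]
  have hB0 : 0 ≤ D * (∫ x in K, (1 : ℝ)) + (1 * Bu + 1 * Bv) := by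
    refine le_trans (mul_nonneg (by positivity) (integral_nonneg fun x => ?_)) key
    have := h.fst_pos (ε • x)
    have := h.snd_pos (ε • x)
    have := hζ0 x
    unfold pohozaevDensity
    positivity
  obtain ⟨n, rfl⟩ : ∃ n, N = n + 3 := ⟨N - 3, by omega⟩
  calc ε ^ (n + 3) * ∫ x in K, pohozaevDensity p q a b u v (ε • x) * ζ x ^ (2 * (m + 1))
      = ε ^ n * ε * (ε ^ 2 *
          ∫ x in K, pohozaevDensity p q a b u v (ε • x) * ζ x ^ (2 * (m + 1))) := by ring
    _ ≤ ε ^ n * ε * (D * (∫ x in K, (1 : ℝ)) + (1 * Bu + 1 * Bv)) := by gcongr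
    _ ≤ 1 * ε * (D * (∫ x in K, (1 : ℝ)) + (1 * Bu + 1 * Bv)) := by
        gcongr
        exact pow_le_one₀ h0.le h1
    _ = _ := by ring

end BlowUp

section Pohozaev

variable {N : ℕ} {p q a b C : ℝ} {K : Set (Euc N)} {χ u v : Euc N → ℝ}

lemma inner_gradient_left_eq (f : Euc N → ℝ) (x z : Euc N) :
    inner ℝ (gradient f x) z = fderiv ℝ f x z := by
  simp [gradient]

lemma inner_gradient_right_eq (f : Euc N → ℝ) (x z : Euc N) :
    inner ℝ z (gradient f x) = fderiv ℝ f x z := by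
  rw [real_inner_comm, inner_gradient_left_eq]

lemma ContDiffOn.continuousOn_gradient_of_one {f : Euc N → ℝ}
    (hf : ContDiffOn ℝ 1 f {x : Euc N | x ≠ 0}) :
    ContinuousOn (gradient f) {x : Euc N | x ≠ 0} :=
  (InnerProductSpace.toDual ℝ (Euc N)).symm.continuous.comp_continuousOn
    (hf.continuousOn_fderiv_of_isOpen isOpen_ne_zero (by norm_num))

lemma hasFDerivAt_gradient {f : Euc N → ℝ} {x : Euc N}
    (hf : DifferentiableAt ℝ (fderiv ℝ f) x) :
    ∃ L : Euc N →L[ℝ] Euc N, HasFDerivAt (gradient f) L x ∧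
      ∀ y z, inner ℝ (L y) z = fderiv ℝ (fderiv ℝ f) x y z := by
  let T : (Euc N →L[ℝ] ℝ) →L[ℝ] Euc N :=
    (InnerProductSpace.toDual ℝ (Euc N)).symm.toContinuousLinearEquiv.toContinuousLinearMap
  refine ⟨T.comp (fderiv ℝ (fderiv ℝ f) x), T.hasFDerivAt.comp x hf.hasFDerivAt, fun y z => ?_⟩
  exact InnerProductSpace.toDual_symm_apply

lemma setIntegral_test_mul (hK : IsCompact K) (hK0 : K ⊆ {x : Euc N | x ≠ 0})
    (hu : ContDiffOn ℝ 2 u {x : Euc N | x ≠ 0}) {w : Euc N → ℝ}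
    (hw : ContDiffOn ℝ 1 w {x : Euc N | x ≠ 0}) (hχ : ContDiff ℝ 1 χ) (hs : tsupport χ ⊆ K) :
    ∫ x in K, (χ x * inner ℝ (gradient u x) (gradient w x) +
      w x * inner ℝ (gradient u x) (gradient χ x) + lap u x * (χ x * w x)) = 0 := by
  have hs0 := hs.trans hK0
  have hφ : ContDiff ℝ 1 (fun x => χ x * w x) := contDiff_mul_of_tsupport_subset hχ hs0 hw
  have hφs : tsupport (fun x => χ x * w x) ⊆ K := (tsupport_mul_subset_left).trans hs
  have hφc : HasCompactSupport (fun x => χ x * w x) :=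
    hK.of_isClosed_subset (isClosed_tsupport _) hφs
  have h := integral_inner_gradient_eq hu hφ hφc (hφs.trans hK0)
  rw [← setIntegral_eq_integral_of_forall_compl_eq_zero (s := K),
    ← setIntegral_eq_integral_of_forall_compl_eq_zero (s := K) (f := fun x => -lap u x * _)] at h
  · have hcw := hw.continuousOn
    have hcgw := hw.continuousOn_gradient_of_one
    have hcgu := hu.continuousOn_gradient_punctured
    have hcl := continuousOn_lap hu
    have hcχ := hχ.continuous
    have hcgχ := hχ.continuous_gradient
    have hcφ := hφ.continuous_gradient
    have hsub := sub_eq_zero.2 h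
    rw [← integral_sub (ContinuousOn.integrableOn_punctured (by fun_prop) hK hK0)
      (ContinuousOn.integrableOn_punctured (by fun_prop) hK hK0)] at hsub
    rw [← hsub]
    refine setIntegral_congr_fun hK.measurableSet fun x hx => ?_
    simp only [gradient_mul (hχ.differentiable (by norm_num) x)
      ((hw.contDiffAt_punctured (hK0 hx)).differentiableAt (by norm_num)), inner_add_right,
      inner_smul_right]
    ring
  · intro x hx
    rw [image_eq_zero_of_notMem_tsupport fun h' => hx (hφs h'), mul_zero]
  · intro x hx
    rw [gradient_eq_zero_of_notMem_tsupport fun h' => hx (hφs h'), inner_zero_right]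

lemma setIntegral_radial (hK : IsCompact K) (hK0 : K ⊆ {x : Euc N | x ≠ 0})
    {ψ : Euc N → ℝ} (hψ : ContDiffOn ℝ 1 ψ {x : Euc N | x ≠ 0})
    (hχ : ContDiff ℝ 1 χ) (hs : tsupport χ ⊆ K) :
    ∫ x in K, (χ x * fderiv ℝ ψ x x + ψ x * fderiv ℝ χ x x + N * (χ x * ψ x)) = 0 := by
  have hs0 := hs.trans hK0
  have hφ : ContDiff ℝ 1 (fun x => χ x * ψ x) := contDiff_mul_of_tsupport_subset hχ hs0 hψ
  have hφs : tsupport (fun x => χ x * ψ x) ⊆ K := (tsupport_mul_subset_left).trans hs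
  have hφc : HasCompactSupport (fun x => χ x * ψ x) :=
    hK.of_isClosed_subset (isClosed_tsupport _) hφs
  have h := integral_fderiv_self_eq hφ hφc
  rw [← setIntegral_eq_integral_of_forall_compl_eq_zero (s := K),
    ← setIntegral_eq_integral_of_forall_compl_eq_zero (s := K) (f := fun x => χ x * ψ x)] at h
  · have hcχ := hχ.continuous
    have hcψ := hψ.continuousOn
    have hcφ := hφ.continuous_fderiv (by norm_num)
    have hsub : _ + (N : ℝ) * _ = 0 := (eq_neg_iff_add_eq_zero.1 (h.trans (neg_mul _ _)))
    rw [← integral_const_mul, ← integral_add (ContinuousOn.integrableOn_punctured (by fun_prop) hK hK0)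
      (ContinuousOn.integrableOn_punctured (by fun_prop) hK hK0)] at hsub
    rw [← hsub]
    refine setIntegral_congr_fun hK.measurableSet fun x hx => ?_
    simp only [fderiv_fun_mul (hχ.differentiable (by norm_num) x)
      ((hψ.contDiffAt_punctured (hK0 hx)).differentiableAt (by norm_num))]
    simp
  · intro x hx
    rw [image_eq_zero_of_notMem_tsupport fun h' => hx (hφs h')]
  · intro x hx
    have : fderiv ℝ (fun x => χ x * ψ x) x = 0 := by
      by_contra h'
      exact hx (hφs (support_fderiv_subset ℝ h'))
    simp [this]

lemma inner_gradient_fderiv_self_add {x : Euc N} (hx : x ≠ 0)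
    (hu : ContDiffOn ℝ 2 u {x : Euc N | x ≠ 0}) (hv : ContDiffOn ℝ 2 v {x : Euc N | x ≠ 0}) :
    inner ℝ (gradient u x) (gradient (fun y => fderiv ℝ v y y) x) +
        inner ℝ (gradient v x) (gradient (fun y => fderiv ℝ u y y) x) =
      2 * inner ℝ (gradient u x) (gradient v x) +
        fderiv ℝ (fun y => inner ℝ (gradient u y) (gradient v y)) x x := by
  have hdu : DifferentiableAt ℝ (fderiv ℝ u) x :=
    (hu.contDiffOn_fderiv_punctured.contDiffAt_punctured hx).differentiableAt (by norm_num)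
  have hdv : DifferentiableAt ℝ (fderiv ℝ v) x :=
    (hv.contDiffOn_fderiv_punctured.contDiffAt_punctured hx).differentiableAt (by norm_num)
  have hsu : IsSymmSndFDerivAt ℝ u x := (hu.contDiffAt_punctured hx).isSymmSndFDerivAt (by simp)
  have hsv : IsSymmSndFDerivAt ℝ v x := (hv.contDiffAt_punctured hx).isSymmSndFDerivAt (by simp)
  obtain ⟨Lu, hLu, hLu'⟩ := hasFDerivAt_gradient hdu
  obtain ⟨Lv, hLv, hLv'⟩ := hasFDerivAt_gradient hdv
  have hw : ∀ f : Euc N → ℝ, DifferentiableAt ℝ (fderiv ℝ f) x → ∀ z,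
      fderiv ℝ (fun y => fderiv ℝ f y y) x z = fderiv ℝ f x z + fderiv ℝ (fderiv ℝ f) x z x := by
    intro f hf z
    have h : HasFDerivAt (fun y => fderiv ℝ f y y) _ x :=
      hf.hasFDerivAt.clm_apply (hasFDerivAt_id x)
    rw [h.fderiv]
    simp
  rw [inner_gradient_right_eq, inner_gradient_right_eq, (hLu.inner ℝ hLv).fderiv, hw v hdv,
    hw u hdu]
  have e1 : inner ℝ (gradient u x) (Lv x) = fderiv ℝ (fderiv ℝ v) x (gradient u x) x := by
    rw [real_inner_comm, hLv', hsv.eq]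
  have e2 : inner ℝ (Lu x) (gradient v x) = fderiv ℝ (fderiv ℝ u) x (gradient v x) x := by
    rw [hLu', hsu.eq]
  simp only [ContinuousLinearMap.comp_apply, ContinuousLinearMap.prod_apply, fderivInnerCLM_apply,
    e1, e2, ← inner_gradient_left_eq v, ← inner_gradient_left_eq u,
    real_inner_comm (gradient u x) (gradient v x)]
  ring

end Pohozaev

section PohozaevInequality

variable {N : ℕ} {p q a b C : ℝ} {K : Set (Euc N)} {χ u v : Euc N → ℝ}

lemma fderiv_norm_apply_self {x : Euc N} (hx : x ≠ 0) :
    fderiv ℝ (fun y : Euc N => ‖y‖) x x = ‖x‖ := by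
  have hn : DifferentiableAt ℝ (fun y : Euc N => ‖y‖) x := differentiableAt_id.norm ℝ hx
  have h : HasFDerivAt (fun y : Euc N => ‖y‖ ^ 2) _ x := hn.hasFDerivAt.pow 2
  have h' := congrArg (fun L : Euc N →L[ℝ] ℝ => L x)
    (h.unique (hasStrictFDerivAt_norm_sq x).hasFDerivAt)
  simp at h'
  have : 0 < ‖x‖ := norm_pos_iff.2 hx
  nlinarith

lemma fderiv_norm_rpow_mul_rpow {x : Euc N} (hx : x ≠ 0) (hv : DifferentiableAt ℝ v x)
    (hv0 : 0 < v x) (hp : 0 < p) :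
    fderiv ℝ (fun y => ‖y‖ ^ a * v y ^ (p + 1) / (p + 1)) x x =
      a * (‖x‖ ^ a * v x ^ (p + 1) / (p + 1)) + ‖x‖ ^ a * v x ^ p * fderiv ℝ v x x := by
  have hn : DifferentiableAt ℝ (fun y : Euc N => ‖y‖) x := differentiableAt_id.norm ℝ hx
  have hn0 : 0 < ‖x‖ := norm_pos_iff.2 hx
  have h1 := hn.hasFDerivAt.rpow_const (p := a) (Or.inl hn0.ne')
  have h2 := hv.hasFDerivAt.rpow_const (p := p + 1) (Or.inl hv0.ne')
  have h3 : HasFDerivAt (fun y => ‖y‖ ^ a * v y ^ (p + 1) * (p + 1)⁻¹) _ x :=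
    (h1.mul h2).mul_const (p + 1)⁻¹
  have h4 : ‖x‖ ^ (a - 1) * ‖x‖ = ‖x‖ ^ a := by
    rw [Real.rpow_sub_one hn0.ne', div_mul_cancel₀ _ hn0.ne']
  simp only [div_eq_mul_inv, h3.fderiv, smul_apply, add_apply, smul_eq_mul, fderiv_norm_apply_self hx, add_sub_cancel_right, ← h4]
  have : p + 1 ≠ 0 := by positivity
  field_simp
  ring

lemma setIntegral_combination_eq_zero {G₁ G₂ G₃ G₄ G₅ : Euc N → ℝ} (c d : ℝ)
    (h₁ : ∫ x in K, G₁ x = 0) (h₂ : ∫ x in K, G₂ x = 0) (h₃ : ∫ x in K, G₃ x = 0)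
    (h₄ : ∫ x in K, G₄ x = 0) (h₅ : ∫ x in K, G₅ x = 0) (i₁ : IntegrableOn G₁ K)
    (i₂ : IntegrableOn G₂ K) (i₃ : IntegrableOn G₃ K) (i₄ : IntegrableOn G₄ K)
    (i₅ : IntegrableOn G₅ K) :
    IntegrableOn (fun x => G₁ x + G₂ x - G₃ x + c * G₄ x - d * G₅ x) K ∧
      ∫ x in K, (G₁ x + G₂ x - G₃ x + c * G₄ x - d * G₅ x) = 0 := by
  have j₁ : IntegrableOn (fun x => G₁ x + G₂ x) K := i₁.add i₂
  have j₂ : IntegrableOn (fun x => G₁ x + G₂ x - G₃ x) K := j₁.sub i₃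
  have j₃ : IntegrableOn (fun x => G₁ x + G₂ x - G₃ x + c * G₄ x) K := j₂.add (i₄.const_mul c)
  refine ⟨j₃.sub (i₅.const_mul d), ?_⟩
  rw [integral_sub j₃ (i₅.const_mul d), integral_add j₂ (i₄.const_mul c), integral_sub j₁ i₃,
    integral_add i₁ i₂, integral_const_mul, integral_const_mul, h₁, h₂, h₃, h₄, h₅]
  simp

lemma boundary_terms_le {X G s t wu wv a₁ a₂ d ψ U V u v A B : ℝ} (hX : 0 < X) (hG : 0 ≤ G)
    (hs : 0 ≤ s) (ht : 0 ≤ t) (hU : 0 ≤ U) (hV : 0 ≤ V) (hu : 0 ≤ u) (hv : 0 ≤ v)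
    (hwu : |wu| ≤ s * X) (hwv : |wv| ≤ t * X) (ha₁ : |a₁| ≤ s * G) (ha₂ : |a₂| ≤ t * G)
    (hd : |d| ≤ G * X) (hψ : |ψ| ≤ s * t + V + U) :
    -(wv * a₁) - wu * a₂ + ψ * d - A * (v * a₁) + B * (u * a₂) ≤
      (3 + |A| + |B|) * (X * G * (V + U + s * t + X⁻¹ * (u * t + v * s))) := by
  have e₁ : |wv * a₁| ≤ t * X * (s * G) := by
    rw [abs_mul]; exact mul_le_mul hwv ha₁ (abs_nonneg _) (by positivity)
  have e₂ : |wu * a₂| ≤ s * X * (t * G) := by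
    rw [abs_mul]; exact mul_le_mul hwu ha₂ (abs_nonneg _) (by positivity)
  have e₃ : |ψ * d| ≤ (s * t + V + U) * (G * X) := by
    rw [abs_mul]; exact mul_le_mul hψ hd (abs_nonneg _) (by positivity)
  have e₄ : |A * (v * a₁)| ≤ |A| * (v * (s * G)) := by
    rw [abs_mul, abs_mul, abs_of_nonneg hv]; gcongr
  have e₅ : |B * (u * a₂)| ≤ |B| * (u * (t * G)) := by
    rw [abs_mul, abs_mul, abs_of_nonneg hu]; gcongr
  have e₆ : X * G * (V + U + s * t + X⁻¹ * (u * t + v * s)) =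
      X * G * (V + U + s * t) + G * (u * t) + G * (v * s) := by
    field_simp
    ring
  have n₁ : 0 ≤ X * G * (V + U + s * t) := by positivity
  have n₂ : 0 ≤ X * G * (V + U) := by positivity
  have n₃ : 0 ≤ G * (u * t) := by positivity
  have n₄ : 0 ≤ G * (v * s) := by positivity
  have nA := abs_nonneg A
  have nB := abs_nonneg B
  rw [e₆]
  have := mul_nonneg nA n₁
  have := mul_nonneg nA n₃
  have := mul_nonneg nB n₁
  have := mul_nonneg nB n₄
  have := (abs_le.1 e₁).1
  have := (abs_le.1 e₂).1
  have := (abs_le.1 e₃).2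
  have := (abs_le.1 e₄).1
  have := (abs_le.1 e₅).2
  linarith

/-- The Pohozaev inequality, localized by a cutoff function supported away from the origin. -/
lemma IsPosSol.pohozaev_le (h : IsPosSol p q a b C u v) (hp : 0 < p) (hq : 0 < q)
    (hK : IsCompact K) (hK0 : K ⊆ {x : Euc N | x ≠ 0}) (hχ : ContDiff ℝ 1 χ)
    (hs : tsupport χ ⊆ K) {A : ℝ} (hA : A = (N + a) / (p + 1)) :
    (A + (N + b) / (q + 1) - (N - 2)) * ∫ x in K, χ x * (‖x‖ ^ b * u x ^ (q + 1)) ≤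
      (3 + |A| + |2 - N + A|) *
        ∫ x in K, ‖x‖ * ‖gradient χ x‖ * pohozaevDensity p q a b u v x := by
  have hu2 := h.contDiffOn_fst
  have hv2 := h.contDiffOn_snd
  have hu1 : ContDiffOn ℝ 1 u {x : Euc N | x ≠ 0} := hu2.of_le (by norm_num)
  have hv1 : ContDiffOn ℝ 1 v {x : Euc N | x ≠ 0} := hv2.of_le (by norm_num)
  have hgu := hu2.contDiffOn_gradient_punctured
  have hgv := hv2.contDiffOn_gradient_punctured
  have hwu : ContDiffOn ℝ 1 (fun y => fderiv ℝ u y y) {x : Euc N | x ≠ 0} :=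
    hu2.contDiffOn_fderiv_punctured.clm_apply contDiffOn_id
  have hwv : ContDiffOn ℝ 1 (fun y => fderiv ℝ v y y) {x : Euc N | x ≠ 0} :=
    hv2.contDiffOn_fderiv_punctured.clm_apply contDiffOn_id
  have hP₁ : ContDiffOn ℝ 1 (fun y => ‖y‖ ^ a * v y ^ (p + 1) / (p + 1)) {x : Euc N | x ≠ 0} :=
    ((contDiffOn_norm_rpow a).mul (hv1.rpow_of_pos h.snd_pos _)).div_const _
  have hP₂ : ContDiffOn ℝ 1 (fun y => ‖y‖ ^ b * u y ^ (q + 1) / (q + 1)) {x : Euc N | x ≠ 0} :=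
    ((contDiffOn_norm_rpow b).mul (hu1.rpow_of_pos h.fst_pos _)).div_const _
  have hh : ContDiffOn ℝ 1 (fun y => inner ℝ (gradient u y) (gradient v y)) {x : Euc N | x ≠ 0} :=
    hgu.inner ℝ hgv
  obtain ⟨ψ, hψ⟩ : ∃ ψ : Euc N → ℝ, ψ = fun y => inner ℝ (gradient u y) (gradient v y) -
    ‖y‖ ^ a * v y ^ (p + 1) / (p + 1) - ‖y‖ ^ b * u y ^ (q + 1) / (q + 1) := ⟨_, rfl⟩
  have hψ1 : ContDiffOn ℝ 1 ψ {x : Euc N | x ≠ 0} := hψ ▸ (hh.sub hP₁).sub hP₂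
  have hcgu := hgu.continuousOn
  have hcgv := hgv.continuousOn
  have hcu := hu1.continuousOn
  have hcv := hv1.continuousOn
  have hcwu := hwu.continuousOn
  have hcwv := hwv.continuousOn
  have hcgwu := hwu.continuousOn_gradient_of_one
  have hcgwv := hwv.continuousOn_gradient_of_one
  have hcψ := hψ1.continuousOn
  have hcdψ : ContinuousOn (fun x => fderiv ℝ ψ x x) {x : Euc N | x ≠ 0} :=
    (hψ1.continuousOn_fderiv_of_isOpen isOpen_ne_zero (by norm_num)).clm_apply continuousOn_id
  have hclu := continuousOn_lap hu2
  have hclv := continuousOn_lap hv2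
  have hcχ := hχ.continuous
  have hcgχ := hχ.continuous_gradient
  have hcdχ : Continuous (fun x => fderiv ℝ χ x x) :=
    (hχ.continuous_fderiv (by norm_num)).clm_apply continuous_id
  have hu' : ∀ x ∈ {x : Euc N | x ≠ 0}, u x ≠ 0 := fun x _ => (h.fst_pos x).ne'
  have hv' : ∀ x ∈ {x : Euc N | x ≠ 0}, v x ≠ 0 := fun x _ => (h.snd_pos x).ne'
  have hn' : ∀ x ∈ {x : Euc N | x ≠ 0}, ‖x‖ ≠ 0 := fun x hx => norm_ne_zero_iff.2 hx
  have i₁ := setIntegral_test_mul hK hK0 hu2 hwv hχ hs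
  have i₂ := setIntegral_test_mul hK hK0 hv2 hwu hχ hs
  have i₃ := setIntegral_radial hK hK0 hψ1 hχ hs
  have i₄ := setIntegral_test_mul hK hK0 hu2 hv1 hχ hs
  have i₅ := setIntegral_test_mul hK hK0 hv2 hu1 hχ hs
  obtain ⟨j, hj⟩ := setIntegral_combination_eq_zero A (2 - N + A) i₁ i₂ i₃ i₄ i₅
    (ContinuousOn.integrableOn_punctured (by fun_prop) hK hK0)
    (ContinuousOn.integrableOn_punctured (by fun_prop) hK hK0)
    (ContinuousOn.integrableOn_punctured (by fun_prop) hK hK0)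
    (ContinuousOn.integrableOn_punctured (by fun_prop) hK hK0)
    (ContinuousOn.integrableOn_punctured (by fun_prop) hK hK0)
  have hcE : ContinuousOn (fun x => (A + (N + b) / (q + 1) - (N - 2)) *
      (χ x * (‖x‖ ^ b * u x ^ (q + 1)))) {x : Euc N | x ≠ 0} := by
    fun_prop (disch := assumption)
  rw [← integral_const_mul, ← integral_const_mul, ← sub_zero (∫ x in K, _ * (χ x * _)), ← hj,
    ← integral_sub (hcE.integrableOn_punctured hK hK0) j]
  refine setIntegral_mono_punctured hK hK0 (by fun_prop (disch := assumption)) ?_ fun x hx => ?_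
  · unfold pohozaevDensity
    fun_prop (disch := assumption)
  have hx0 : x ≠ 0 := hK0 hx
  have hX : 0 < ‖x‖ := norm_pos_iff.2 hx0
  have hu0 := h.fst_pos x
  have hv0 := h.snd_pos x
  have hdψ : fderiv ℝ ψ x x = fderiv ℝ (fun y => inner ℝ (gradient u y) (gradient v y)) x x -
      (a * (‖x‖ ^ a * v x ^ (p + 1) / (p + 1)) + ‖x‖ ^ a * v x ^ p * fderiv ℝ v x x) -
      (b * (‖x‖ ^ b * u x ^ (q + 1) / (q + 1)) + ‖x‖ ^ b * u x ^ q * fderiv ℝ u x x) := by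
    have d₁ := (hh.contDiffAt_punctured hx0).differentiableAt one_ne_zero
    have d₂ := (hP₁.contDiffAt_punctured hx0).differentiableAt one_ne_zero
    have d₃ := (hP₂.contDiffAt_punctured hx0).differentiableAt one_ne_zero
    rw [← fderiv_norm_rpow_mul_rpow hx0 (hv2.differentiableAt_punctured hx0) hv0 hp,
      ← fderiv_norm_rpow_mul_rpow hx0 (hu2.differentiableAt_punctured hx0) hu0 hq, hψ,
      fderiv_fun_sub (d₁.fun_sub d₂) d₃, fderiv_fun_sub d₁ d₂]
    rfl
  have hm := inner_gradient_fderiv_self_add hx0 hu2 hv2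
  have hV : ‖x‖ ^ a * v x ^ (p + 1) = ‖x‖ ^ a * v x ^ p * v x := by
    rw [Real.rpow_add_one hv0.ne', mul_assoc]
  have hU : ‖x‖ ^ b * u x ^ (q + 1) = ‖x‖ ^ b * u x ^ q * u x := by
    rw [Real.rpow_add_one hu0.ne', mul_assoc]
  have hψx : ψ x = inner ℝ (gradient u x) (gradient v x) -
    ‖x‖ ^ a * v x ^ (p + 1) / (p + 1) - ‖x‖ ^ b * u x ^ (q + 1) / (q + 1) := by rw [hψ]
  have hP : 0 ≤ ‖x‖ ^ a * v x ^ (p + 1) := by positivity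
  have hQ : 0 ≤ ‖x‖ ^ b * u x ^ (q + 1) := by positivity
  have hbd := boundary_terms_le (A := A) (B := 2 - N + A) hX (norm_nonneg (gradient χ x))
    (norm_nonneg (gradient u x)) (norm_nonneg (gradient v x)) hQ hP hu0.le hv0.le
    (wu := fderiv ℝ u x x) (wv := fderiv ℝ v x x)
    (a₁ := inner ℝ (gradient u x) (gradient χ x)) (a₂ := inner ℝ (gradient v x) (gradient χ x))
    (d := fderiv ℝ χ x x) (ψ := ψ x)
    (by rw [← inner_gradient_left_eq]; exact abs_real_inner_le_norm _ _)
    (by rw [← inner_gradient_left_eq]; exact abs_real_inner_le_norm _ _)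
    (abs_real_inner_le_norm _ _) (abs_real_inner_le_norm _ _)
    (by rw [← inner_gradient_left_eq]; exact abs_real_inner_le_norm _ _)
    (by
      have e₁ := abs_le.1 (abs_real_inner_le_norm (gradient u x) (gradient v x))
      have e₂ := div_le_self hP (by linarith : 1 ≤ p + 1)
      have e₃ := div_le_self hQ (by linarith : 1 ≤ q + 1)
      have e₄ : 0 ≤ ‖x‖ ^ a * v x ^ (p + 1) / (p + 1) := by positivity
      have e₅ : 0 ≤ ‖x‖ ^ b * u x ^ (q + 1) / (q + 1) := by positivity
      rw [hψx, abs_le]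
      exact ⟨by linarith [e₁.1], by linarith [e₁.2]⟩)
  rw [mul_assoc] at hbd
  unfold pohozaevDensity
  refine le_of_eq_of_le ?_ (hbd.trans_eq (by ring))
  have hlu : lap u x = -(‖x‖ ^ a * v x ^ p) := by rw [← h.lap_fst x hx0, neg_neg]
  have hlv : lap v x = -(‖x‖ ^ b * u x ^ q) := by rw [← h.lap_snd x hx0, neg_neg]
  rw [hdψ, hlu, hlv, real_inner_comm (gradient u x) (gradient v x), hψx, hV, hU, hA]
  have hp1 : p + 1 ≠ 0 := by positivity
  have hq1 : q + 1 ≠ 0 := by positivity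
  generalize inner ℝ (gradient u x) (gradient (fun y => fderiv ℝ v y y) x) = m₁ at *
  generalize inner ℝ (gradient v x) (gradient (fun y => fderiv ℝ u y y) x) = m₂ at *
  generalize fderiv ℝ (fun y => inner ℝ (gradient u y) (gradient v y)) x x = dh at *
  generalize inner ℝ (gradient u x) (gradient v x) = h₀ at *
  have hm' : m₁ = 2 * h₀ + dh - m₂ := by linarith
  rw [hm']
  field_simp
  ring

end PohozaevInequality

section Conclusion

variable {N : ℕ} {p q a b C : ℝ} {u v : Euc N → ℝ}

/-- A radial cutoff `τ`, together with a bump function `ζ` supported in an annulus and equal to one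
where the gradient of `τ` does not vanish. -/
lemma exists_cutoffs (N : ℕ) {R₀ R₅ : ℝ} (hR₀ : 0 < R₀) (hR : R₀ < R₅) :
    ∃ (K : Set (Euc N)) (τ ζ : Euc N → ℝ) (r s c : ℝ), IsCompact K ∧
      K ⊆ ball (0 : Euc N) R₅ \ closure (ball (0 : Euc N) R₀) ∧ ContDiff ℝ 2 ζ ∧
      (∀ x, 0 ≤ ζ x) ∧ (∀ x, ζ x ≤ 1) ∧ tsupport ζ ⊆ K ∧ ContDiff ℝ 2 τ ∧
      (∀ x, 0 ≤ τ x) ∧ (∀ x, τ x ≤ 1) ∧ (∀ x, ‖x‖ ≤ r → τ x = 1) ∧ (∀ x, s ≤ ‖x‖ → τ x = 0) ∧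
      0 < r ∧ r < s ∧ 0 ≤ c ∧ ∀ x (k : ℕ), ‖x‖ * ‖gradient τ x‖ ≤ c * ζ x ^ k := by
  obtain ⟨t₀, h0, h0'⟩ := exists_between hR
  obtain ⟨r, hr, hr'⟩ := exists_between h0'
  obtain ⟨s, hs, hs'⟩ := exists_between hr'
  obtain ⟨t, ht, ht'⟩ := exists_between hs'
  have ht0 : 0 < t₀ := hR₀.trans h0
  have hr0 : 0 < r := ht0.trans hr
  have hs0 : 0 < s := hr0.trans hs
  let f₀ : ContDiffBump (0 : Euc N) := ⟨t₀, r, ht0, hr⟩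
  let τ : ContDiffBump (0 : Euc N) := ⟨r, s, hr0, hs⟩
  let f₁ : ContDiffBump (0 : Euc N) := ⟨s, t, hs0, ht⟩
  have hτ : ContDiff ℝ 2 τ := τ.contDiff
  have hone : ∀ (f : ContDiffBump (0 : Euc N)) x, ‖x‖ ≤ f.rIn → f x = 1 := fun f x hx =>
    f.one_of_mem_closedBall (mem_closedBall_zero_iff.2 hx)
  have hzero : ∀ (f : ContDiffBump (0 : Euc N)) x, f.rOut ≤ ‖x‖ → f x = 0 := fun f x hx =>
    f.zero_of_le_dist (by rwa [dist_zero_right])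
  obtain ⟨M, hM⟩ := τ.hasCompactSupport.exists_bound_of_continuous τ.continuous
  obtain ⟨c, hc⟩ := (isCompact_closedBall (0 : Euc N) s).exists_bound_of_continuousOn
    (hτ.of_le (by norm_num) : ContDiff ℝ 1 τ).continuous_gradient.continuousOn
  refine ⟨closedBall 0 t \ ball 0 t₀, τ, fun x => f₁ x * (1 - f₀ x), r, s, s * |c|,
    (isCompact_closedBall _ _).diff isOpen_ball, ?_, ?_, ?_, ?_, ?_, hτ, fun x => τ.nonneg,
    fun x => τ.le_one, hone τ, hzero τ, hr0, hs, by positivity, ?_⟩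
  · rw [closure_ball _ hR₀.ne']
    intro x hx
    rw [mem_sdiff, mem_closedBall_zero_iff, mem_ball_zero_iff, not_lt] at hx
    rw [mem_sdiff, mem_closedBall_zero_iff, mem_ball_zero_iff, not_le]
    exact ⟨hx.1.trans_lt ht', h0.trans_le hx.2⟩
  · exact f₁.contDiff.mul (contDiff_const.sub f₀.contDiff)
  · exact fun x => mul_nonneg f₁.nonneg (sub_nonneg.2 f₀.le_one)
  · exact fun x => mul_le_one₀ f₁.le_one (sub_nonneg.2 f₀.le_one) (sub_le_self _ f₀.nonneg)
  · refine closure_minimal (fun x hx => ?_) (isClosed_closedBall.sdiff isOpen_ball)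
    rw [mem_sdiff, mem_closedBall_zero_iff, mem_ball_zero_iff, not_lt]
    refine ⟨?_, ?_⟩
    · by_contra! h
      exact hx (by simp [hzero f₁ x h.le])
    · by_contra! h
      exact hx (by simp [hone f₀ x h.le])
  · intro x k
    have hζ0 : 0 ≤ f₁ x * (1 - f₀ x) := mul_nonneg f₁.nonneg (sub_nonneg.2 f₀.le_one)
    have h0 : gradient τ x = 0 → ‖x‖ * ‖gradient τ x‖ ≤ s * |c| * (f₁ x * (1 - f₀ x)) ^ k := by
      intro h
      rw [h, norm_zero, mul_zero]
      positivity
    rcases lt_or_ge ‖x‖ r with h | h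
    · refine h0 ?_
      have : (τ : Euc N → ℝ) =ᶠ[nhds x] fun _ => 1 :=
        τ.eventuallyEq_one_of_mem_ball (mem_ball_zero_iff.2 h)
      simp [gradient, this.fderiv_eq]
    rcases lt_or_ge s ‖x‖ with h' | h'
    · refine h0 (gradient_eq_zero_of_notMem_tsupport ?_)
      rw [τ.tsupport_eq, mem_closedBall_zero_iff, not_le]
      exact h'
    · simp only [hzero f₀ x h, hone f₁ x h', sub_zero, mul_one, one_pow]
      exact mul_le_mul h' ((hc x (mem_closedBall_zero_iff.2 h')).trans (le_abs_self c))
        (norm_nonneg _) hs0.le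

lemma pohozaevDensity_nonneg (hu : ∀ x, 0 < u x) (hv : ∀ x, 0 < v x) (x : Euc N) :
    0 ≤ pohozaevDensity p q a b u v x := by
  have := hu x
  have := hv x
  unfold pohozaevDensity
  positivity

lemma IsPosSol.continuousOn_pohozaevDensity (h : IsPosSol p q a b C u v) :
    ContinuousOn (pohozaevDensity p q a b u v) {x : Euc N | x ≠ 0} := by
  have hu' : ∀ x ∈ {x : Euc N | x ≠ 0}, u x ≠ 0 := fun x _ => (h.fst_pos x).ne'
  have hv' : ∀ x ∈ {x : Euc N | x ≠ 0}, v x ≠ 0 := fun x _ => (h.snd_pos x).ne'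
  have hn' : ∀ x ∈ {x : Euc N | x ≠ 0}, ‖x‖ ≠ 0 := fun x hx => norm_ne_zero_iff.2 hx
  have hcu := h.contDiffOn_fst.continuousOn
  have hcv := h.contDiffOn_snd.continuousOn
  have hcgu := h.contDiffOn_fst.continuousOn_gradient_punctured
  have hcgv := h.contDiffOn_snd.continuousOn_gradient_punctured
  unfold pohozaevDensity
  fun_prop (disch := assumption)

lemma setIntegral_annulus_pos (hN : 0 < N) {r s : ℝ} (hr : 0 < r) (hrs : r < s) {F : Euc N → ℝ}
    (hF : ContinuousOn F {x : Euc N | x ≠ 0}) (hF0 : ∀ x, x ≠ 0 → 0 < F x) :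
    0 < ∫ x in closedBall (0 : Euc N) s \ ball 0 r, F x := by
  have hK : IsCompact (closedBall (0 : Euc N) s \ ball 0 r) :=
    (isCompact_closedBall _ _).diff isOpen_ball
  have hK0 : closedBall (0 : Euc N) s \ ball 0 r ⊆ {x : Euc N | x ≠ 0} := by
    rintro x hx rfl
    exact hx.2 (mem_ball_self hr)
  rw [setIntegral_pos_iff_support_of_nonneg_ae
    ((ae_restrict_iff' hK.measurableSet).2 (ae_of_all _ fun x hx => (hF0 x (hK0 hx)).le))
    (hF.integrableOn_punctured hK hK0)]
  have hopen : IsOpen {x : Euc N | r < ‖x‖ ∧ ‖x‖ < s} :=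
    (isOpen_lt continuous_const continuous_norm).inter (isOpen_lt continuous_norm continuous_const)
  obtain ⟨t, hrt, hts⟩ := exists_between hrs
  have hne : {x : Euc N | r < ‖x‖ ∧ ‖x‖ < s}.Nonempty := by
    refine ⟨EuclideanSpace.single ⟨0, hN⟩ t, ?_⟩
    simp [abs_of_pos (hr.trans hrt), hrt, hts]
  refine (hopen.measure_pos volume hne).trans_le (measure_mono fun x hx => ?_)
  have hx0 : x ≠ 0 := norm_pos_iff.1 (hr.trans hx.1)
  refine ⟨(hF0 x hx0).ne', mem_closedBall_zero_iff.2 hx.2.le, ?_⟩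
  rw [mem_ball_zero_iff, not_lt]
  exact hx.1.le

end Conclusion

section Main

variable {N : ℕ} {p q a b C : ℝ} {u v : Euc N → ℝ}

lemma norm_mul_norm_gradient_comp_smul_le {τ ζ : Euc N → ℝ} {c t : ℝ} {k : ℕ} (ht : 0 < t)
    (hc : ∀ x, ‖x‖ * ‖gradient τ x‖ ≤ c * ζ x ^ k) (x : Euc N) :
    ‖x‖ * ‖gradient (fun y => τ (t • y)) x‖ ≤ c * ζ (t • x) ^ k := by
  have h1 : (fun y => τ (t • y)) = dilate 0 t τ := by
    funext y
    simp [dilate]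
  have h2 := hc (t • x)
  rw [norm_smul, Real.norm_of_nonneg ht.le] at h2
  rw [h1, gradient_dilate, Real.rpow_zero, one_mul, norm_smul, Real.norm_of_nonneg ht.le]
  linarith

lemma IsPosSol.integrable_density_mul_comp_smul (h : IsPosSol p q a b C u v) {K : Set (Euc N)}
    {ζ : Euc N → ℝ} (hK : IsCompact K) (hK0 : K ⊆ {x : Euc N | x ≠ 0}) (hζ : Continuous ζ)
    (hs : tsupport ζ ⊆ K) {t : ℝ} (ht : 0 < t) {k : ℕ} (hk : k ≠ 0) :
    Integrable fun x => pohozaevDensity p q a b u v x * ζ (t • x) ^ k := by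
  refine integrable_of_continuousOn_punctured (K := Set.image (fun x => t⁻¹ • x) K)
    (hK.image (continuous_const_smul _)) ?_ ?_ ?_
  · rintro _ ⟨x, hx, rfl⟩
    exact smul_ne_zero (inv_ne_zero ht.ne') (hK0 hx)
  · exact h.continuousOn_pohozaevDensity.mul
      ((hζ.comp (continuous_const_smul t)).pow k).continuousOn
  · intro x hx
    have : ζ (t • x) = 0 := by
      refine image_eq_zero_of_notMem_tsupport fun hx' => hx ⟨t • x, hs hx', ?_⟩
      simp [smul_smul, ht.ne']
    rw [this, zero_pow hk, mul_zero]

/-- The energy on a fixed annulus is controlled by the boundary terms near infinity and near the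
origin. -/
lemma IsPosSol.setIntegral_energy_le (h : IsPosSol p q a b C u v) (hp : 0 < p) (hq : 0 < q)
    (hσ : (N : ℝ) - 2 < (N + a) / (p + 1) + (N + b) / (q + 1)) {K : Set (Euc N)}
    {τ ζ : Euc N → ℝ} {r s c R : ℝ} {k : ℕ} (hk : k ≠ 0)
    (hK : IsCompact K) (hK0 : K ⊆ {x : Euc N | x ≠ 0}) (hζ : Continuous ζ) (hζ0 : ∀ x, 0 ≤ ζ x)
    (hs : tsupport ζ ⊆ K) (hτ : ContDiff ℝ 2 τ) (hτ0 : ∀ x, 0 ≤ τ x) (hτ1 : ∀ x, τ x ≤ 1)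
    (hτr : ∀ x, ‖x‖ ≤ r → τ x = 1) (hτs : ∀ x, s ≤ ‖x‖ → τ x = 0) (hr : 0 < r) (hrs : r < s)
    (hc0 : 0 ≤ c) (hc : ∀ x, ‖x‖ * ‖gradient τ x‖ ≤ c * ζ x ^ k) (hR1 : 1 ≤ R)
    (hR : s ≤ R * r) :
    ((N + a) / (p + 1) + (N + b) / (q + 1) - (N - 2)) *
        ∫ x in closedBall (0 : Euc N) s \ ball 0 r, ‖x‖ ^ b * u x ^ (q + 1) ≤
      (3 + |(N + a) / (p + 1)| + |2 - N + (N + a) / (p + 1)|) * (c *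
        ((∫ x, pohozaevDensity p q a b u v x * ζ (R⁻¹ • x) ^ k) +
          ∫ x, pohozaevDensity p q a b u v x * ζ (R • x) ^ k)) := by
  have hR0 : 0 < R := one_pos.trans_le hR1
  have hRi : 0 < R⁻¹ := inv_pos.2 hR0
  have hs0 : 0 < s := hr.trans hrs
  set χ : Euc N → ℝ := fun x => τ (R⁻¹ • x) - τ (R • x) with hχdef
  have hn : ∀ (t : ℝ) (x : Euc N), 0 < t → ‖t • x‖ = t * ‖x‖ := fun t x ht => by
    rw [norm_smul, Real.norm_of_nonneg ht.le]
  have hd : ∀ t : ℝ, ContDiff ℝ 1 fun x : Euc N => τ (t • x) := fun t =>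
    (hτ.of_le (by norm_num)).comp (contDiff_const_smul t)
  have hχ : ContDiff ℝ 1 χ := (hd _).sub (hd _)
  have hχ0 : ∀ x, 0 ≤ χ x := by
    intro x
    rcases le_total ‖R⁻¹ • x‖ r with hx | hx
    · simp only [χ, hτr _ hx, sub_nonneg, hτ1]
    · have : s ≤ ‖R • x‖ := by
        rw [hn _ _ hRi, inv_mul_eq_div, le_div_iff₀ hR0] at hx
        rw [hn _ _ hR0]
        nlinarith [mul_le_mul_of_nonneg_right hR1 (norm_nonneg x)]
      simp only [χ, hτs _ this, sub_zero, hτ0]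
  set K' : Set (Euc N) := closedBall 0 (R * s) \ ball 0 (R⁻¹ * r) with hK'def
  have hK' : IsCompact K' := (isCompact_closedBall _ _).diff isOpen_ball
  have hK'0 : K' ⊆ {x : Euc N | x ≠ 0} := by
    rintro x hx rfl
    exact hx.2 (mem_ball_self (by positivity))
  have hsub : closedBall (0 : Euc N) s \ ball 0 r ⊆ K' :=
    sdiff_subset_sdiff (closedBall_subset_closedBall (le_mul_of_one_le_left hs0.le hR1))
      (ball_subset_ball (mul_le_of_le_one_left hr.le (inv_le_one_of_one_le₀ hR1)))
  have hχs : tsupport χ ⊆ K' := by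
    refine closure_minimal (fun x hx => ?_) hK'.isClosed
    rw [mem_sdiff, mem_closedBall_zero_iff, mem_ball_zero_iff, not_lt]
    refine ⟨?_, ?_⟩
    · by_contra! hlt
      refine hx ?_
      have h1 : s ≤ ‖R⁻¹ • x‖ := by
        rw [hn _ _ hRi, inv_mul_eq_div, le_div_iff₀ hR0]
        linarith
      have h2 : s ≤ ‖R • x‖ := by
        rw [hn _ _ hR0]
        nlinarith [mul_le_mul_of_nonneg_right hR1 (norm_nonneg x),
          mul_le_mul_of_nonneg_right hR1 hs0.le]
      simp [χ, hτs _ h1, hτs _ h2]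
    · by_contra! hlt
      refine hx ?_
      have h2 : ‖R • x‖ ≤ r := by
        rw [inv_mul_eq_div, lt_div_iff₀ hR0] at hlt
        rw [hn _ _ hR0]
        linarith
      have h1 : ‖R⁻¹ • x‖ ≤ r := by
        rw [hn _ _ hRi]
        rw [hn _ _ hR0] at h2
        have := mul_le_mul_of_nonneg_right ((inv_le_one_of_one_le₀ hR1).trans hR1) (norm_nonneg x)
        linarith
      simp [χ, hτr _ h1, hτr _ h2]
  have hχ1 : ∀ x ∈ closedBall (0 : Euc N) s \ ball 0 r, χ x = 1 := by
    intro x hx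
    rw [mem_sdiff, mem_closedBall_zero_iff, mem_ball_zero_iff, not_lt] at hx
    have h1 : ‖R⁻¹ • x‖ ≤ r := by
      rw [hn _ _ hRi, inv_mul_eq_div, div_le_iff₀ hR0]
      linarith [hx.1]
    have h2 : s ≤ ‖R • x‖ := by
      rw [hn _ _ hR0]
      nlinarith [mul_le_mul_of_nonneg_left hx.2 hR0.le]
    simp [χ, hτr _ h1, hτs _ h2]
  have hu' : ∀ x ∈ {x : Euc N | x ≠ 0}, u x ≠ 0 := fun x _ => (h.fst_pos x).ne'
  have hn' : ∀ x ∈ {x : Euc N | x ≠ 0}, ‖x‖ ≠ 0 := fun x hx => norm_ne_zero_iff.2 hx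
  have hcu := h.contDiffOn_fst.continuousOn
  have hE : ContinuousOn (fun x => ‖x‖ ^ b * u x ^ (q + 1)) {x : Euc N | x ≠ 0} := by
    fun_prop (disch := assumption)
  have hE0 : ∀ x, 0 ≤ ‖x‖ ^ b * u x ^ (q + 1) := fun x => by
    have := h.fst_pos x
    positivity
  have hD := h.continuousOn_pohozaevDensity
  have hχE : ContinuousOn (fun x => χ x * (‖x‖ ^ b * u x ^ (q + 1))) {x : Euc N | x ≠ 0} :=
    hχ.continuous.continuousOn.mul hE
  have hζt : ∀ t : ℝ, Continuous fun x : Euc N => ζ (t • x) ^ k := fun t =>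
    (hζ.comp (continuous_const_smul t)).pow k
  have hinner : ∫ x in closedBall (0 : Euc N) s \ ball 0 r, ‖x‖ ^ b * u x ^ (q + 1) ≤
      ∫ x in K', χ x * (‖x‖ ^ b * u x ^ (q + 1)) := by
    have hm : MeasurableSet (closedBall (0 : Euc N) s \ ball 0 r) :=
      measurableSet_closedBall.diff measurableSet_ball
    rw [setIntegral_congr_fun hm (g := fun x => χ x * (‖x‖ ^ b * u x ^ (q + 1)))
      fun x hx => by simp only [hχ1 x hx, one_mul]]
    exact setIntegral_mono_set (hχE.integrableOn_punctured hK' hK'0)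
      (ae_of_all _ fun x => mul_nonneg (hχ0 x) (hE0 x)) hsub.eventuallyLE
  have hi : ∀ t : ℝ, 0 < t →
      Integrable fun x => pohozaevDensity p q a b u v x * ζ (t • x) ^ k := fun t ht =>
    h.integrable_density_mul_comp_smul hK hK0 hζ hs ht hk
  have hD0 : ∀ x, 0 ≤ pohozaevDensity p q a b u v x := pohozaevDensity_nonneg h.fst_pos h.snd_pos
  have hboundary : ∫ x in K', ‖x‖ * ‖gradient χ x‖ * pohozaevDensity p q a b u v x ≤
      c * ((∫ x, pohozaevDensity p q a b u v x * ζ (R⁻¹ • x) ^ k) +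
          ∫ x, pohozaevDensity p q a b u v x * ζ (R • x) ^ k) := by
    rw [← integral_add (hi _ hRi) (hi _ hR0), ← integral_const_mul]
    refine (setIntegral_mono_punctured hK' hK'0 ?_ ?_ ?_).trans
      (setIntegral_le_integral (((hi _ hRi).add (hi _ hR0)).const_mul c) ?_)
    · exact (continuous_norm.mul hχ.continuous_gradient.norm).continuousOn.mul hD
    · exact continuousOn_const.mul ((hD.mul (hζt _).continuousOn).add
        (hD.mul (hζt _).continuousOn))
    · intro x _
      have hg : gradient χ x = gradient (fun y => τ (R⁻¹ • y)) x -
          gradient (fun y => τ (R • y)) x := by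
        simp only [gradient, χ]
        rw [fderiv_fun_sub ((hd _).differentiable one_ne_zero x)
          ((hd _).differentiable one_ne_zero x), map_sub]
      have h1 := norm_mul_norm_gradient_comp_smul_le hRi hc x
      have h2 := norm_mul_norm_gradient_comp_smul_le hR0 hc x
      have h3 : ‖x‖ * ‖gradient χ x‖ ≤ c * ζ (R⁻¹ • x) ^ k + c * ζ (R • x) ^ k := by
        rw [hg]
        have := mul_le_mul_of_nonneg_left (norm_sub_le (gradient (fun y => τ (R⁻¹ • y)) x)
          (gradient (fun y => τ (R • y)) x)) (norm_nonneg x)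
        linarith
      have := mul_le_mul_of_nonneg_right h3 (hD0 x)
      linarith
    · refine ae_of_all _ fun x => mul_nonneg hc0 (add_nonneg ?_ ?_)
      · exact mul_nonneg (hD0 x) (pow_nonneg (hζ0 _) _)
      · exact mul_nonneg (hD0 x) (pow_nonneg (hζ0 _) _)
  refine (mul_le_mul_of_nonneg_left hinner (sub_pos.2 hσ).le).trans
    ((h.pohozaev_le hp hq hK' hK'0 hχ hχs rfl).trans
      (mul_le_mul_of_nonneg_left hboundary (by positivity)))

lemma IsPosSol.false_of_stable (h : IsPosSol p q a b C u v) (hN : 3 ≤ N) (hq : 0 < q)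
    (hqp : q ≤ p) (h1pq : 1 < p * q) (hpq : (p + 1) * (q + 1) < 4 * (p * q)) (ha : -2 < a)
    (hb : -2 < b) (hσ : (N : ℝ) - 2 < (N + a) / (p + 1) + (N + b) / (q + 1)) (hC : 0 < C)
    (hu : Continuous u) (hv : Continuous v) {R₀ R₅ Rstar : ℝ} (hR₀ : 0 < R₀) (hR : R₀ < R₅)
    (hRs : 0 < Rstar) (hst : ∀ R, Rstar ≤ R → StabilityOn p q a b u v
      (ball (0 : Euc N) (R * R₅) \ closure (ball (0 : Euc N) (R * R₀)))) : False := by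
  have hp : 0 < p := hq.trans_le hqp
  have hpq1 : 0 < p * q - 1 := sub_pos.2 h1pq
  set α : ℝ := (2 * (p + 1) + a + b * p) / (p * q - 1) with hαdef
  set β : ℝ := (2 * (q + 1) + b + a * q) / (p * q - 1) with hβdef
  have hα : α + 2 = p * β - a := by
    rw [hαdef, hβdef]
    field_simp
    ring
  have hβ : β + 2 = q * α - b := by
    refine mul_right_cancel₀ hpq1.ne' ?_
    have h1 : α * (p * q - 1) = 2 * (p + 1) + a + b * p := div_mul_cancel₀ _ hpq1.ne'
    have h2 : β * (p * q - 1) = 2 * (q + 1) + b + a * q := div_mul_cancel₀ _ hpq1.ne'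
    linear_combination h2 - q * h1
  have hNS : (N : ℝ) < α + β + 2 := by
    have h1 : (N + a) / (p + 1) = β + (N - (α + β + 2)) / (p + 1) := by
      rw [div_eq_iff (by positivity), add_mul, div_mul_cancel₀ _ (by positivity)]
      linarith
    have h2 : (N + b) / (q + 1) = α + (N - (α + β + 2)) / (q + 1) := by
      rw [div_eq_iff (by positivity), add_mul, div_mul_cancel₀ _ (by positivity)]
      linarith
    rw [h1, h2] at hσ
    have h3 : 1 / (p + 1) + 1 / (q + 1) < 1 := by
      rw [div_add_div _ _ (by positivity) (by positivity), div_lt_one (by positivity)]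
      nlinarith
    have h4 : 0 < (N - (α + β + 2)) * (1 / (p + 1) + 1 / (q + 1) - 1) := by
      have : (N - (α + β + 2)) * (1 / (p + 1) + 1 / (q + 1) - 1) =
        (N - (α + β + 2)) / (p + 1) + (N - (α + β + 2)) / (q + 1) - (N - (α + β + 2)) := by ring
      rw [this]
      linarith
    by_contra! hle
    have := mul_nonneg (sub_nonneg.2 hle) (sub_nonneg.2 h3.le)
    linarith
  obtain ⟨K, τ, ζ, r, s, c, hK, hKA, hζ, hζ0, hζ1, hs, hτ, hτ0, hτ1, hτr, hτs, hr, hrs, hc0, hc⟩ :=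
    exists_cutoffs N hR₀ hR
  have hK0 : K ⊆ {x : Euc N | x ≠ 0} := by
    rintro x hx rfl
    exact (hKA hx).2 (subset_closure (mem_ball_self hR₀))
  obtain ⟨m, B, hB⟩ := exists_integral_density_le_of_stable hq hqp h1pq hpq hC hα hβ hR₀ hRs hK hKA
    hζ hζ0 hζ1 hs h hst
  obtain ⟨B', hB'⟩ := exists_integral_density_le_of_continuous hN hp hq ha hb hK hK0 hζ hζ0 hζ1 hs
    h hu hv m
  set L : ℝ := 3 + |(N + a) / (p + 1)| + |2 - N + (N + a) / (p + 1)| with hL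
  have hL0 : 0 ≤ L := by positivity
  have hu' : ∀ x ∈ {x : Euc N | x ≠ 0}, u x ≠ 0 := fun x _ => (h.fst_pos x).ne'
  have hn' : ∀ x ∈ {x : Euc N | x ≠ 0}, ‖x‖ ≠ 0 := fun x hx => norm_ne_zero_iff.2 hx
  have hpos : 0 < ∫ x in closedBall (0 : Euc N) s \ ball 0 r, ‖x‖ ^ b * u x ^ (q + 1) := by
    refine setIntegral_annulus_pos (by omega) hr hrs ?_ fun x hx => ?_
    · have hcu := hu.continuousOn (s := {x : Euc N | x ≠ 0})
      fun_prop (disch := assumption)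
    · exact mul_pos (Real.rpow_pos_of_pos (norm_pos_iff.2 hx) _)
        (Real.rpow_pos_of_pos (h.fst_pos x) _)
  have hlim : Filter.Tendsto (fun R : ℝ => L * (c * (B * R ^ ((N : ℝ) - (α + β + 2)) + B' * R⁻¹)))
      Filter.atTop (nhds (L * (c * (B * 0 + B' * 0)))) := by
    have h1 := tendsto_rpow_neg_atTop (sub_pos.2 hNS)
    rw [neg_sub] at h1
    exact (((h1.const_mul B).add (tendsto_inv_atTop_zero.const_mul B')).const_mul c).const_mul L
  have hle := ge_of_tendsto hlim (b := ((N + a) / (p + 1) + (N + b) / (q + 1) - (N - 2)) *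
        ∫ x in closedBall (0 : Euc N) s \ ball 0 r, ‖x‖ ^ b * u x ^ (q + 1)) (by
    filter_upwards [Filter.eventually_ge_atTop Rstar, Filter.eventually_ge_atTop 1,
      Filter.eventually_ge_atTop (s / r)] with R h1 h2 h3
    have hR0 : 0 < R := one_pos.trans_le h2
    refine (h.setIntegral_energy_le hp hq hσ (k := 2 * (m + 1)) (by omega) hK hK0 hζ.continuous hζ0
      hs hτ hτ0 hτ1 hτr hτs hr hrs hc0 (fun x => hc x _) h2 ((div_le_iff₀ hr).1 h3)).trans ?_
    have h4 := hB' R⁻¹ (inv_pos.2 hR0) (inv_le_one_of_one_le₀ h2)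
    rw [inv_inv] at h4
    exact mul_le_mul_of_nonneg_left (mul_le_mul_of_nonneg_left (add_le_add (hB R h1) h4) hc0) hL0)
  have := mul_pos (sub_pos.2 hσ) hpos
  simp only [mul_zero, add_zero] at hle
  linarith

end Main

lemma abs_rpow_sub_one_mul_self {x : ℝ} (hx : 0 < x) (r : ℝ) : |x| ^ (r - 1) * x = x ^ r := by
  rw [abs_of_pos hx, Real.rpow_sub_one hx.ne', div_mul_cancel₀ _ hx.ne']

/-- Theorem 3.22: Liouville theorem for positive solutions of the subcritical
Hénon–Lane–Emden system satisfying the comparison estimate and the stability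
inequality (3.36) on large annuli. -/
theorem stmt_12 (N : ℕ) (hN : 3 ≤ N) (p q a b : ℝ)
    (hq : 1 / 3 < q) (hqp : q ≤ p) (hp' : (q + 1) / (3 * q - 1) < p)
    (ha : -2 < a) (hb : -2 < b)
    (hsub : ((N : ℝ) + a) / (p + 1) + ((N : ℝ) + b) / (q + 1) > (N : ℝ) - 2)
    (u v : Euc N → ℝ) (hsol : IsHLESol p q a b u v)
    (hu : ∀ x, 0 < u x) (hv : ∀ x, 0 < v x)
    (C : ℝ) (hC : 0 < C)
    (hcomp : ∀ x : Euc N, x ≠ 0 → ‖x‖ ^ a * v x ^ (p + 1) ≤ C * (‖x‖ ^ b * u x ^ (q + 1)))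
    (R₀ R₅ Rstar : ℝ) (hR0 : 0 < R₀) (hR05 : R₀ < R₅) (hRstar : 0 < Rstar)
    (hstab : ∀ R : ℝ, Rstar ≤ R → ∀ φ : Euc N → ℝ,
      ContDiff ℝ 2 φ → HasCompactSupport φ →
      tsupport φ ⊆ ball (0 : Euc N) (R * R₅) \ closure (ball (0 : Euc N) (R * R₀)) →
      Real.sqrt (p * q) *
          ∫ x : Euc N, ‖x‖ ^ ((a + b) / 2) * u x ^ ((q - 1) / 2) * v x ^ ((p - 1) / 2) * φ x ^ 2
        ≤ ∫ x : Euc N, ‖gradient φ x‖ ^ 2) :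
    ∀ x, u x = 0 ∧ v x = 0 := by
  have hq0 : 0 < q := by linarith
  have hpq := (div_lt_iff₀ (by linarith : (0 : ℝ) < 3 * q - 1)).1 hp'
  obtain ⟨hu2, hv2, huc, hvc, h1, h2⟩ := hsol
  have h : IsPosSol p q a b C u v :=
    { contDiffOn_fst := hu2
      contDiffOn_snd := hv2
      fst_pos := hu
      snd_pos := hv
      lap_fst := fun x hx => by rw [h1 x hx, abs_rpow_sub_one_mul_self (hv x)]
      lap_snd := fun x hx => by rw [h2 x hx, abs_rpow_sub_one_mul_self (hu x)]
      comparison := hcomp }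
  exact (h.false_of_stable hN hq0 hqp (by nlinarith) (by nlinarith) ha hb hsub hC huc hvc hR0 hR05
    hRstar hstab).elim
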